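/- arXiv:math/0512419 — 2 statements merged into one kernel-verified Lean document; each statement's English description precedes it below -/
import Mathlib

section
/- If x, y, z are integers with gcd(x, y) = 1 satisfying 4x⁶ + 57x⁴y² + 156x²y⁴ + 4y⁶ = z², then x = 0 or y = 0. (Equivalently, every rational point on the curve C₄ : Y² = X⁶ + (57/4)X⁴ + 39X² + 1 has X-coordinate 0 or lies at infinity.) -/
open scoped QuadraticAlgebra

/-- The ring `ℤ[√2, ζ₃]`, as `ℤ[√2][w]` with `w ^ 2 = -1 - w`. -/
abbrev O : Type := QuadraticAlgebra (QuadraticAlgebra ℤ 2 0) (-1) (-1)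

namespace O

/-- The square root of two in `O`. -/
def t : O := ⟨⟨0, 1⟩, 0⟩

/-- The primitive cube root of unity in `O`. -/
def w : O := ⟨0, 1⟩

/-- The element `a + b√2 + (c + d√2) w` of `O`. -/
def mk (a b c d : ℤ) : O := ⟨⟨a, b⟩, ⟨c, d⟩⟩

lemma t_sq : t ^ 2 = 2 := by
  ext <;> simp [t, sq]

lemma w_sq : w ^ 2 = -1 - w := by
  ext <;> simp [w, sq]

lemma mk_eq (a b c d : ℤ) : mk a b c d = a + b * t + (c + d * t) * w := by
  ext <;> simp [mk, t, w]

lemma exists_mk (x : O) : ∃ a b c d : ℤ, x = mk a b c d := ⟨_, _, _, _, rfl⟩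

lemma mk_inj {a b c d a' b' c' d' : ℤ} :
    mk a b c d = mk a' b' c' d' ↔ a = a' ∧ b = b' ∧ c = c' ∧ d = d' := by
  simp [mk, QuadraticAlgebra.ext_iff, and_assoc]

lemma mk_mul (a b c d a' b' c' d' : ℤ) : mk a b c d * mk a' b' c' d' =
    mk (a * a' + 2 * b * b' - c * c' - 2 * d * d') (a * b' + b * a' - c * d' - d * c')
      (a * c' + 2 * b * d' + c * a' + 2 * d * b' - c * c' - 2 * d * d')
      (a * d' + b * c' + c * b' + d * a' - c * d' - d * c') := by
  ext <;> simp [mk] <;> ring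

lemma mk_sub (a b c d a' b' c' d' : ℤ) : mk a b c d - mk a' b' c' d' =
    mk (a - a') (b - b') (c - c') (d - d') := by
  ext <;> simp [mk]

lemma intCast_eq_mk (n : ℤ) : (n : O) = mk n 0 0 0 := by
  ext <;> simp [mk]

/-- The absolute norm of `O` over `ℤ`. -/
def nm : O →* ℤ := QuadraticAlgebra.norm.comp QuadraticAlgebra.norm

lemma nm_mk (a b c d : ℤ) : nm (mk a b c d) =
    ((a ^ 2 - a * c + c ^ 2) - 2 * (b ^ 2 - b * d + d ^ 2)) ^ 2 + 6 * (a * d - b * c) ^ 2 := by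
  simp [nm, mk, QuadraticAlgebra.norm_def]
  ring

lemma nm_nonneg (x : O) : 0 ≤ nm x := by
  obtain ⟨a, b, c, d, rfl⟩ := exists_mk x
  rw [nm_mk]
  positivity

lemma nm_intCast (n : ℤ) : nm n = n ^ 4 := by
  rw [intCast_eq_mk, nm_mk]
  ring

lemma eq_zero_of_sq_eq_mul_sq {k a b : ℤ} (hk : ∀ n : ℤ, k ≠ n * n) (h : a ^ 2 = k * b ^ 2) :
    a = 0 ∧ b = 0 := by
  have := (Zsqrtd.norm_eq_zero hk ⟨a, b⟩).mp (by simp only [Zsqrtd.norm_def]; linarith)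
  simpa [Zsqrtd.ext_iff] using this

lemma nonsquare_two (n : ℤ) : 2 ≠ n * n := by
  intro h
  have h1 : n < 2 := by nlinarith
  have h2 : -2 < n := by nlinarith
  interval_cases n <;> omega

lemma nonsquare_three (n : ℤ) : 3 ≠ n * n := by
  intro h
  have h1 : n < 2 := by nlinarith
  have h2 : -2 < n := by nlinarith
  interval_cases n <;> omega

lemma eq_zero_of_eisenstein_eq_zero {a c : ℤ} (h : a ^ 2 - a * c + c ^ 2 = 0) :
    a = 0 ∧ c = 0 :=
  ⟨by nlinarith [sq_nonneg (a - 2 * c)], by nlinarith [sq_nonneg (2 * a - c)]⟩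

lemma eisenstein_nonneg (a c : ℤ) : 0 ≤ a ^ 2 - a * c + c ^ 2 := by
  nlinarith [sq_nonneg (a - 2 * c)]

lemma nm_mk' (a b c d : ℤ) : nm (mk a b c d) =
    ((a ^ 2 - a * c + c ^ 2) + 2 * (b ^ 2 - b * d + d ^ 2)) ^ 2 -
      2 * (2 * a * b - a * d - b * c + 2 * c * d) ^ 2 := by
  rw [nm_mk]
  ring

lemma nm_eq_zero {x : O} : nm x = 0 ↔ x = 0 := by
  refine ⟨fun h ↦ ?_, fun h ↦ by subst h; simpa using nm_intCast 0⟩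
  obtain ⟨a, b, c, d, rfl⟩ := exists_mk x
  rw [nm_mk', sub_eq_zero] at h
  have h0 := (eq_zero_of_sq_eq_mul_sq nonsquare_two h).1
  have h1 := eisenstein_nonneg a c
  have h2 := eisenstein_nonneg b d
  obtain ⟨rfl, rfl⟩ := eq_zero_of_eisenstein_eq_zero (a := a) (c := c) (by linarith)
  obtain ⟨rfl, rfl⟩ := eq_zero_of_eisenstein_eq_zero (a := b) (c := d) (by linarith)
  rfl

lemma nm_pos {x : O} (hx : x ≠ 0) : 0 < nm x :=
  (nm_nonneg x).lt_of_ne' (nm_eq_zero.not.mpr hx)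

instance : NoZeroDivisors O where
  eq_zero_or_eq_zero_of_mul_eq_zero {x y} h := by
    rw [← nm_eq_zero, map_mul, mul_eq_zero] at h
    exact h.imp nm_eq_zero.mp nm_eq_zero.mp

instance : IsDomain O := NoZeroDivisors.to_isDomain O

lemma three_mul_eisenstein_le {m x y : ℤ} (h1 : |2 * x - y| ≤ m) (h2 : |2 * y - x| ≤ m)
    (h3 : |x + y| ≤ m) : 3 * (x ^ 2 - x * y + y ^ 2) ≤ m ^ 2 := by
  have e1 := sq_le_sq' (abs_le.mp h1).1 (abs_le.mp h1).2
  have e2 := sq_le_sq' (abs_le.mp h2).1 (abs_le.mp h2).2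
  have e3 := sq_le_sq' (abs_le.mp h3).1 (abs_le.mp h3).2
  have key : 3 * (x ^ 2 - x * y + y ^ 2) =
    (2 * x - y) * (x + y) + (2 * y - x) ^ 2 := by ring
  rcases le_total 0 (2 * x - y) with ha | ha <;> rcases le_total 0 (2 * y - x) with hb | hb
  · nlinarith [mul_nonneg ha hb]
  · rcases le_total 0 (x + y) with hc | hc
    · nlinarith [mul_nonneg hc (sub_nonneg.mpr hb)]
    · nlinarith [mul_nonneg ha (sub_nonneg.mpr hc)]
  · rcases le_total 0 (x + y) with hc | hc
    · nlinarith [mul_nonneg hc (sub_nonneg.mpr ha)]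
    · nlinarith [mul_nonneg hb (sub_nonneg.mpr hc)]
  · nlinarith [mul_nonneg (sub_nonneg.mpr ha) (sub_nonneg.mpr hb)]

lemma exists_three_mul_eisenstein_le {m : ℤ} (hm : 0 < m) (a c : ℤ) : ∃ p q : ℤ,
    3 * ((a - m * p) ^ 2 - (a - m * p) * (c - m * q) + (c - m * q) ^ 2) ≤ m ^ 2 := by
  have ha := Int.emod_add_mul_ediv a m
  have ha0 := Int.emod_nonneg a hm.ne'
  have ha1 := Int.emod_lt_of_pos a hm
  have hc := Int.emod_add_mul_ediv c m
  have hc0 := Int.emod_nonneg c hm.ne'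
  have hc1 := Int.emod_lt_of_pos c hm
  generalize a % m = r at *
  generalize c % m = s at *
  generalize a / m = k at *
  generalize c / m = l at *
  subst ha hc
  have key (i j : ℤ) (h1 : |2 * (r - m * i) - (s - m * j)| ≤ m)
      (h2 : |2 * (s - m * j) - (r - m * i)| ≤ m) (h3 : |(r - m * i) + (s - m * j)| ≤ m) :
      ∃ p q : ℤ, 3 * ((r + m * k - m * p) ^ 2 - (r + m * k - m * p) * (s + m * l - m * q) +
        (s + m * l - m * q) ^ 2) ≤ m ^ 2 := by
    refine ⟨k + i, l + j, ?_⟩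
    convert three_mul_eisenstein_le h1 h2 h3 using 1
    ring
  simp only [abs_le] at key
  by_cases h1 : m ≤ 2 * s - r ∧ 2 * r ≤ s
  · exact key 0 1 (by omega) (by omega) (by omega)
  by_cases h2 : m ≤ 2 * r - s ∧ 2 * s ≤ r
  · exact key 1 0 (by omega) (by omega) (by omega)
  by_cases h3 : r + s ≤ m
  · exact key 0 0 (by omega) (by omega) (by omega)
  · exact key 1 1 (by omega) (by omega) (by omega)

lemma exists_mul_eq_nm (y : O) : ∃ y' : O, y * y' = nm y := by
  refine ⟨star y * algebraMap _ O (star (QuadraticAlgebra.norm y)), ?_⟩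
  rw [← mul_assoc, ← QuadraticAlgebra.algebraMap_norm_eq_mul_star, ← map_mul,
    ← QuadraticAlgebra.algebraMap_norm_eq_mul_star]
  rfl

lemma nm_mk_lt {m a b c d : ℤ} (hm : 0 < m) (h1 : 3 * (a ^ 2 - a * c + c ^ 2) ≤ m ^ 2)
    (h2 : 3 * (b ^ 2 - b * d + d ^ 2) ≤ m ^ 2) : nm (mk a b c d) < m ^ 4 := by
  have h3 := eisenstein_nonneg a c
  have h4 := eisenstein_nonneg b d
  have h5 := nm_mk a b c d
  have h6 := nm_mk' a b c d
  generalize a ^ 2 - a * c + c ^ 2 = A at *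
  generalize b ^ 2 - b * d + d ^ 2 = B at *
  generalize 2 * a * b - a * d - b * c + 2 * c * d = F at *
  generalize a * d - b * c = E at *
  by_contra! h
  rw [show m ^ 4 = (m ^ 2) ^ 2 by ring] at h
  have hm2 : 0 < m ^ 2 := by positivity
  generalize m ^ 2 = M at *
  have hM : M ≤ A + 2 * B := by
    apply le_of_sq_le_sq _ (by linarith)
    nlinarith [sq_nonneg F]
  obtain rfl : A = B := by linarith
  have := (eq_zero_of_sq_eq_mul_sq (a := 2 * A) (b := E) nonsquare_three (by
    obtain rfl : M = 3 * A := by linarith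
    nlinarith [sq_nonneg F])).1
  linarith

lemma exists_nm_sub_mul_lt (x : O) {y : O} (hy : y ≠ 0) : ∃ q, nm (x - y * q) < nm y := by
  obtain ⟨y', hy'⟩ := exists_mul_eq_nm y
  have hm := nm_pos hy
  obtain ⟨a, b, c, d, h⟩ := exists_mk (x * y')
  obtain ⟨p, r, h1⟩ := exists_three_mul_eisenstein_le hm a c
  obtain ⟨q, s, h2⟩ := exists_three_mul_eisenstein_le hm b d
  refine ⟨mk p q r s, ?_⟩
  have : nm ((x - y * mk p q r s) * y') < nm (y * y') := by
    rw [hy', nm_intCast, sub_mul, mul_right_comm, hy', h, intCast_eq_mk, mk_mul, mk_sub]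
    simp only [zero_mul, mul_zero, add_zero, sub_zero]
    exact nm_mk_lt hm h1 h2
  rw [map_mul, map_mul] at this
  exact lt_of_mul_lt_mul_right this (nm_nonneg _)

instance : IsPrincipalIdealRing O := by
  classical
  refine ⟨fun I ↦ ?_⟩
  by_cases hI : I = ⊥
  · exact ⟨0, by simpa using hI⟩
  obtain ⟨x, hxI, hx⟩ := Submodule.exists_mem_ne_zero_of_ne_bot hI
  have hex : ∃ n : ℕ, ∃ y ∈ I, y ≠ 0 ∧ (nm y).toNat = n := ⟨_, x, hxI, hx, rfl⟩
  obtain ⟨y, hyI, hy, hyn⟩ := Nat.find_spec hex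
  refine ⟨y, le_antisymm (fun z hz ↦ ?_) (by simpa using hyI)⟩
  obtain ⟨q, hq⟩ := exists_nm_sub_mul_lt z hy
  have hmem : z - y * q ∈ I := I.sub_mem hz (I.mul_mem_right _ hyI)
  have h0 : z - y * q = 0 := by
    by_contra h0
    have := Nat.find_min' hex ⟨_, hmem, h0, rfl⟩
    have := nm_nonneg (z - y * q)
    omega
  exact Ideal.mem_span_singleton.mpr ⟨q, sub_eq_zero.mp h0⟩

/-- The fundamental unit `1 + √2`. -/
def eps : O := 1 + t

lemma eps_eq_mk : eps = mk 1 1 0 0 := by rw [eps, mk_eq]; push_cast; ring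

lemma w_eq_mk : w = mk 0 0 1 0 := by rw [mk_eq]; push_cast; ring

lemma eps_mul : eps * (t - 1) = 1 := by
  rw [eps]
  linear_combination t_sq

lemma w_cube : w ^ 3 = 1 := by linear_combination (w - 1) * w_sq

lemma isUnit_w : IsUnit w := .of_mul_eq_one (w ^ 2) (by rw [← w_cube]; ring)

lemma isUnit_eps : IsUnit eps := .of_mul_eq_one _ eps_mul

lemma nm_eq_one {u : O} (hu : IsUnit u) : nm u = 1 := by
  have := Int.isUnit_iff.mp (hu.map nm)
  have := nm_nonneg u
  omega

lemma eq_of_eisenstein_eq_one {a c : ℤ} (h : a ^ 2 - a * c + c ^ 2 = 1) :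
    (a = 1 ∧ c = 0) ∨ (a = -1 ∧ c = 0) ∨ (a = 0 ∧ c = 1) ∨ (a = 0 ∧ c = -1) ∨
      (a = 1 ∧ c = 1) ∨ (a = -1 ∧ c = -1) := by
  have h1 : a ≤ 1 := by nlinarith [sq_nonneg (a - 2 * c)]
  have h2 : -1 ≤ a := by nlinarith [sq_nonneg (a - 2 * c)]
  have h3 : c ≤ 1 := by nlinarith [sq_nonneg (2 * a - c)]
  have h4 : -1 ≤ c := by nlinarith [sq_nonneg (2 * a - c)]
  interval_cases a <;> interval_cases c <;> simp_all

/-- The element `u` is `w ^ i * eps ^ j` times the cube of a unit, with `i, j < 3`. -/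
def IsReduced (u : O) : Prop :=
  ∃ i < 3, ∃ j < 3, ∃ v : O, IsUnit v ∧ u = w ^ i * eps ^ j * v ^ 3

lemma IsReduced.mul_eps {u : O} (h : IsReduced u) : IsReduced (u * eps) := by
  obtain ⟨i, hi, j, hj, v, hv, rfl⟩ := h
  obtain hj | rfl : j + 1 < 3 ∨ j = 2 := by omega
  · exact ⟨i, hi, j + 1, hj, v, hv, by ring⟩
  · exact ⟨i, hi, 0, by norm_num, v * eps, hv.mul isUnit_eps, by ring⟩

lemma IsReduced.of_mul_eps {u : O} (h : IsReduced (u * eps)) : IsReduced u := by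
  have h3 : IsReduced (u * eps ^ 3) := by
    convert h.mul_eps.mul_eps using 1
    ring
  obtain ⟨i, hi, j, hj, v, hv, h⟩ := h3
  refine ⟨i, hi, j, hj, v * (t - 1), hv.mul (.of_mul_eq_one_right _ eps_mul), ?_⟩
  calc u = (u * eps ^ 3) * (t - 1) ^ 3 := by
        rw [mul_assoc, ← mul_pow, eps_mul, one_pow, mul_one]
    _ = _ := by rw [h]; ring

lemma isReduced_mk (n : ℕ) : ∀ a b c d : ℤ, nm (mk a b c d) = 1 →
    a ^ 2 - a * c + c ^ 2 + 2 * (b ^ 2 - b * d + d ^ 2) < n → IsReduced (mk a b c d) := by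
  induction n with
  | zero =>
    intro a b c d _ h
    have := eisenstein_nonneg a c
    have := eisenstein_nonneg b d
    omega
  | succ n ih =>
    intro a b c d h hn
    push_cast at hn
    have hA := eisenstein_nonneg a c
    have hB := eisenstein_nonneg b d
    have h1 := nm_mk' a b c d
    rw [h] at h1
    rcases lt_trichotomy (2 * a * b - a * d - b * c + 2 * c * d) 0 with h0 | h0 | h0
    · apply IsReduced.of_mul_eps
      rw [eps_eq_mk, mk_mul]
      apply ih
      · rw [← mk_mul, ← eps_eq_mk, map_mul, h, nm_eq_one isUnit_eps, one_mul]
      · ring_nf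
        have : a ^ 2 - a * c + c ^ 2 + 2 * (b ^ 2 - b * d + d ^ 2) <
          -2 * (2 * a * b - a * d - b * c + 2 * c * d) := by
          apply lt_of_pow_lt_pow_left₀ 2 (by linarith)
          nlinarith
        linarith
    · rw [h0] at h1
      have h2 : (a ^ 2 - a * c + c ^ 2) + 2 * (b ^ 2 - b * d + d ^ 2) = 1 := by nlinarith
      obtain ⟨rfl, rfl⟩ := eq_zero_of_eisenstein_eq_zero (a := b) (c := d) (by omega)
      have h3 : ((-1 : ℤ) : O) = -1 := by push_cast; rfl
      rcases eq_of_eisenstein_eq_one (a := a) (c := c) (by omega) with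
        ⟨rfl, rfl⟩ | ⟨rfl, rfl⟩ | ⟨rfl, rfl⟩ | ⟨rfl, rfl⟩ | ⟨rfl, rfl⟩ | ⟨rfl, rfl⟩
      · exact ⟨0, by norm_num, 0, by norm_num, 1, isUnit_one, by rw [mk_eq]; push_cast; ring⟩
      · exact ⟨0, by norm_num, 0, by norm_num, -1, isUnit_one.neg, by
          rw [mk_eq]; push_cast; ring⟩
      · exact ⟨1, by norm_num, 0, by norm_num, 1, isUnit_one, by rw [mk_eq]; push_cast; ring⟩
      · exact ⟨1, by norm_num, 0, by norm_num, -1, isUnit_one.neg, by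
          rw [mk_eq]; push_cast; ring⟩
      · exact ⟨2, by norm_num, 0, by norm_num, -1, isUnit_one.neg, by
          rw [mk_eq]; push_cast; linear_combination w_sq⟩
      · exact ⟨2, by norm_num, 0, by norm_num, 1, isUnit_one, by
          rw [mk_eq]; push_cast; linear_combination -w_sq⟩
    · have h4 : mk a b c d = mk (2 * b - a) (a - b) (2 * d - c) (c - d) * eps := by
        rw [eps_eq_mk, mk_mul, mk_inj]
        refine ⟨?_, ?_, ?_, ?_⟩ <;> ring
      rw [h4]
      apply IsReduced.mul_eps
      apply ih
      · rw [← h, h4, map_mul, nm_eq_one isUnit_eps, mul_one]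
      · ring_nf
        have : a ^ 2 - a * c + c ^ 2 + 2 * (b ^ 2 - b * d + d ^ 2) <
          2 * (2 * a * b - a * d - b * c + 2 * c * d) := by
          apply lt_of_pow_lt_pow_left₀ 2 (by linarith)
          nlinarith
        linarith

lemma isReduced_of_isUnit {u : O} (hu : IsUnit u) : IsReduced u := by
  obtain ⟨a, b, c, d, rfl⟩ := exists_mk u
  refine isReduced_mk ((a ^ 2 - a * c + c ^ 2 + 2 * (b ^ 2 - b * d + d ^ 2)).toNat + 1) a b c d
    (nm_eq_one hu) ?_
  push_cast
  exact Int.lt_add_one_iff.mpr (Int.self_le_toNat _)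

/-- The coprime factors of a unit multiple of a cube are, up to units, cubes. -/
lemma exists_eq_unit_mul_cube {a b z u : O} (hab : IsCoprime a b) (hu : IsUnit u)
    (h : a * b = u * z ^ 3) : ∃ i < 3, ∃ j < 3, ∃ c, a = w ^ i * eps ^ j * c ^ 3 := by
  obtain ⟨d, u', hd⟩ := exists_associated_pow_of_associated_pow_mul (c := z) (k := 3) hab
    (by rw [h]; exact (associated_unit_mul_left _ _ hu).symm)
  obtain ⟨i, hi, j, hj, v, -, hv⟩ := isReduced_of_isUnit u'.isUnit
  exact ⟨i, hi, j, hj, d * v, by rw [← hd, hv]; ring⟩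

/-- The prime `1 - w` above `3`. -/
def lam : O := 1 - w

lemma lam_sq : lam ^ 2 = -3 * w := by
  rw [lam]
  linear_combination w_sq

lemma three_eq : (3 : O) = -w ^ 2 * lam ^ 2 := by
  rw [lam_sq]
  linear_combination -3 * w_cube

lemma lam_mul_mk (a b c d : ℤ) :
    lam * mk a b c d = mk (a + c) (b + d) (2 * c - a) (2 * d - b) := by
  rw [lam, mk_eq, mk_eq]
  push_cast
  linear_combination (-c - d * t) * w_sq

lemma lam_dvd_mk {a b c d : ℤ} : lam ∣ mk a b c d ↔ 3 ∣ a + c ∧ 3 ∣ b + d := by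
  constructor
  · rintro ⟨x, hx⟩
    obtain ⟨p, q, r, s, rfl⟩ := exists_mk x
    rw [lam_mul_mk, mk_inj] at hx
    omega
  · rintro ⟨⟨r, hr⟩, ⟨s, hs⟩⟩
    refine ⟨mk (a - r) (b - s) r s, ?_⟩
    rw [lam_mul_mk, mk_inj]
    omega

lemma of_lam_sq_dvd_mk {a b c d : ℤ} (h : lam ^ 2 ∣ mk a b c d) : 3 ∣ c ∧ 3 ∣ d := by
  obtain ⟨x, hx⟩ := h
  obtain ⟨p, q, r, s, rfl⟩ := exists_mk x
  rw [pow_two, mul_assoc, lam_mul_mk, lam_mul_mk, mk_inj] at hx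
  omega

lemma of_lam_cube_dvd_mk {a b c d : ℤ} (h : lam ^ 3 ∣ mk a b c d) :
    3 ∣ c ∧ 3 ∣ d ∧ 9 ∣ b + d := by
  obtain ⟨x, hx⟩ := h
  obtain ⟨p, q, r, s, rfl⟩ := exists_mk x
  rw [pow_succ, pow_two, mul_assoc, mul_assoc, lam_mul_mk, lam_mul_mk, lam_mul_mk, mk_inj] at hx
  omega

lemma three_dvd_sq_add_sq {a b : ℤ} : 3 ∣ a ^ 2 + b ^ 2 ↔ 3 ∣ a ∧ 3 ∣ b := by
  rw [← Nat.cast_ofNat, ← ZMod.intCast_zmod_eq_zero_iff_dvd, ← ZMod.intCast_zmod_eq_zero_iff_dvd,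
    ← ZMod.intCast_zmod_eq_zero_iff_dvd]
  push_cast
  generalize (a : ZMod 3) = x
  generalize (b : ZMod 3) = y
  revert x y
  decide

lemma lam_dvd_iff_nm {x : O} : lam ∣ x ↔ 3 ∣ nm x := by
  obtain ⟨a, b, c, d, rfl⟩ := exists_mk x
  have h : nm (mk a b c d) = ((a + c) ^ 2 + (b + d) ^ 2) ^ 2 + 3 * (2 * (a * d - b * c) ^ 2 -
      2 * ((a + c) ^ 2 + (b + d) ^ 2) * (a * c + b ^ 2 + d ^ 2) +
      3 * (a * c + b ^ 2 + d ^ 2) ^ 2) := by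
    rw [nm_mk]
    ring
  rw [lam_dvd_mk, h, ← three_dvd_sq_add_sq, dvd_add_left (dvd_mul_right _ _),
    Int.prime_three.dvd_pow_iff_dvd two_ne_zero]

lemma prime_lam : Prime lam := by
  have h0 : lam = mk 1 0 (-1) 0 := by
    rw [mk_eq, lam]
    push_cast
    ring
  have h9 : nm lam = 9 := by
    rw [h0, nm_mk]
    norm_num
  refine ⟨fun h ↦ ?_, fun h ↦ ?_, fun x y h ↦ ?_⟩
  · rw [nm_eq_zero.mpr h] at h9
    norm_num at h9
  · rw [nm_eq_one h] at h9
    norm_num at h9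
  · rw [lam_dvd_iff_nm, map_mul] at h
    rw [lam_dvd_iff_nm, lam_dvd_iff_nm]
    exact Int.prime_three.dvd_or_dvd h

/-- Reduction modulo the prime `lam`. -/
def red : O →+* O ⧸ Ideal.span {lam} := Ideal.Quotient.mk _

instance : IsDomain (O ⧸ Ideal.span {lam}) :=
  (Ideal.Quotient.isDomain_iff_prime _).mpr
    ((Ideal.span_singleton_prime prime_lam.ne_zero).mpr prime_lam)

lemma red_eq_zero {x : O} : red x = 0 ↔ lam ∣ x :=
  Ideal.Quotient.eq_zero_iff_mem.trans Ideal.mem_span_singleton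

lemma red_lam : red lam = 0 := red_eq_zero.mpr dvd_rfl

lemma red_w : red w = 1 := by
  have : red (1 - w) = 0 := red_lam
  rw [map_sub, map_one, sub_eq_zero] at this
  exact this.symm

lemma red_three : (3 : O ⧸ Ideal.span {lam}) = 0 := by
  have := congrArg red three_eq
  simpa [red_lam, map_ofNat red 3] using this

lemma red_t_sq : red t ^ 2 = 2 := by
  rw [← map_pow, t_sq, map_ofNat]

lemma red_intCast_cube (n : ℤ) : (n : O ⧸ Ideal.span {lam}) ^ 3 = n := by
  obtain ⟨k, hk⟩ : (3 : ℤ) ∣ n ^ 3 - n := by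
    rw [← Nat.cast_ofNat, ← ZMod.intCast_zmod_eq_zero_iff_dvd]
    push_cast
    rw [ZMod.pow_card, sub_self]
  have := congrArg (Int.cast : ℤ → O ⧸ Ideal.span {lam}) hk
  push_cast at this
  linear_combination this + k * red_three

lemma red_pow_nine (x : O) : red x ^ 9 = red x := by
  obtain ⟨a, b, c, d, rfl⟩ := exists_mk x
  have h : red (mk a b c d) = (a + c : ℤ) + (b + d : ℤ) * red t := by
    rw [mk_eq]
    simp [red_w]
    ring
  have hA := red_intCast_cube (a + c)
  have hB := red_intCast_cube (b + d)
  rw [h]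
  generalize ((a + c : ℤ) : O ⧸ Ideal.span {lam}) = A at *
  generalize ((b + d : ℤ) : O ⧸ Ideal.span {lam}) = B at *
  have ht := red_t_sq
  have h3 := red_three
  generalize red t = T at *
  have e1 : (A + B * T) ^ 3 = A + 2 * B * T := by
    linear_combination hA + B ^ 3 * T * ht + 2 * T * hB + (A ^ 2 * B * T + A * B ^ 2 * T ^ 2) * h3
  have e2 : (A + 2 * B * T) ^ 3 = A + B * T := by
    linear_combination hA + 8 * B ^ 3 * T * ht + 16 * T * hB +
      (2 * A ^ 2 * B * T + 4 * A * B ^ 2 * T ^ 2 + 5 * B * T) * h3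
  rw [show 9 = 3 * 3 from rfl, pow_mul, e1, e2]

lemma red_pow_eight {x : O} (hx : ¬ lam ∣ x) : red x ^ 8 = 1 := by
  rw [← red_eq_zero] at hx
  apply mul_left_cancel₀ hx
  linear_combination red_pow_nine x

lemma lam_cube_dvd_sub_of_dvd {x y : O} (h : lam ∣ x - y) : lam ^ 3 ∣ x ^ 3 - y ^ 3 := by
  obtain ⟨c, hc⟩ := h
  obtain rfl : x = y + lam * c := by linear_combination hc
  refine ⟨c ^ 3 - w ^ 2 * (y ^ 2 * c + y * lam * c ^ 2), ?_⟩
  linear_combination (y ^ 2 * lam * c + y * lam ^ 2 * c ^ 2) * three_eq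

lemma lam_cube_dvd_pow_sub_one {x : O} (hx : ¬ lam ∣ x) : lam ^ 3 ∣ x ^ 24 - 1 := by
  have h : lam ∣ x ^ 8 - 1 := by
    rw [← red_eq_zero]
    simp [red_pow_eight hx]
  convert lam_cube_dvd_sub_of_dvd h using 1
  ring

lemma eps_pow_two_eq : eps ^ 2 = mk 3 2 0 0 := by
  rw [pow_two, eps_eq_mk, mk_mul]
  norm_num

lemma eps_pow_eight : eps ^ 8 = mk 577 408 0 0 := by
  rw [show eps ^ 8 = eps ^ 2 * eps ^ 2 * (eps ^ 2 * eps ^ 2) by ring, eps_pow_two_eq,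
    mk_mul, mk_mul]
  norm_num

lemma w_pow_mul_eps_pow_eight (i j : ℕ) :
    (w ^ i * eps ^ j) ^ 8 = mk (-1) 0 (-1) 0 ^ i * mk 577 408 0 0 ^ j := by
  have hw : mk (-1) 0 (-1) 0 = w ^ 8 := by
    rw [mk_eq]
    push_cast
    linear_combination -w_sq + (-w ^ 5 - w ^ 2) * w_cube
  rw [hw, ← eps_pow_eight]
  ring

/-- Modulo `lam ^ 2`, the eighth power of a unit times a cube detects the power of `w` in it. -/
lemma eq_zero_of_lam_sq_dvd {i j : ℕ} (hi : i < 3) (hj : j < 3) {N : ℤ}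
    (h : lam ^ 2 ∣ (w ^ i * eps ^ j) ^ 8 - N) : i = 0 := by
  rw [w_pow_mul_eps_pow_eight, intCast_eq_mk] at h
  interval_cases i <;> interval_cases j <;>
    simp only [pow_zero, pow_one, pow_two (mk _ _ _ _), one_mul, mul_one, mk_mul, mk_sub] at h ⊢ <;>
    (have := of_lam_sq_dvd_mk h; omega)

/-- Modulo `lam ^ 3`, the eighth power of a unit times a cube detects the unit modulo cubes. -/
lemma eq_zero_of_lam_cube_dvd {i j : ℕ} (hi : i < 3) (hj : j < 3) {N : ℤ}
    (h : lam ^ 3 ∣ (w ^ i * eps ^ j) ^ 8 - N) : i = 0 ∧ j = 0 := by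
  rw [w_pow_mul_eps_pow_eight, intCast_eq_mk] at h
  interval_cases i <;> interval_cases j <;>
    simp only [pow_zero, pow_one, pow_two (mk _ _ _ _), one_mul, mul_one, mk_mul, mk_sub, true_and,
      and_true, and_self] at h ⊢ <;>
    (have := of_lam_cube_dvd_mk h; omega)

/-- A factor of a cube, prime to its cofactor and fixed by an automorphism inverting `w`, is the
cube of a fixed element as soon as its eighth power is rational modulo `lam ^ 3`. -/
lemma exists_fixed_cube_root {a b c : O} (h : a * b = c ^ 3) (hab : IsCoprime a b)
    (ha : ¬ lam ∣ a) {N : ℤ} (hN : lam ^ 3 ∣ a ^ 8 - N) (φ : O →+* O) (hw : φ w = w ^ 2)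
    (hφ : φ a = a) : ∃ α, α ^ 3 = a ∧ φ α = α := by
  obtain ⟨i, hi, j, hj, β, hβ⟩ :=
    exists_eq_unit_mul_cube hab isUnit_one (h.trans (one_mul _).symm)
  have hβl : ¬ lam ∣ β := fun hd ↦ ha (hβ ▸ (dvd_pow hd three_ne_zero).mul_left _)
  obtain ⟨rfl, rfl⟩ := eq_zero_of_lam_cube_dvd hi hj (N := N) (by
    convert hN.sub ((lam_cube_dvd_pow_sub_one hβl).mul_left ((w ^ i * eps ^ j) ^ 8)) using 1
    rw [hβ]
    ring)
  simp only [pow_zero, one_mul] at hβ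
  have h3 : β ^ 3 = φ β ^ 3 := by rw [← map_pow, ← hβ, hφ]
  have hprod : (β - φ β) * ((β - w * φ β) * (β - w ^ 2 * φ β)) = 0 := by
    linear_combination h3 + (β * φ β ^ 2 - β ^ 2 * φ β) * w_sq +
      (β * φ β ^ 2 - φ β ^ 3) * w_cube
  rcases mul_eq_zero.mp hprod with h0 | h0
  · exact ⟨β, hβ.symm, (sub_eq_zero.mp h0).symm⟩
  rcases mul_eq_zero.mp h0 with h0 | h0
  · refine ⟨w * β, by rw [mul_pow, w_cube, one_mul, hβ], ?_⟩
    rw [map_mul, hw]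
    linear_combination -w * h0
  · refine ⟨w ^ 2 * β, by rw [mul_pow, ← pow_mul, mul_comm 2 3, pow_mul, w_cube, hβ]; ring, ?_⟩
    rw [map_mul, map_pow, hw]
    linear_combination -w ^ 2 * h0

/-- The automorphism of `O` inverting `w` and multiplying `√2` by the sign `e`. -/
def conj (e : ℤ) (he : e * e = 1) : O →+* O where
  toFun x := mk (x.re.re - x.im.re) (e * (x.re.im - x.im.im)) (-x.im.re) (-(e * x.im.im))
  map_one' := by
    ext <;> simp [mk]
  map_zero' := by
    ext <;> simp [mk]
  map_add' x y := by
    ext <;> simp [mk] <;> ring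
  map_mul' x y := by
    rw [mk_mul]
    ext <;> simp [mk] <;> grind

lemma conj_mk (e : ℤ) (he : e * e = 1) (a b c d : ℤ) :
    conj e he (mk a b c d) = mk (a - c) (e * (b - d)) (-c) (-(e * d)) := rfl

lemma conj_w (e : ℤ) (he : e * e = 1) : conj e he w = w ^ 2 := by
  rw [w_sq, w_eq_mk, conj_mk, mk_eq, mk_eq]
  push_cast
  ring

lemma lam_dvd_three : lam ∣ 3 := ⟨-w ^ 2 * lam, by linear_combination three_eq⟩

lemma cube_add_cube_eq {X Y p : O} (hp : X + Y = lam * p) :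
    X ^ 3 + Y ^ 3 = lam ^ 3 * (w ^ 2 * (p * (X + w * p) * (p - X))) := by
  obtain rfl : Y = lam * p - X := by linear_combination hp
  have h : lam = 1 - w := rfl
  linear_combination (lam * p * X ^ 2 - lam ^ 2 * p ^ 2 * X) * three_eq
    - lam ^ 3 * p ^ 3 * w_cube + lam ^ 3 * w ^ 2 * p ^ 2 * X * h

lemma lam_dvd_add_of_cube_add_cube {X Y : O} (h : lam ∣ X ^ 3 + Y ^ 3) : lam ∣ X + Y := by
  rw [← red_eq_zero] at h ⊢
  rw [← pow_eq_zero_iff three_ne_zero]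
  simp only [map_add, map_pow] at h ⊢
  linear_combination h + (red X ^ 2 * red Y + red X * red Y ^ 2) * red_three

lemma exists_lam_sq_dvd_add {n : ℕ} {X Y z : O} (hXY : IsCoprime X Y)
    (h : X ^ 3 + Y ^ 3 = 3 * eps ^ 2 * (lam ^ (n + 1) * z) ^ 3) :
    ∃ Y', IsCoprime X Y' ∧ X ^ 3 + Y' ^ 3 = 3 * eps ^ 2 * (lam ^ (n + 1) * z) ^ 3 ∧
      lam ^ 2 ∣ X + Y' := by
  obtain ⟨p, hp⟩ : lam ∣ X + Y := lam_dvd_add_of_cube_add_cube (by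
    rw [h, mul_assoc]
    exact lam_dvd_three.mul_right _)
  have hprod : p * (X + w * p) * (p - X) = 3 * (w * eps ^ 2 * (lam ^ n * z) ^ 3) := by
    apply mul_left_cancel₀ (pow_ne_zero 3 prime_lam.ne_zero)
    linear_combination w * (h - cube_add_cube_eq hp) -
      lam ^ 3 * (p * (X + w * p) * (p - X)) * w_cube
  have hdvd : lam ∣ p * (X + w * p) * (p - X) := hprod ▸ lam_dvd_three.mul_right _
  have hl : lam = 1 - w := rfl
  rcases prime_lam.dvd_or_dvd hdvd with hd | ⟨q, hq⟩
  · rcases prime_lam.dvd_or_dvd hd with ⟨q, hq⟩ | ⟨q, hq⟩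
    · exact ⟨Y, hXY, h, q, by rw [hp, hq]; ring⟩
    · refine ⟨w * Y, (isCoprime_mul_unit_left_right isUnit_w _ _).mpr hXY, ?_, q, ?_⟩
      · linear_combination h + Y ^ 3 * w_cube
      · linear_combination w * hp + lam * hq - X * hl
  · refine ⟨w ^ 2 * Y, (isCoprime_mul_unit_left_right (isUnit_w.pow 2) _ _).mpr hXY, ?_,
      w ^ 2 * q, ?_⟩
    · linear_combination h + Y ^ 3 * (w ^ 3 + 1) * w_cube
    · linear_combination w ^ 2 * hp + lam * w ^ 2 * hq + X * w ^ 2 * hl - X * w_cube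

lemma w_pow_mul_eps_pow_isUnit (i j : ℕ) : IsUnit (w ^ i * eps ^ j) :=
  (isUnit_w.pow i).mul (isUnit_eps.pow j)

lemma exists_descent_data {n : ℕ} {X Y z : O} (hXY : IsCoprime X Y)
    (h : X ^ 3 + Y ^ 3 = 3 * eps ^ 2 * (lam ^ (n + 1) * z) ^ 3) (hd : lam ^ 2 ∣ X + Y)
    (hX : ¬ lam ∣ X) (hz : ¬ lam ∣ z) :
    ∃ U a b c k v : O, ∃ i < 3, ∃ j < 3, IsUnit U ∧ IsUnit k ∧ IsCoprime a b ∧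
      a ^ 3 + w ^ i * eps ^ j * b ^ 3 = -w ^ 2 * k * lam ^ (3 * n + 2) * c ^ 3 ∧
      k * (w ^ i * eps ^ j) = -eps ^ 2 * v ^ 3 ∧ z = U * (a * b * c) * v ∧
      lam ∣ X - U * a ^ 3 := by
  obtain ⟨q, hq⟩ := hd
  have hl : lam = 1 - w := rfl
  have hl0 := prime_lam.ne_zero
  have hprod : q * ((X + w * (lam * q)) * (lam * q - X)) =
      lam ^ (3 * n + 1) * (-eps ^ 2 * z ^ 3) := by
    apply mul_left_cancel₀ (pow_ne_zero 4 hl0)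
    have := cube_add_cube_eq (show X + Y = lam * (lam * q) by rw [hq]; ring)
    linear_combination w * (h - this) -
      lam ^ 4 * q * (X + w * (lam * q)) * (lam * q - X) * w_cube +
      w * eps ^ 2 * (lam ^ (n + 1) * z) ^ 3 * three_eq
      - eps ^ 2 * (lam ^ (n + 1) * z) ^ 3 * lam ^ 2 * w_cube
  have h1 : ¬ lam ∣ X + w * (lam * q) := fun hd ↦ hX (by
    convert hd.sub (dvd_mul_right lam (w * q)) using 1
    ring)
  have h2 : ¬ lam ∣ lam * q - X := fun hd ↦ hX (by
    convert (dvd_mul_right lam q).sub hd using 1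
    ring)
  obtain ⟨r, rfl⟩ : lam ^ (3 * n + 1) ∣ q := by
    refine prime_lam.pow_dvd_of_dvd_mul_right _ (fun hd ↦ ?_) ⟨_, hprod⟩
    exact (prime_lam.dvd_or_dvd hd).elim h1 h2
  have hsum : (X + w * (lam * (lam ^ (3 * n + 1) * r))) + (lam * (lam ^ (3 * n + 1) * r) - X) =
      -w ^ 2 * lam ^ (3 * n + 2) * r := by
    linear_combination lam ^ (3 * n + 2) * r * w_sq
  replace hprod : r * ((X + w * (lam * (lam ^ (3 * n + 1) * r))) *
      (lam * (lam ^ (3 * n + 1) * r) - X)) = -eps ^ 2 * z ^ 3 := by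
    apply mul_left_cancel₀ (pow_ne_zero (3 * n + 1) hl0)
    linear_combination hprod
  obtain ⟨x, y, hxy⟩ := hXY
  have hr : lam ^ (3 * n + 2) * r =
      -w * (X + w * (lam * (lam ^ (3 * n + 1) * r))) - w * (lam * (lam ^ (3 * n + 1) * r) - X) := by
    linear_combination w * hsum - lam ^ (3 * n + 2) * r * w_cube
  have hY : Y = lam * (lam ^ (3 * n + 2) * r) - X := by linear_combination hq
  have hp1 : X + w * (lam * (lam ^ (3 * n + 1) * r)) = X + w * (lam ^ (3 * n + 2) * r) := by ring
  have hp2 : lam * (lam ^ (3 * n + 1) * r) - X = lam ^ (3 * n + 2) * r - X := by ring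
  rw [hp1, hp2] at hprod hsum hr
  have c1 : IsCoprime r (X + w * (lam ^ (3 * n + 2) * r)) := by
    refine ⟨y * lam ^ (3 * n + 3) - (x - y) * w * lam ^ (3 * n + 2), x - y, ?_⟩
    linear_combination hxy - y * hY
  have c2 : IsCoprime r (lam ^ (3 * n + 2) * r - X) := by
    refine ⟨y * lam ^ (3 * n + 3) + (x - y) * lam ^ (3 * n + 2), y - x, ?_⟩
    linear_combination hxy - y * hY
  have c3 : IsCoprime (X + w * (lam ^ (3 * n + 2) * r)) (lam ^ (3 * n + 2) * r - X) := by
    refine ⟨-w * (x - y + y * lam), -w * (x - y + y * lam) - (x - y), ?_⟩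
    linear_combination hxy - y * hY - (x - y + y * lam) * hr
  have hu : IsUnit (-eps ^ 2) := (isUnit_eps.pow 2).neg
  obtain ⟨i₁, -, j₁, -, a, ha⟩ := exists_eq_unit_mul_cube (c1.symm.mul_right c3) hu
    (by rw [← hprod]; ring)
  obtain ⟨i₂, -, j₂, -, b, hb⟩ := exists_eq_unit_mul_cube (c2.symm.mul_right c3.symm) hu
    (by rw [← hprod]; ring)
  obtain ⟨i₀, -, j₀, -, c, hc⟩ := exists_eq_unit_mul_cube (c1.mul_right c2) hu hprod
  have hU := w_pow_mul_eps_pow_isUnit i₁ j₁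
  have hU₂ := w_pow_mul_eps_pow_isUnit i₂ j₂
  have hU₀ := w_pow_mul_eps_pow_isUnit i₀ j₀
  generalize w ^ i₁ * eps ^ j₁ = U at *
  generalize w ^ i₂ * eps ^ j₂ = U₂ at *
  generalize w ^ i₀ * eps ^ j₀ = U₀ at *
  obtain ⟨V, hV⟩ := hU.exists_right_inv
  have hVu : IsUnit V := .of_mul_eq_one_right _ hV
  obtain ⟨i, hi, j, hj, v', hv', hv⟩ := isReduced_of_isUnit (hVu.mul hU₂)
  replace hb : lam ^ (3 * n + 2) * r - X = U * (w ^ i * eps ^ j * (v' * b) ^ 3) := by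
    linear_combination hb - U₂ * b ^ 3 * hV + U * b ^ 3 * hv
  replace hc : r = U * (V * U₀ * c ^ 3) := by
    linear_combination hc - U₀ * c ^ 3 * hV
  have hk : IsUnit (V * U₀) := hVu.mul hU₀
  generalize V * U₀ = k at *
  generalize v' * b = b at *
  have hcube : (U * (a * b * c)) ^ 3 * (k * (w ^ i * eps ^ j)) = -eps ^ 2 * z ^ 3 := by
    rw [← hprod, ha, hb]
    linear_combination -(U * a ^ 3 * (U * (w ^ i * eps ^ j * b ^ 3))) * hc
  obtain ⟨v, rfl⟩ : U * (a * b * c) ∣ z := by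
    rw [← UniqueFactorizationMonoid.pow_dvd_pow_iff_dvd three_ne_zero, ← hu.dvd_mul_left]
    exact ⟨_, hcube.symm⟩
  have h0 : U * (a * b * c) ≠ 0 := by
    intro h0
    rw [h0, zero_mul] at hz
    exact hz (dvd_zero _)
  refine ⟨U, a, b, c, k, v, i, hi, j, hj, hU, hk, ?_, ?_, ?_, rfl, ?_⟩
  · rw [ha, hb] at c3
    rw [isCoprime_mul_unit_left_left hU, isCoprime_mul_unit_left_right hU,
      isCoprime_mul_unit_left_right (w_pow_mul_eps_pow_isUnit i j)] at c3
    exact (IsCoprime.pow_iff three_pos three_pos).mp c3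
  · apply mul_left_cancel₀ hU.ne_zero
    linear_combination hsum - ha - hb - w ^ 2 * lam ^ (3 * n + 2) * hc
  · apply mul_left_cancel₀ (pow_ne_zero 3 h0)
    linear_combination hcube
  · rw [← ha]
    exact ⟨-w * lam ^ (3 * n + 1) * r, by ring⟩

lemma lam_pow_dvd_unit_pow_sub_one {a b u : O} {m : ℕ} (hm : m ≤ 3) (ha : ¬ lam ∣ a)
    (hb : ¬ lam ∣ b) (h : lam ^ m ∣ a ^ 3 + u * b ^ 3) : lam ^ m ∣ u ^ 8 - (1 : ℤ) := by
  have h1 : lam ^ m ∣ (u * b ^ 3) ^ 8 - (a ^ 3) ^ 8 := by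
    obtain ⟨c, hc⟩ := sub_dvd_pow_sub_pow (u * b ^ 3) (-a ^ 3) 8
    refine dvd_trans h ⟨c, ?_⟩
    linear_combination hc
  have ha' := (pow_dvd_pow lam hm).trans (lam_cube_dvd_pow_sub_one ha)
  have hb' := ((pow_dvd_pow lam hm).trans (lam_cube_dvd_pow_sub_one hb)).mul_left (u ^ 8)
  convert (h1.add ha').sub hb' using 1
  push_cast
  ring

lemma exists_eps_pow_eight {j : ℕ} (hj : j < 3) : ∃ e, (eps ^ j) ^ 8 = 1 + 3 * j * t + 9 * e := by
  have h8 : eps ^ 8 = 577 + 408 * t := by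
    rw [eps_pow_eight, mk_eq]
    push_cast
    ring
  rw [pow_right_comm, h8]
  interval_cases j
  · exact ⟨0, by simp⟩
  · exact ⟨64 + 45 * t, by push_cast; ring⟩
  · exact ⟨73984 + 52314 * t, by push_cast; linear_combination 166464 * t_sq⟩

lemma lam_dvd_of_sub_three_mul {a b D : O} {j : ℕ} (hj : j < 3) (ha : ¬ lam ∣ a) (hb : ¬ lam ∣ b)
    (h : a ^ 3 + eps ^ j * b ^ 3 = 3 * D) : lam ∣ j * t + 8 * D * a ^ 21 := by
  obtain ⟨e, he⟩ := exists_eps_pow_eight hj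
  obtain ⟨α, hα⟩ := lam_cube_dvd_pow_sub_one ha
  obtain ⟨β, hβ⟩ := lam_cube_dvd_pow_sub_one hb
  obtain ⟨q, hq⟩ : ∃ q, (3 * D - a ^ 3) ^ 8 = a ^ 24 - 24 * D * a ^ 21 + 9 * q :=
    ⟨729 * D ^ 8 - 1944 * D ^ 7 * a ^ 3 + 2268 * D ^ 6 * a ^ 6 - 1512 * D ^ 5 * a ^ 9 +
      630 * D ^ 4 * a ^ 12 - 168 * D ^ 3 * a ^ 15 + 28 * D ^ 2 * a ^ 18, by ring⟩
  have h8 : (eps ^ j) ^ 8 * b ^ 24 = (3 * D - a ^ 3) ^ 8 := by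
    rw [← h]
    ring
  rw [← mul_dvd_mul_iff_left (pow_ne_zero 2 prime_lam.ne_zero)]
  refine ⟨-w * (α - (eps ^ j) ^ 8 * β) - w ^ 5 * lam * (q - e), ?_⟩
  linear_combination -w * (-he - (eps ^ j) ^ 8 * hβ + h8 + hq + hα) +
    (j * t + 8 * D * a ^ 21) * lam_sq +
    (q - e) * (w ^ 5 * (lam ^ 2 - 3 * w) * lam_sq + 9 * w * (w ^ 3 + 1) * w_cube)

lemma lam_dvd_sq_sub_sq_of_coprime (n : ℕ) : ∀ X Y z : O, IsCoprime X Y →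
    X ^ 3 + Y ^ 3 = 3 * eps ^ 2 * (lam ^ (n + 1) * z) ^ 3 → ¬ lam ∣ X → ¬ lam ∣ z →
    lam ∣ z ^ 2 - X ^ 2 := by
  induction n with
  | zero =>
    intro X Y z hXY h hX hz
    obtain ⟨Y, hXY, h, hd⟩ := exists_lam_sq_dvd_add hXY h
    obtain ⟨U, a, b, c, k, v, i, hi, j, hj, hU, hk, hab, hsum, hkv, rfl, hXa⟩ :=
      exists_descent_data hXY h hd hX hz
    have ha : ¬ lam ∣ a := fun h ↦ hz (h.trans ⟨U * (b * c) * v, by ring⟩)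
    have hb : ¬ lam ∣ b := fun h ↦ hz (h.trans ⟨U * (a * c) * v, by ring⟩)
    obtain rfl : i = 0 := eq_zero_of_lam_sq_dvd hi hj (N := 1) <|
      lam_pow_dvd_unit_pow_sub_one (by norm_num) ha hb (hsum ▸ ((dvd_mul_left _ _).mul_right _))
    rw [pow_zero, one_mul] at hsum hkv
    have hD : a ^ 3 + eps ^ j * b ^ 3 = 3 * (k * c ^ 3) := by
      linear_combination hsum - k * c ^ 3 * three_eq
    have hjt := lam_dvd_of_sub_three_mul hj ha hb hD
    have hza : eps ^ 2 * (U * (a * b * c) * v) ^ 3 =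
        -U ^ 3 * a ^ 3 * (3 * (k * c ^ 3) - a ^ 3) * (k * c ^ 3) := by
      linear_combination (U * (a * b * c)) ^ 3 * hkv - U ^ 3 * a ^ 3 * k * c ^ 3 * hD
    have ha8 := red_pow_eight ha
    have h3 := red_three
    have he : red eps ^ 2 = 2 * red t := by
      rw [eps, map_add, map_one]
      linear_combination red_t_sq + red_three
    generalize U * (a * b * c) * v = z at *
    generalize k * c ^ 3 = D at *
    rw [← red_eq_zero] at hjt hXa hz ⊢
    replace hza := congrArg red hza
    simp only [map_sub, map_add, map_mul, map_pow, map_neg, map_natCast, map_ofNat] at hjt hXa hza ⊢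
    have hD' : red D = j * red t * red a ^ 3 := by
      linear_combination -red a ^ 3 * hjt + 8 * red D * (red a ^ 16 + red a ^ 8 + 1) * ha8 +
        3 * red D * h3
    have hX' : red X = red U * red a ^ 3 := by linear_combination hXa
    have key : 2 * red t * red z ^ 3 = j * red t * red X ^ 3 := by
      rw [hX']
      linear_combination hza - red z ^ 3 * he + red U ^ 3 * red a ^ 6 * hD' -
        red U ^ 3 * red a ^ 3 * red D ^ 2 * h3
    have hj2 : (j : O ⧸ Ideal.span {lam}) ^ 2 = 1 := by
      interval_cases j
      · refine absurd ((pow_eq_zero_iff three_ne_zero).mp ?_) hz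
        linear_combination red t * key - 2 * red z ^ 3 * red_t_sq - red z ^ 3 * h3
      · simp
      · push_cast
        linear_combination h3
    rw [← pow_eq_zero_iff three_ne_zero]
    linear_combination -(2 * red t * red z ^ 3 + j * red t * red X ^ 3) * key +
      (4 * red z ^ 6 - j ^ 2 * red X ^ 6) * red_t_sq - 2 * red X ^ 6 * hj2 +
      (3 * red z ^ 6 - red X ^ 6 - red z ^ 4 * red X ^ 2 + red z ^ 2 * red X ^ 4) * h3
  | succ m ih =>
    intro X Y z hXY h hX hz
    obtain ⟨Y, hXY, h, hd⟩ := exists_lam_sq_dvd_add hXY h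
    obtain ⟨U, a, b, c, k, v, i, hi, j, hj, hU, hk, hab, hsum, hkv, rfl, hXa⟩ :=
      exists_descent_data hXY h hd hX hz
    have ha : ¬ lam ∣ a := fun h ↦ hz (h.trans ⟨U * (b * c) * v, by ring⟩)
    have hb : ¬ lam ∣ b := fun h ↦ hz (h.trans ⟨U * (a * c) * v, by ring⟩)
    have hvc : ¬ lam ∣ -(v * c) := by
      rw [dvd_neg]
      exact fun h ↦ hz (h.trans ⟨U * (a * b), by ring⟩)
    have hlam : lam ^ 3 ∣ a ^ 3 + w ^ i * eps ^ j * b ^ 3 := by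
      rw [hsum]
      exact ((pow_dvd_pow lam (by omega : 3 ≤ 3 * (m + 1) + 2)).mul_left _).mul_right _
    obtain ⟨rfl, rfl⟩ := eq_zero_of_lam_cube_dvd hi hj (N := 1)
      (lam_pow_dvd_unit_pow_sub_one le_rfl ha hb hlam)
    simp only [pow_zero, one_mul, mul_one] at hsum hkv
    have hih := ih a b (-(v * c)) hab (by
      rw [hsum, hkv]
      linear_combination eps ^ 2 * (lam ^ (m + 1) * (v * c)) ^ 3 * three_eq) ha hvc
    have hba : lam ∣ a + b := by
      simp only [pow_zero, one_mul] at hlam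
      exact lam_dvd_add_of_cube_add_cube ((dvd_pow_self lam three_ne_zero).trans hlam)
    rw [← red_eq_zero] at hih hba hXa ⊢
    simp only [map_sub, map_add, map_mul, map_pow, map_neg] at hih hba hXa ⊢
    have hb' : red b = -red a := by linear_combination hba
    have hX' : red X = red U * red a ^ 3 := by linear_combination hXa
    rw [hb', hX']
    linear_combination red U ^ 2 * red a ^ 4 * hih

lemma lam_dvd_sq_sub_sq {n : ℕ} {X Y z : O}
    (h : X ^ 3 + Y ^ 3 = 3 * eps ^ 2 * (lam ^ (n + 1) * z) ^ 3) (hX : ¬ lam ∣ X) (hz : ¬ lam ∣ z) :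
    lam ∣ z ^ 2 - X ^ 2 := by
  have hX0 : X ≠ 0 := fun h0 ↦ hX (h0 ▸ dvd_zero _)
  obtain ⟨g, x, y, hg, rfl, rfl⟩ : ∃ g x y, IsCoprime x y ∧ X = g * x ∧ Y = g * y := by
    obtain ⟨x, hx⟩ := IsBezout.gcd_dvd_left X Y
    obtain ⟨y, hy⟩ := IsBezout.gcd_dvd_right X Y
    obtain ⟨p, q, hpq⟩ := IsBezout.gcd_eq_sum X Y
    refine ⟨_, x, y, ⟨p, q, ?_⟩, hx, hy⟩
    apply mul_left_cancel₀ (left_ne_zero_of_mul (hx ▸ hX0))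
    linear_combination hpq - p * hx - q * hy
  have hgl : IsCoprime lam g := (prime_lam.coprime_iff_not_dvd).mpr fun hd ↦ hX (hd.mul_right _)
  obtain ⟨z, rfl⟩ : g ∣ z := by
    rw [← UniqueFactorizationMonoid.pow_dvd_pow_iff_dvd three_ne_zero]
    have h1 : g ^ 3 ∣ lam ^ (3 * n + 5) * z ^ 3 := by
      rw [← (isUnit_eps.pow 2).dvd_mul_left, ← (isUnit_w.pow 2).neg.dvd_mul_left]
      refine ⟨x ^ 3 + y ^ 3, ?_⟩
      linear_combination -h - eps ^ 2 * (lam ^ (n + 1) * z) ^ 3 * three_eq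
    exact (hgl.symm.pow).dvd_of_dvd_mul_left h1
  have hg0 : g ≠ 0 := left_ne_zero_of_mul hX0
  have := (lam_dvd_sq_sub_sq_of_coprime n x y z hg (mul_left_cancel₀ (pow_ne_zero 3 hg0) (by
    linear_combination h)) (fun hd ↦ hX (hd.mul_left _)) fun hd ↦ hz (hd.mul_left _)).mul_left
      (g ^ 2)
  convert this using 1
  ring

end O

lemma isCoprime_six {N : ℤ} (h2 : ¬ 2 ∣ N) (h3 : ¬ 3 ∣ N) : IsCoprime 6 N := by
  obtain h | h : N = 6 * (N / 6) + 1 ∨ N = 6 * (N / 6) + 5 := by omega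
  · exact ⟨-(N / 6), 1, by linarith⟩
  · exact ⟨N / 6 + 1, -1, by linarith⟩

lemma three_dvd_cube_sub (x : ℤ) : 3 ∣ x ^ 3 - x := by
  rw [← Nat.cast_ofNat, ← ZMod.intCast_zmod_eq_zero_iff_dvd]
  push_cast
  rw [ZMod.pow_card, sub_self]

lemma three_dvd_sq_sub_one {x : ℤ} (hx : ¬ 3 ∣ x) : 3 ∣ x ^ 2 - 1 := by
  have h : 3 ∣ x * (x ^ 2 - 1) := by
    rw [show x * (x ^ 2 - 1) = x ^ 3 - x by ring]
    exact three_dvd_cube_sub x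
  exact (Int.prime_three.dvd_or_dvd h).resolve_left hx

namespace O

lemma isCoprime_of_int {a b : O} {M N : ℤ} (hMN : IsCoprime M N) (hM : ∃ x y, x * a + y * b = M)
    (hN : a ∣ N) : IsCoprime a b := by
  obtain ⟨p, q, hpq⟩ := hMN
  obtain ⟨x, y, hxy⟩ := hM
  obtain ⟨c, hc⟩ := hN
  refine ⟨p * x + q * c, p * y, ?_⟩
  have := congrArg (Int.cast : ℤ → O) hpq
  push_cast at this
  linear_combination this + p * hxy - q * hc

lemma add_mul_t_inj {a b c d : ℤ} : (a + b * t : O) = c + d * t ↔ a = c ∧ b = d := by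
  have h (x y : ℤ) : (x + y * t : O) = mk x y 0 0 := by simp [mk_eq]
  rw [h, h, mk_inj]
  simp

lemma lam_cube_dvd_nine : lam ^ 3 ∣ 9 :=
  ⟨w ^ 4 * lam, by linear_combination (3 - w ^ 2 * lam ^ 2) * three_eq⟩

lemma lam_dvd_add_mul_t {a b : ℤ} : lam ∣ (a + b * t : O) ↔ 3 ∣ a ∧ 3 ∣ b := by
  have h : (a + b * t : O) = mk a b 0 0 := by simp [mk_eq]
  rw [h, lam_dvd_mk, add_zero, add_zero]

/-- The case of `exists_fixed_cube_root` for elements of `ℤ[√2]`. -/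
lemma exists_cube_root_of_lam_cube_dvd {p q N : ℤ} {b c : O} (h : (p + q * t) * b = c ^ 3)
    (hab : IsCoprime (p + q * t) b) (hp : ¬ 3 ∣ p) (hN : lam ^ 3 ∣ (p + q * t) ^ 8 - (N : O)) :
    ∃ x y : ℤ, x ^ 3 + 6 * x * y ^ 2 = p ∧ 3 * x ^ 2 * y + 2 * y ^ 3 = q := by
  have hm : (p + q * t : O) = mk p q 0 0 := by simp [mk_eq]
  obtain ⟨α, hα, hφ⟩ := exists_fixed_cube_root h hab (fun h ↦ hp (lam_dvd_add_mul_t.mp h).1) hN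
    (conj 1 (one_mul 1)) (conj_w _ _) (by rw [hm, conj_mk]; simp)
  obtain ⟨x, y, z, u, rfl⟩ := exists_mk α
  rw [conj_mk, mk_inj] at hφ
  obtain ⟨rfl, rfl⟩ : z = 0 ∧ u = 0 := by omega
  refine ⟨x, y, add_mul_t_inj.mp ?_⟩
  rw [← hα, mk_eq]
  push_cast
  linear_combination (-3 * x * y ^ 2 - y ^ 3 * t) * t_sq

lemma exists_cube_root_of_nine_dvd {p q : ℤ} {b c : O} (h : (p + q * t) * b = c ^ 3)
    (hab : IsCoprime (p + q * t) b) (hp : ¬ 3 ∣ p) (hq : 9 ∣ q) :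
    ∃ x y : ℤ, x ^ 3 + 6 * x * y ^ 2 = p ∧ 3 * x ^ 2 * y + 2 * y ^ 3 = q := by
  obtain ⟨q, rfl⟩ := hq
  obtain ⟨d, hd⟩ := lam_cube_dvd_nine
  refine exists_cube_root_of_lam_cube_dvd (N := p ^ 8) h hab hp
    ⟨d * q * t * ((p + 9 * q * t + p) * ((p + 9 * q * t) ^ 2 + p ^ 2) *
      ((p + 9 * q * t) ^ 4 + p ^ 4)), ?_⟩
  push_cast
  linear_combination q * t * ((p + 9 * q * t + p) * ((p + 9 * q * t) ^ 2 + p ^ 2) *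
      ((p + 9 * q * t) ^ 4 + p ^ 4)) * hd

lemma cube_add_cube_identity {r s a₀ a₁ g₀ g₁ : ℤ} (h₁ : a₀ ^ 3 + 6 * a₀ * a₁ ^ 2 = r - 3 * s)
    (h₂ : 3 * a₀ ^ 2 * a₁ + 2 * a₁ ^ 3 = 2 * s) (h₃ : g₀ ^ 3 + 6 * g₀ * g₁ ^ 2 = r + 3 * s)
    (h₄ : 3 * g₀ ^ 2 * g₁ + 2 * g₁ ^ 3 = 2 * s) :
    (eps ^ 2 * (a₀ + a₁ * t) ^ 2 + 3 * (a₀ - a₁ * t) * (g₀ + g₁ * t)) ^ 3 +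
      (-3 * (a₀ - a₁ * t) ^ 2 - eps ^ 2 * (a₀ + a₁ * t) * (g₀ + g₁ * t)) ^ 3 =
      3 * eps ^ 2 * (-t * ((g₀ + g₁ * t) ^ 2 - (a₀ + a₁ * t) * (a₀ - a₁ * t)) : O) ^ 3 := by
  have e : eps ^ 2 = 3 + 2 * t := by
    rw [eps]
    linear_combination t_sq
  have hα : (a₀ + a₁ * t : O) ^ 3 = r - 3 * s + 2 * s * t := by
    have h₁ := congrArg (Int.cast : ℤ → O) h₁
    have h₂ := congrArg (Int.cast : ℤ → O) h₂
    push_cast at h₁ h₂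
    linear_combination h₁ + t * h₂ + (3 * a₀ * a₁ ^ 2 + a₁ ^ 3 * t) * t_sq
  have hβ : (a₀ - a₁ * t : O) ^ 3 = r - 3 * s - 2 * s * t := by
    have h₁ := congrArg (Int.cast : ℤ → O) h₁
    have h₂ := congrArg (Int.cast : ℤ → O) h₂
    push_cast at h₁ h₂
    linear_combination h₁ - t * h₂ + (3 * a₀ * a₁ ^ 2 - a₁ ^ 3 * t) * t_sq
  have hγ : (g₀ + g₁ * t : O) ^ 3 = r + 3 * s + 2 * s * t := by
    have h₃ := congrArg (Int.cast : ℤ → O) h₃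
    have h₄ := congrArg (Int.cast : ℤ → O) h₄
    push_cast at h₃ h₄
    linear_combination h₃ + t * h₄ + (3 * g₀ * g₁ ^ 2 + g₁ ^ 3 * t) * t_sq
  generalize (a₀ + a₁ * t : O) = α at *
  generalize (a₀ - a₁ * t : O) = β at *
  generalize (g₀ + g₁ * t : O) = γ at *
  have h0 : eps ^ 2 * α ^ 3 - 3 * β ^ 3 - 2 * t * γ ^ 3 = 0 := by
    rw [e, hα, hβ, hγ]
    ring
  rw [e]
  rw [e] at h0
  linear_combination ((3 + 2 * t) ^ 2 * α ^ 3 + 9 * β ^ 3 - 3 * (3 + 2 * t) * γ ^ 3 +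
    9 * (3 + 2 * t) * α * β * γ) * h0 + 3 * (3 + 2 * t) * t * (γ ^ 2 - α * β) ^ 3 * t_sq

end O

lemma not_three_dvd_of_cube_add {a b r s : ℤ} (hr : ¬ 3 ∣ r)
    (h : a ^ 3 + 6 * a * b ^ 2 = r + 3 * s) : ¬ 3 ∣ a := by
  rintro ⟨c, rfl⟩
  exact hr ⟨9 * c ^ 3 + 6 * c * b ^ 2 - s, by linarith⟩

lemma exists_eq_three_pow_mul {a b s : ℤ} {n : ℕ} (ha : ¬ 3 ∣ a)
    (h : 3 * a ^ 2 * b + 2 * b ^ 3 = 2 * (3 ^ (n + 2) * s)) :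
    ∃ c, b = 3 ^ (n + 1) * c ∧ c * (a ^ 2 + 6 * (3 ^ n * c) ^ 2) = 2 * s := by
  have hb : 3 ∣ b := by
    have h2 : 3 ∣ 2 * b ^ 3 := ⟨2 * (3 ^ (n + 1) * s) - a ^ 2 * b, by linear_combination h⟩
    exact Int.prime_three.dvd_of_dvd_pow
      ((Int.prime_three.dvd_or_dvd h2).resolve_left (by norm_num))
  obtain ⟨b, rfl⟩ := hb
  have h' : 3 ^ n * (2 * s) = b * (a ^ 2 + 6 * b ^ 2) := by
    apply mul_left_cancel₀ (show (9 : ℤ) ≠ 0 by norm_num)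
    linear_combination -h
  obtain ⟨c, rfl⟩ : 3 ^ n ∣ b := by
    refine Int.prime_three.pow_dvd_of_dvd_mul_right _ (fun hd ↦ ha ?_) ⟨_, h'.symm⟩
    exact Int.prime_three.dvd_of_dvd_pow
      ((dvd_add_left ⟨2 * b ^ 2, by ring⟩).mp hd)
  refine ⟨c, by ring, mul_left_cancel₀ (pow_ne_zero n three_ne_zero) ?_⟩
  linear_combination -h'

namespace O

lemma red_intCast_eq_zero {n : ℤ} (hn : 3 ∣ n) : (n : O ⧸ Ideal.span {lam}) = 0 := by
  obtain ⟨k, rfl⟩ := hn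
  push_cast
  linear_combination k * red_three

lemma red_intCast_sq {n : ℤ} (hn : ¬ 3 ∣ n) : (n : O ⧸ Ideal.span {lam}) ^ 2 = 1 := by
  have := red_intCast_eq_zero (three_dvd_sq_sub_one hn)
  push_cast at this
  linear_combination this

lemma red_eps_sq : red eps ^ 2 = 2 * red t := by
  rw [eps, map_add, map_one]
  linear_combination red_t_sq + red_three

lemma three_pow_eq (n : ℕ) : (3 : O) ^ n = lam ^ (2 * n) * (-w ^ 2) ^ n := by
  rw [three_eq]
  ring

lemma false_of_cube_add_cube {r s a₀ b g₀ d : ℤ} {n : ℕ} (ha₀ : ¬ 3 ∣ a₀) (hg₀ : ¬ 3 ∣ g₀)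
    (hd : ¬ 3 ∣ d)
    (h₁ : a₀ ^ 3 + 6 * a₀ * (3 ^ (n + 1) * b) ^ 2 = r - 3 * (3 ^ (n + 2) * s))
    (h₂ : 3 * a₀ ^ 2 * (3 ^ (n + 1) * b) + 2 * (3 ^ (n + 1) * b) ^ 3 = 2 * (3 ^ (n + 2) * s))
    (h₃ : g₀ ^ 3 + 6 * g₀ * (3 ^ (n + 1) * d) ^ 2 = r + 3 * (3 ^ (n + 2) * s))
    (h₄ : 3 * g₀ ^ 2 * (3 ^ (n + 1) * d) + 2 * (3 ^ (n + 1) * d) ^ 3 = 2 * (3 ^ (n + 2) * s)) :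
    False := by
  have hid := cube_add_cube_identity h₁ h₂ h₃ h₄
  have hcube : g₀ ^ 3 - a₀ ^ 3 = 3 ^ (n + 3) * (2 * s - 2 * 3 ^ n * (g₀ * d ^ 2 - a₀ * b ^ 2)) := by
    linear_combination h₃ - h₁
  obtain ⟨e, he⟩ : 3 ∣ g₀ - a₀ := by
    have h := ((three_dvd_cube_sub g₀).sub (three_dvd_cube_sub a₀))
    have h' : 3 ∣ g₀ ^ 3 - a₀ ^ 3 := hcube ▸ (dvd_pow_self 3 (by omega)).mul_right _
    omega
  obtain rfl : g₀ = a₀ + 3 * e := by linarith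
  obtain ⟨f, rfl⟩ : 3 ^ (n + 1) ∣ e := by
    refine Int.prime_three.pow_dvd_of_dvd_mul_right (b := a₀ ^ 2 + 3 * (a₀ * e + e ^ 2)) _
      (fun h ↦ ?_) ⟨2 * s - 2 * 3 ^ n * ((a₀ + 3 * e) * d ^ 2 - a₀ * b ^ 2), ?_⟩
    · exact ha₀ (Int.prime_three.dvd_of_dvd_pow ((dvd_add_left (dvd_mul_right _ _)).mp h))
    · apply mul_left_cancel₀ (show (9 : ℤ) ≠ 0 by norm_num)
      linear_combination hcube
  generalize hg : a₀ + 3 * (3 ^ (n + 1) * f) = g₀ at *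
  have hz : -t * ((g₀ + (3 ^ (n + 1) * d : ℤ) * t) ^ 2 -
      (a₀ + (3 ^ (n + 1) * b : ℤ) * t) * (a₀ - (3 ^ (n + 1) * b : ℤ) * t)) =
      lam ^ (2 * n + 1 + 1) * ((-w ^ 2) ^ (n + 1) *
        (-4 * g₀ * d - 3 * ((f * (g₀ + a₀) + 2 * 3 ^ n * (d ^ 2 + b ^ 2) : ℤ) : O) * t)) := by
    have h3 := three_pow_eq (n + 1)
    have hg' := congrArg (Int.cast : ℤ → O) hg
    push_cast at hg' ⊢
    linear_combination (-4 * g₀ * d - 3 * (f * (g₀ + a₀) + 2 * 3 ^ n * (d ^ 2 + b ^ 2)) * t) * h3 +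
      t * (g₀ + a₀) * hg' - (2 * g₀ * (3 ^ (n + 1) * d) +
        t * ((3 ^ (n + 1) * d) ^ 2 + (3 ^ (n + 1) * b) ^ 2)) * t_sq
  generalize ((f * (g₀ + a₀) + 2 * 3 ^ n * (d ^ 2 + b ^ 2) : ℤ) : O) = E at hz
  have ha2 := red_intCast_sq ha₀
  have hg2 := red_intCast_sq hg₀
  have hd2 := red_intCast_sq hd
  rw [hz] at hid
  have hX : red (eps ^ 2 * (a₀ + (3 ^ (n + 1) * b : ℤ) * t) ^ 2 +
      3 * (a₀ - (3 ^ (n + 1) * b : ℤ) * t) * (g₀ + (3 ^ (n + 1) * d : ℤ) * t)) = 2 * red t := by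
    simp only [map_add, map_mul, map_pow, map_sub, map_intCast, red_eps_sq, map_ofNat, red_three]
    rw [red_intCast_eq_zero ((dvd_pow_self 3 (by omega)).mul_right _)]
    linear_combination 2 * red t * ha2
  have hZ : red ((-w ^ 2) ^ (n + 1) * (-4 * g₀ * d - 3 * E * t)) ^ 2 = 1 := by
    have hw : red ((-w ^ 2) ^ (n + 1)) ^ 2 = 1 := by
      rw [map_pow, pow_right_comm, map_neg, map_pow, red_w]
      simp
    rw [map_mul, mul_pow, hw]
    simp only [map_mul, map_sub, map_neg, map_intCast, map_ofNat, red_three]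
    linear_combination 16 * d ^ 2 * hg2 + 16 * hd2 + 5 * red_three
  have ht := red_t_sq
  have := lam_dvd_sq_sub_sq hid (fun h ↦ ?_) (fun h ↦ ?_)
  · rw [← red_eq_zero, map_sub, map_pow, map_pow, hX, hZ] at this
    refine one_ne_zero (α := O ⧸ Ideal.span {lam}) ?_
    linear_combination -this - 4 * ht - 2 * red_three
  · rw [← red_eq_zero, hX] at h
    refine one_ne_zero (α := O ⧸ Ideal.span {lam}) ?_
    linear_combination red t * h - 2 * ht - red_three
  · rw [← red_eq_zero] at h
    rw [h] at hZ
    simp at hZ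

end O

lemma not_three_dvd_of_isCoprime {r s : ℤ} (h : IsCoprime r s) (hs : 3 ∣ s) : ¬ 3 ∣ r :=
  fun hr ↦ Int.prime_three.not_isUnit (h.isUnit_of_dvd' hr hs)

namespace O

theorem eq_zero_of_cube_eq_sq_sub_sq {r s : ℤ} (hrs : IsCoprime r s) (hodd : ¬ 2 ∣ r + s)
    (hs : 9 ∣ s) {ξ : O} (hξ : ξ ^ 3 = r ^ 2 - s ^ 2 + 4 * r * s * t) : s = 0 := by
  by_contra hs0
  obtain ⟨s, rfl⟩ := hs
  obtain ⟨s', hs', hs3⟩ := FiniteMultiplicity.exists_eq_pow_mul_and_not_dvd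
    (a := 3) (b := s) (Int.finiteMultiplicity_iff.mpr ⟨by norm_num, by rintro rfl; simp at hs0⟩)
  generalize multiplicity 3 s = n at hs'
  have hss : 9 * s = 3 ^ (n + 2) * s' := by rw [hs']; ring
  have h3 : 3 ∣ 9 * s := ⟨3 * s, by ring⟩
  have hr : ¬ 3 ∣ r := not_three_dvd_of_isCoprime hrs h3
  have h9 : 9 ∣ 2 * (9 * s) := ⟨2 * s, by ring⟩
  generalize 9 * s = s at *
  have hN : IsCoprime 6 (r ^ 2 - 6 * r * s + s ^ 2) := by
    refine isCoprime_six (fun h ↦ hodd ?_) fun h ↦ hr ?_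
    · have h' : 2 ∣ (r + s) ^ 2 := by
        obtain ⟨k, hk⟩ := h
        exact ⟨k + 4 * r * s, by linear_combination hk⟩
      exact Int.prime_two.dvd_of_dvd_pow h'
    · obtain ⟨k, hk⟩ := h3
      obtain ⟨l, hl⟩ := h
      exact Int.prime_three.dvd_of_dvd_pow (n := 2)
        ⟨l + 2 * r * s - k * s, by linear_combination hl - s * hk⟩
  have hcop : IsCoprime (((r - 3 * s : ℤ) : O) + (2 * s : ℤ) * t)
      (((r + 3 * s : ℤ) : O) + (2 * s : ℤ) * t) := by
    obtain ⟨p, q, hpq⟩ := hrs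
    refine isCoprime_of_int hN ⟨p * (3 + 2 * t) - q, p * (3 - 2 * t) + q, ?_⟩
      ⟨r - (3 + 2 * t) * s, ?_⟩
    · have hpq' := congrArg (Int.cast : ℤ → O) hpq
      push_cast at hpq' ⊢
      linear_combination 6 * hpq'
    · push_cast
      linear_combination 4 * s ^ 2 * t_sq
  obtain ⟨a₀, a₁, h₁, h₂⟩ := exists_cube_root_of_nine_dvd (c := ξ) (by
    rw [hξ]
    push_cast
    linear_combination 4 * s ^ 2 * t_sq) hcop (fun h ↦ hr (by omega)) h9
  obtain ⟨g₀, g₁, h₃, h₄⟩ := exists_cube_root_of_nine_dvd (c := ξ) (by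
    rw [hξ]
    push_cast
    linear_combination 4 * s ^ 2 * t_sq) hcop.symm (fun h ↦ hr (by omega)) h9
  have ha₀ : ¬ 3 ∣ a₀ := not_three_dvd_of_cube_add (s := -s) hr (h₁.trans (by ring))
  have hg₀ : ¬ 3 ∣ g₀ := not_three_dvd_of_cube_add hr h₃
  subst hss
  obtain ⟨b, rfl, -⟩ := exists_eq_three_pow_mul ha₀ h₂
  obtain ⟨d, rfl, hd⟩ := exists_eq_three_pow_mul hg₀ h₄
  refine false_of_cube_add_cube ha₀ hg₀ (fun h ↦ hs3 ?_) h₁ h₂ h₃ h₄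
  have := hd ▸ h.mul_right (g₀ ^ 2 + 6 * (3 ^ n * d) ^ 2)
  omega

end O

lemma exists_cubes_of_mul_eq_cube {a b c : ℤ} (hab : IsCoprime a b) (h : a * b = c ^ 3) :
    ∃ d e, a = d ^ 3 ∧ b = e ^ 3 ∧ c = d * e := by
  obtain ⟨⟨d, rfl⟩, e, rfl⟩ := Int.eq_pow_of_mul_eq_pow_odd hab (by decide) h
  refine ⟨d, e, rfl, rfl, ?_⟩
  rw [← mul_pow] at h
  exact (Odd.strictMono_pow (by decide : Odd 3)).injective h.symm

lemma isCoprime_of_six {n N : ℤ} {k : ℕ} (hn : n ∣ 6 ^ k) (h2 : ¬ 2 ∣ N) (h3 : ¬ 3 ∣ N) :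
    IsCoprime n N :=
  ((isCoprime_six h2 h3).pow_left).of_isCoprime_of_dvd_left hn

lemma isCoprime_four {N : ℤ} (h2 : ¬ 2 ∣ N) : IsCoprime 4 N :=
  ((Int.prime_two.coprime_iff_not_dvd.mpr h2).pow_left (m := 2)).of_isCoprime_of_dvd_left
    (by norm_num)

lemma isCoprime_two_mul {m N : ℤ} (h : IsCoprime m N) (h2 : ¬ 2 ∣ N) : IsCoprime (2 * m) N :=
  (Int.prime_two.coprime_iff_not_dvd.mpr h2).mul_left h

lemma exists_sq_add_eq_cube {p q s : ℤ} (h2 : ¬ 2 ∣ p) (h3 : ¬ 3 ∣ p) (hpq : IsCoprime p q)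
    (hs : 3 ∣ s) (h : q * (3 * p ^ 2 + 2 * q ^ 2) = 4 * s ^ 3) :
    ∃ e f, s = 3 * (e * f) ∧ IsCoprime p e ∧ p ^ 2 + 864 * e ^ 6 = f ^ 3 := by
  obtain ⟨s, rfl⟩ := hs
  obtain ⟨q, rfl⟩ : 3 ∣ q := by
    have h' : 3 ∣ 2 * q ^ 3 := ⟨36 * s ^ 3 - p ^ 2 * q, by linear_combination h⟩
    exact Int.prime_three.dvd_of_dvd_pow
      ((Int.prime_three.dvd_or_dvd h').resolve_left (by norm_num))
  obtain ⟨q, rfl⟩ : 12 ∣ q := by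
    refine IsCoprime.dvd_of_dvd_mul_right (z := p ^ 2 + 6 * q ^ 2)
      (isCoprime_of_six (k := 2) (by norm_num) (fun hd ↦ h2 ?_) fun hd ↦ h3 ?_) ⟨s ^ 3, ?_⟩
    · exact Int.prime_two.dvd_of_dvd_pow ((dvd_add_left ⟨3 * q ^ 2, by ring⟩).mp hd)
    · exact Int.prime_three.dvd_of_dvd_pow ((dvd_add_left ⟨2 * q ^ 2, by ring⟩).mp hd)
    · linarith
  have hpq' : IsCoprime p q := hpq.of_mul_right_right.of_mul_right_right
  obtain ⟨e, f, rfl, hf, rfl⟩ := exists_cubes_of_mul_eq_cube (a := q) (b := p ^ 2 + 864 * q ^ 2)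
    (c := s) (by
      rw [show 864 * q ^ 2 = 864 * q * q by ring, IsCoprime.add_mul_right_right_iff]
      exact hpq'.symm.pow_right) (by linarith)
  exact ⟨e, f, rfl, (IsCoprime.pow_right_iff three_pos).mp hpq', by linear_combination hf⟩

namespace O

/-- The case of `exists_fixed_cube_root` for elements of `ℤ[√-6]`. -/
lemma exists_eq_of_sq_add_eq_cube {p e f : ℤ} (h2 : ¬ 2 ∣ p) (h3 : ¬ 3 ∣ p) (hpe : IsCoprime p e)
    (h : p ^ 2 + 864 * e ^ 6 = f ^ 3) :
    ∃ m n, p = m ^ 3 - 18 * m * n ^ 2 ∧ 4 * e ^ 3 = n * (m ^ 2 - 2 * n ^ 2) := by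
  have hpf : IsCoprime (2 * p) (f ^ 3) := by
    rw [← h]
    refine isCoprime_two_mul ?_ fun hd ↦ h2 ?_
    · rw [pow_two, add_comm, IsCoprime.add_mul_right_right_iff]
      exact (isCoprime_of_six (k := 5) (by norm_num) h2 h3).symm.mul_right hpe.pow_right
    · exact Int.prime_two.dvd_of_dvd_pow ((dvd_add_left ⟨432 * e ^ 6, by ring⟩).mp hd)
  have h' := congrArg (Int.cast : ℤ → O) h
  push_cast at h'
  have hθ : (t * (1 + 2 * w)) ^ 2 = -6 := by
    linear_combination (1 + 2 * w) ^ 2 * t_sq + 8 * w_sq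
  have hl : t * (1 + 2 * w) = lam * (t * (-w ^ 2 * lam - 2)) := by
    have hl : lam = 1 - w := rfl
    linear_combination t * three_eq + 2 * t * hl
  have hprod : ((p : O) + 12 * e ^ 3 * (t * (1 + 2 * w))) * (p - 12 * e ^ 3 * (t * (1 + 2 * w))) =
      (f : O) ^ 3 := by
    linear_combination h' - 144 * e ^ 6 * hθ
  have hm (m n : ℤ) : (m + n * (t * (1 + 2 * w)) : O) = mk m n 0 (2 * n) := by
    rw [mk_eq]
    push_cast
    ring
  have hm' := hm p (12 * e ^ 3)
  push_cast at hm'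
  obtain ⟨α, hα, hφ⟩ := exists_fixed_cube_root hprod
    (isCoprime_of_int hpf ⟨1, 1, by push_cast; ring⟩ ⟨_, by push_cast; exact hprod.symm⟩)
    (by
      rw [hm', lam_dvd_mk]
      omega) (N := p ^ 8) (by
      obtain ⟨c, hc⟩ : lam ^ 3 ∣ 12 * e ^ 3 * (t * (1 + 2 * w)) :=
        ⟨-w ^ 2 * 4 * e ^ 3 * (t * (-w ^ 2 * lam - 2)),
          by linear_combination 12 * e ^ 3 * hl +
            4 * e ^ 3 * lam * (t * (-w ^ 2 * lam - 2)) * three_eq⟩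
      rw [hc]
      refine ⟨c * ((p + lam ^ 3 * c + p) * ((p + lam ^ 3 * c) ^ 2 + p ^ 2) *
        ((p + lam ^ 3 * c) ^ 4 + p ^ 4)), ?_⟩
      push_cast
      ring)
    (conj (-1) (by norm_num)) (conj_w _ _) (by
      rw [hm', conj_mk, mk_inj]
      omega)
  obtain ⟨x, y, z, u, rfl⟩ := exists_mk α
  rw [conj_mk, mk_inj] at hφ
  obtain ⟨rfl, rfl⟩ : z = 0 ∧ u = 2 * y := by omega
  have hc : mk (x ^ 3 - 18 * x * y ^ 2) (3 * x ^ 2 * y - 6 * y ^ 3) 0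
      (2 * (3 * x ^ 2 * y - 6 * y ^ 3)) = mk p (12 * e ^ 3) 0 (2 * (12 * e ^ 3)) := by
    rw [← hm', ← hα, ← hm, ← hm]
    push_cast
    linear_combination -(3 * x * y ^ 2 + y ^ 3 * (t * (1 + 2 * w))) * hθ
  rw [mk_inj] at hc
  exact ⟨x, y, hc.1.symm, by linarith [hc.2.1]⟩

end O

lemma exists_sq_sub_eq_cube {m n e : ℤ} (h2 : ¬ 2 ∣ m) (hmn : IsCoprime m n)
    (h : 4 * e ^ 3 = n * (m ^ 2 - 2 * n ^ 2)) :
    ∃ k l, e = k * l ∧ IsCoprime m k ∧ m ^ 2 - 32 * k ^ 6 = l ^ 3 := by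
  obtain ⟨n, rfl⟩ : 4 ∣ n := by
    refine IsCoprime.dvd_of_dvd_mul_right (z := m ^ 2 - 2 * n ^ 2)
      (isCoprime_four fun hd ↦ h2 ?_) ⟨_, h.symm⟩
    exact Int.prime_two.dvd_of_dvd_pow ((dvd_sub_left ⟨n ^ 2, by ring⟩).mp hd)
  have hmn' : IsCoprime m n := hmn.of_mul_right_right
  obtain ⟨k, l, rfl, hl, rfl⟩ := exists_cubes_of_mul_eq_cube (a := n) (b := m ^ 2 - 32 * n ^ 2)
    (c := e) (by
      rw [show m ^ 2 - 32 * n ^ 2 = m ^ 2 + (-32 * n) * n by ring,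
        IsCoprime.add_mul_right_right_iff]
      exact hmn'.symm.pow_right) (by linarith)
  exact ⟨k, l, rfl, (IsCoprime.pow_right_iff three_pos).mp hmn', by linear_combination hl⟩

lemma three_dvd_of_three_mul_eq_zero {x : ℤ} (h : 3 * (x : ZMod 9) = 0) : 3 ∣ x := by
  have h : ((3 * x : ℤ) : ZMod 9) = 0 := by exact_mod_cast h
  have := (ZMod.intCast_zmod_eq_zero_iff_dvd _ 9).mp h
  push_cast at this
  omega

lemma nine_dvd_of_sq_sub_eq_cube {m k l : ℤ} (h3 : ¬ 3 ∣ m) (hk : ¬ 3 ∣ k)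
    (h : m ^ 2 - 32 * k ^ 6 = l ^ 3) : 9 ∣ m ^ 2 + 32 * k ^ 6 ∧ 9 ∣ 128 * m ^ 2 * k ^ 6 + 1 := by
  have key : ∀ m k l : ZMod 9, 3 * m ≠ 0 → 3 * k ≠ 0 → m ^ 2 - 32 * k ^ 6 = l ^ 3 →
      m ^ 2 + 32 * k ^ 6 = 0 ∧ 128 * m ^ 2 * k ^ 6 + 1 = 0 := by decide
  have h' := congrArg (Int.cast : ℤ → ZMod 9) h
  push_cast at h'
  obtain ⟨h₁, h₂⟩ := key m k l (mt three_dvd_of_three_mul_eq_zero h3)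
    (mt three_dvd_of_three_mul_eq_zero hk) h'
  constructor
  · exact (ZMod.intCast_zmod_eq_zero_iff_dvd _ 9).mp (by exact_mod_cast h₁)
  · exact (ZMod.intCast_zmod_eq_zero_iff_dvd _ 9).mp (by exact_mod_cast h₂)

namespace O

lemma exists_eq_of_sq_sub_eq_cube {m k l : ℤ} (h2 : ¬ 2 ∣ m) (h3 : ¬ 3 ∣ m) (hmk : IsCoprime m k)
    (h : m ^ 2 - 32 * k ^ 6 = l ^ 3) :
    ∃ P Q, P ^ 3 + 6 * P * Q ^ 2 = m ∧ 3 * P ^ 2 * Q + 2 * Q ^ 3 = 4 * k ^ 3 := by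
  have hml : IsCoprime (2 * m) (l ^ 3) := by
    rw [← h]
    refine isCoprime_two_mul ?_ fun hd ↦ h2 ?_
    · rw [show m ^ 2 - 32 * k ^ 6 = -32 * k ^ 6 + m * m by ring, IsCoprime.add_mul_right_right_iff]
      exact (isCoprime_of_six (k := 5) (by norm_num) h2 h3).symm.mul_right hmk.pow_right
    · exact Int.prime_two.dvd_of_dvd_pow ((dvd_sub_left ⟨16 * k ^ 6, by ring⟩).mp hd)
  have h' := congrArg (Int.cast : ℤ → O) h
  push_cast at h'
  have hprod : ((m : O) + (4 * k ^ 3 : ℤ) * t) * (m - 4 * k ^ 3 * t) = (l : O) ^ 3 := by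
    push_cast
    linear_combination h' - 16 * k ^ 6 * t_sq
  have hcop : IsCoprime ((m : O) + (4 * k ^ 3 : ℤ) * t) (m - 4 * k ^ 3 * t) :=
    isCoprime_of_int hml ⟨1, 1, by push_cast; ring⟩ ⟨_, by push_cast at hprod ⊢; exact hprod.symm⟩
  by_cases hk : 3 ∣ k
  · refine exists_cube_root_of_nine_dvd hprod hcop h3 ?_
    obtain ⟨k, rfl⟩ := hk
    exact ⟨12 * k ^ 3, by ring⟩
  · obtain ⟨⟨u, hu⟩, v, hv⟩ := nine_dvd_of_sq_sub_eq_cube h3 hk h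
    have hu := congrArg (Int.cast : ℤ → O) hu
    have hv := congrArg (Int.cast : ℤ → O) hv
    push_cast at hu hv
    refine exists_cube_root_of_lam_cube_dvd (N := 1) hprod hcop h3 ?_
    have h4 : (m + (4 * k ^ 3 : ℤ) * t : O) ^ 4 =
        9 * (9 * u ^ 2 + 16 * u * m * k ^ 3 * t + v) - 1 := by
      have h2 : (m + (4 * k ^ 3 : ℤ) * t : O) ^ 2 = 9 * u + 8 * m * k ^ 3 * t := by
        push_cast
        linear_combination hu + 16 * k ^ 6 * t_sq
      rw [pow_mul _ 2 2, h2]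
      linear_combination hv + 64 * m ^ 2 * k ^ 6 * t_sq
    rw [pow_mul _ 4 2, h4]
    obtain ⟨c, hc⟩ := lam_cube_dvd_nine
    generalize (9 * u ^ 2 + 16 * u * m * k ^ 3 * t + v : O) = x
    refine ⟨c * (x * (9 * x - 2)), ?_⟩
    push_cast
    linear_combination x * (9 * x - 2) * hc

lemma false_of_three_mul_sq_add_eq_cube {P E F : ℤ} (h2 : ¬ 2 ∣ P) (h3 : ¬ 3 ∣ P) (hE : ¬ 3 ∣ E)
    (hPE : IsCoprime P E) (h : 3 * P ^ 2 + 32 * E ^ 6 = F ^ 3) : False := by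
  have hEF : IsCoprime (2 ^ 4 * E ^ 3) (F ^ 3) := by
    rw [← h]
    refine IsCoprime.mul_left (IsCoprime.pow_left ?_) (IsCoprime.pow_left ?_)
    · rw [show 3 * P ^ 2 + 32 * E ^ 6 = 3 * P ^ 2 + (16 * E ^ 6) * 2 by ring,
        IsCoprime.add_mul_right_right_iff]
      exact IsCoprime.mul_right ⟨-1, 1, by norm_num⟩
        (Int.prime_two.coprime_iff_not_dvd.mpr h2).pow_right
    · rw [show 3 * P ^ 2 + 32 * E ^ 6 = 3 * P ^ 2 + (32 * E ^ 5) * E by ring,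
        IsCoprime.add_mul_right_right_iff]
      exact (Int.prime_three.coprime_iff_not_dvd.mpr hE).symm.mul_right hPE.symm.pow_right
  have h' := congrArg (Int.cast : ℤ → O) h
  push_cast at h'
  have hprod : (4 * E ^ 3 * t + (1 + 2 * w) * P) * (4 * E ^ 3 * t - (1 + 2 * w) * P) =
      1 * (F : O) ^ 3 := by
    linear_combination h' + 16 * E ^ 6 * t_sq - 4 * P ^ 2 * w_sq
  have hcop : IsCoprime (4 * E ^ 3 * t + (1 + 2 * w) * P : O)
      (4 * E ^ 3 * t - (1 + 2 * w) * P) :=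
    isCoprime_of_int hEF ⟨t, t, by push_cast; linear_combination 8 * E ^ 3 * t_sq⟩
      ⟨_, by push_cast; rw [hprod, one_mul]⟩
  obtain ⟨i, hi, j, hj, c, hc⟩ := exists_eq_unit_mul_cube hcop isUnit_one hprod
  have hη : (4 * E ^ 3 * t + (1 + 2 * w) * P : O) = mk P (4 * E ^ 3) (2 * P) 0 := by
    rw [mk_eq]
    push_cast
    ring
  have hcl : ¬ lam ∣ c := fun hd ↦ hE <| by
    have h' : lam ∣ mk P (4 * E ^ 3) (2 * P) 0 :=
      hη ▸ hc ▸ (dvd_pow hd three_ne_zero).mul_left _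
    have h3 := (lam_dvd_mk.mp h').2
    exact Int.prime_three.dvd_of_dvd_pow (n := 3) (by omega)
  obtain ⟨A, hA⟩ : ∃ A : ℤ, A = 32 * E ^ 6 - 3 * P ^ 2 := ⟨_, rfl⟩
  obtain ⟨B, hB⟩ : ∃ B : ℤ, B = 8 * E ^ 3 * P := ⟨_, rfl⟩
  obtain ⟨D, hD⟩ : ∃ D : ℤ, D = 4 * A * B * (A ^ 2 - 6 * B ^ 2) := ⟨_, rfl⟩
  have hη8 : (4 * E ^ 3 * t + (1 + 2 * w) * P : O) ^ 8 =
      mk ((A ^ 2 - 6 * B ^ 2) ^ 2 - 24 * A ^ 2 * B ^ 2) D 0 (2 * D) := by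
    have hθ : (t * (1 + 2 * w)) ^ 2 = -6 := by
      linear_combination (1 + 2 * w) ^ 2 * t_sq + 8 * w_sq
    have h2 : (4 * E ^ 3 * t + (1 + 2 * w) * P : O) ^ 2 = A + B * (t * (1 + 2 * w)) := by
      rw [hA, hB]
      push_cast
      linear_combination 16 * E ^ 6 * t_sq + 4 * P ^ 2 * w_sq
    have h4 : (4 * E ^ 3 * t + (1 + 2 * w) * P : O) ^ 4 =
        A ^ 2 - 6 * B ^ 2 + 2 * A * B * (t * (1 + 2 * w)) := by
      rw [pow_mul _ 2 2, h2]
      linear_combination B ^ 2 * hθ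
    rw [pow_mul _ 4 2, h4, mk_eq, hD]
    push_cast
    linear_combination 4 * A ^ 2 * B ^ 2 * hθ
  have hD3 : ¬ 3 ∣ D := by
    have hA3 : ¬ 3 ∣ A := fun hd ↦ hE <| by
      have h' : 3 ∣ 2 * E ^ 6 := by
        obtain ⟨v, hv⟩ := hd
        exact ⟨v + P ^ 2 - 10 * E ^ 6, by linear_combination hv - hA⟩
      exact Int.prime_three.dvd_of_dvd_pow
        ((Int.prime_three.dvd_or_dvd h').resolve_left (by norm_num))
    have hB3 : ¬ 3 ∣ B := fun hd ↦ by
      rw [hB, mul_assoc] at hd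
      rcases Int.prime_three.dvd_or_dvd ((Int.prime_three.dvd_or_dvd hd).resolve_left (by norm_num))
        with h | h
      · exact hE (Int.prime_three.dvd_of_dvd_pow h)
      · exact h3 h
    rw [hD, mul_assoc, mul_assoc]
    intro hd
    rcases Int.prime_three.dvd_or_dvd ((Int.prime_three.dvd_or_dvd hd).resolve_left (by norm_num))
        with h | h
    · exact hA3 h
    rcases Int.prime_three.dvd_or_dvd h with h | h
    · exact hB3 h
    · exact hA3 (Int.prime_three.dvd_of_dvd_pow
        ((dvd_sub_left (⟨2 * B ^ 2, by ring⟩ : 3 ∣ 6 * B ^ 2)).mp h))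
  obtain ⟨v, hv⟩ := lam_cube_dvd_pow_sub_one hcl
  have hdvd : lam ^ 2 ∣ mk ((A ^ 2 - 6 * B ^ 2) ^ 2 - 24 * A ^ 2 * B ^ 2) D 0 (2 * D) -
      mk (-1) 0 (-1) 0 ^ i * mk 577 408 0 0 ^ j := by
    rw [← hη8, ← w_pow_mul_eps_pow_eight, hc]
    exact ⟨(w ^ i * eps ^ j) ^ 8 * (lam * v), by linear_combination (w ^ i * eps ^ j) ^ 8 * hv⟩
  have h1 (x : O) : x ^ 0 = mk 1 0 0 0 := by simp [mk_eq]
  apply hD3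
  interval_cases i <;> interval_cases j <;>
    simp only [h1, pow_one, pow_two, mk_mul, mk_sub] at hdvd <;>
    have := (of_lam_sq_dvd_mk hdvd).2 <;> omega

/-- One round of the descent for `q * (3 * p ^ 2 + 2 * q ^ 2) = 4 * s ^ 3`. -/
lemma exists_dvd_of_mul_eq_four_mul_cube {p q s : ℤ} (h2 : ¬ 2 ∣ p) (h3 : ¬ 3 ∣ p)
    (hpq : IsCoprime p q) (hs : 3 ∣ s) (h : q * (3 * p ^ 2 + 2 * q ^ 2) = 4 * s ^ 3) :
    ∃ P Q k, ¬ 2 ∣ P ∧ ¬ 3 ∣ P ∧ IsCoprime P Q ∧ 3 * k ∣ s ∧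
      Q * (3 * P ^ 2 + 2 * Q ^ 2) = 4 * k ^ 3 := by
  obtain ⟨e, f, rfl, hpe, hf⟩ := exists_sq_add_eq_cube h2 h3 hpq hs h
  obtain ⟨m, n, hp, he⟩ := exists_eq_of_sq_add_eq_cube h2 h3 hpe hf
  have hmp : m ∣ p := ⟨m ^ 2 - 18 * n ^ 2, by rw [hp]; ring⟩
  have h2m : ¬ 2 ∣ m := fun hd ↦ h2 (hd.trans hmp)
  have h3m : ¬ 3 ∣ m := fun hd ↦ h3 (hd.trans hmp)
  have hmn : IsCoprime m n := by
    have : IsCoprime m (4 * e ^ 3) := (isCoprime_four h2m).symm.mul_right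
      (hpe.of_isCoprime_of_dvd_left hmp).pow_right
    rw [he] at this
    exact this.of_mul_right_left
  obtain ⟨k, l, rfl, hmk, hl⟩ := exists_sq_sub_eq_cube h2m hmn he
  obtain ⟨P, Q, hP, hQ⟩ := exists_eq_of_sq_sub_eq_cube h2m h3m hmk hl
  have hPm : P ∣ m := ⟨P ^ 2 + 6 * Q ^ 2, by rw [← hP]; ring⟩
  have h2P : ¬ 2 ∣ P := fun hd ↦ h2m (hd.trans hPm)
  have h3P : ¬ 3 ∣ P := fun hd ↦ h3m (hd.trans hPm)
  have hQ : Q * (3 * P ^ 2 + 2 * Q ^ 2) = 4 * k ^ 3 := by rw [← hQ]; ring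
  refine ⟨P, Q, k, h2P, h3P, ?_, ⟨l * f, by ring⟩, hQ⟩
  have : IsCoprime P (4 * k ^ 3) := (isCoprime_four h2P).symm.mul_right
    (hmk.of_isCoprime_of_dvd_left hPm).pow_right
  rw [← hQ] at this
  exact this.of_mul_right_left

lemma three_dvd_of_mul_eq_four_mul_cube {p q s : ℤ} (h2 : ¬ 2 ∣ p) (h3 : ¬ 3 ∣ p)
    (hpq : IsCoprime p q) (h : q * (3 * p ^ 2 + 2 * q ^ 2) = 4 * s ^ 3) : 3 ∣ s := by
  by_contra hs
  obtain ⟨q, rfl⟩ : 4 ∣ q := by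
    refine IsCoprime.dvd_of_dvd_mul_right (z := 3 * p ^ 2 + 2 * q ^ 2)
      (isCoprime_four fun hd ↦ h2 ?_) ⟨_, h⟩
    exact Int.prime_two.dvd_of_dvd_pow
      ((Int.prime_two.dvd_or_dvd ((dvd_add_left ⟨q ^ 2, rfl⟩).mp hd)).resolve_left (by norm_num))
  have hpq' : IsCoprime p q := hpq.of_mul_right_right
  have h' : q * (3 * p ^ 2 + 32 * q ^ 2) = s ^ 3 := by linarith
  have hq : ¬ 3 ∣ q := fun hd ↦ hs (Int.prime_three.dvd_of_dvd_pow (h' ▸ hd.mul_right _))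
  obtain ⟨E, F, rfl, hF, rfl⟩ := exists_cubes_of_mul_eq_cube (by
    rw [show 32 * q ^ 2 = 32 * q * q by ring, IsCoprime.add_mul_right_right_iff]
    exact (Int.prime_three.coprime_iff_not_dvd.mpr hq).symm.mul_right hpq'.symm.pow_right) h'
  exact false_of_three_mul_sq_add_eq_cube h2 h3 (fun hd ↦ hq (dvd_pow hd three_ne_zero))
    ((IsCoprime.pow_right_iff three_pos).mp hpq') (by rw [← hF]; ring)

theorem eq_zero_of_mul_eq_four_mul_cube {p q s : ℤ} (h2 : ¬ 2 ∣ p) (h3 : ¬ 3 ∣ p)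
    (hpq : IsCoprime p q) (h : q * (3 * p ^ 2 + 2 * q ^ 2) = 4 * s ^ 3) : s = 0 := by
  induction hn : s.natAbs using Nat.strong_induction_on generalizing p q s with
  | _ n ih =>
    obtain ⟨P, Q, k, h2', h3', hPQ, ⟨c, rfl⟩, h'⟩ := exists_dvd_of_mul_eq_four_mul_cube h2 h3 hpq
      (three_dvd_of_mul_eq_four_mul_cube h2 h3 hpq h) h
    by_contra hs
    have hk : k ≠ 0 := by rintro rfl; simp at hs
    have hc : c ≠ 0 := by rintro rfl; simp at hs
    refine hk (ih _ ?_ h2' h3' hPQ h' rfl)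
    rw [← hn, Int.natAbs_mul, Int.natAbs_mul]
    have := Int.natAbs_pos.mpr hk
    have := Int.natAbs_pos.mpr hc
    norm_num
    nlinarith

/-- A factor `a` of a cube in `ℤ[√2]`, prime to its cofactor and to three, has `a ^ 8` congruent
to one modulo `lam ^ 3` as soon as `a ^ 8` is rational modulo `lam ^ 3`. -/
lemma lam_cube_dvd_sub_one {p q N : ℤ} {b c : O} (h : (p + q * t) * b = c ^ 3)
    (hab : IsCoprime (p + q * t) b) (hq : ¬ 3 ∣ q) (hN : lam ^ 3 ∣ (p + q * t) ^ 8 - (N : O)) :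
    lam ^ 3 ∣ (N : O) - 1 := by
  have hm : (p + q * t : O) = mk p q 0 0 := by simp [mk_eq]
  have hl : ¬ lam ∣ (p + q * t : O) := fun h ↦ hq (lam_dvd_add_mul_t.mp h).2
  obtain ⟨α, hα, -⟩ := exists_fixed_cube_root h hab hl hN
    (conj 1 (one_mul 1)) (conj_w _ _) (by rw [hm, conj_mk]; simp)
  obtain ⟨u, hu⟩ := lam_cube_dvd_pow_sub_one (x := α) fun hd ↦ hl (hα ▸ dvd_pow hd three_ne_zero)
  obtain ⟨v, hv⟩ := hN
  rw [← hα] at hv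
  exact ⟨u - v, by linear_combination hu - hv⟩

lemma not_nine_dvd_of_mul_eq_cube {r s : ℤ} {ξ : O} (hs : ¬ 3 ∣ s)
    (hcop : IsCoprime ((r : O) + (-s : ℤ) * t) (r + (2 * s : ℤ) * t))
    (h : ((r : O) + (-s : ℤ) * t) * (r + (2 * s : ℤ) * t) = ξ ^ 3) : ¬ 9 ∣ r := by
  rintro ⟨r, rfl⟩
  obtain ⟨c, hc⟩ := lam_cube_dvd_nine
  have key (q : ℤ) : lam ^ 3 ∣ (((9 * r : ℤ) : O) + q * t) ^ 8 - (16 * q ^ 8 : ℤ) := by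
    refine ⟨c * r * ((9 * r + q * t + q * t) * ((9 * r + q * t) ^ 2 + (q * t) ^ 2) *
      ((9 * r + q * t) ^ 4 + (q * t) ^ 4)), ?_⟩
    push_cast
    linear_combination r * ((9 * r + q * t + q * t) * ((9 * r + q * t) ^ 2 + (q * t) ^ 2) *
      ((9 * r + q * t) ^ 4 + (q * t) ^ 4)) * hc +
      q ^ 8 * (t ^ 6 + 2 * t ^ 4 + 4 * t ^ 2 + 8) * t_sq
  obtain ⟨u, hu⟩ := lam_cube_dvd_sub_one h hcop (by omega) (key (-s))
  obtain ⟨v, hv⟩ := lam_cube_dvd_sub_one ((mul_comm _ _).trans h) hcop.symm (by omega) (key (2 * s))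
  push_cast at hu hv
  have h3 : lam ^ 2 * (lam * (v - 256 * u - c * 28)) = lam ^ 2 * (-w ^ 2) := by
    linear_combination 256 * hu - hv + 28 * hc + three_eq
  exact prime_lam.not_isUnit (isUnit_of_dvd_unit
    ⟨_, (mul_left_cancel₀ (pow_ne_zero 2 prime_lam.ne_zero) h3).symm⟩ (isUnit_w.pow 2).neg)

theorem eq_zero_of_cube_eq_sq_sub_four_mul_sq {r s : ℤ} (hrs : IsCoprime r s) (hr : ¬ 2 ∣ r)
    (h9 : 9 ∣ r ∨ 9 ∣ s) {ξ : O} (hξ : ξ ^ 3 = r ^ 2 - 4 * s ^ 2 + r * s * t) : s = 0 := by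
  have hprod : ((r : O) + (-s : ℤ) * t) * (r + (2 * s : ℤ) * t) = ξ ^ 3 := by
    rw [hξ]
    push_cast
    linear_combination -2 * s ^ 2 * t_sq
  have hcop : IsCoprime ((r : O) + (-s : ℤ) * t) (r + (2 * s : ℤ) * t) := by
    have h3 : ¬ 3 ∣ r ^ 2 - 2 * s ^ 2 := by
      intro hd
      have key : ∀ r s : ZMod 3, r ^ 2 - 2 * s ^ 2 = 0 → r = 0 ∧ s = 0 := by decide
      have h0 := (ZMod.intCast_zmod_eq_zero_iff_dvd _ 3).mpr hd
      push_cast at h0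
      obtain ⟨h₁, h₂⟩ := key r s h0
      rw [ZMod.intCast_zmod_eq_zero_iff_dvd] at h₁ h₂
      exact Int.prime_three.not_isUnit (hrs.isUnit_of_dvd' h₁ h₂)
    obtain ⟨p, q, hpq⟩ := hrs
    refine isCoprime_of_int (isCoprime_six (fun hd ↦ hr ?_) h3)
      ⟨2 * (2 * p) - t * q, 2 * p + t * q, ?_⟩ ⟨r + s * t, ?_⟩
    · exact Int.prime_two.dvd_of_dvd_pow ((dvd_sub_left ⟨s ^ 2, rfl⟩).mp hd)
    · have hpq' := congrArg (Int.cast : ℤ → O) hpq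
      push_cast at hpq' ⊢
      linear_combination 6 * hpq' + 3 * q * s * t_sq
    · push_cast
      linear_combination s ^ 2 * t_sq
  obtain h9 | ⟨s, rfl⟩ := h9
  · have hs : ¬ 3 ∣ s := not_three_dvd_of_isCoprime hrs.symm (by omega)
    exact (not_nine_dvd_of_mul_eq_cube hs hcop hprod h9).elim
  have hr3 : ¬ 3 ∣ r := not_three_dvd_of_isCoprime hrs ⟨3 * s, by ring⟩
  obtain ⟨x, y, hx, hy⟩ := exists_cube_root_of_nine_dvd hprod hcop hr3 ⟨-s, by ring⟩
  obtain ⟨z, u, hz, hu⟩ := exists_cube_root_of_nine_dvd (mul_comm _ _ |>.trans hprod) hcop.symm hr3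
    ⟨2 * s, by ring⟩
  generalize 9 * s = s at *
  obtain ⟨p, hp⟩ : ∃ p, p = (x ^ 2 + 2 * y ^ 2) * z + 4 * x * y * u := ⟨_, rfl⟩
  obtain ⟨q, hq⟩ : ∃ q, q = (x ^ 2 + 2 * y ^ 2) * u + 2 * x * y * z := ⟨_, rfl⟩
  have hpq : p ^ 3 + 6 * p * q ^ 2 = r ^ 3 - 6 * r * s ^ 2 ∧
      3 * p ^ 2 * q + 2 * q ^ 3 = 4 * s ^ 3 := by
    have h₁ : (x + y * t : O) ^ 3 = r - s * t := by
      rw [← hx, eq_neg_of_add_eq_zero_left (show s + (3 * x ^ 2 * y + 2 * y ^ 3) = 0 by linarith)]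
      push_cast
      linear_combination (3 * x * y ^ 2 + y ^ 3 * t) * t_sq
    have h₂ : (z + u * t : O) ^ 3 = r + 2 * s * t := by
      have hu := congrArg (Int.cast : ℤ → O) hu
      push_cast at hu
      rw [← hz]
      push_cast
      linear_combination (3 * z * u ^ 2 + u ^ 3 * t) * t_sq + t * hu
    have h₃ : (p + q * t : O) = (x + y * t) ^ 2 * (z + u * t) := by
      rw [hp, hq]
      push_cast
      linear_combination -(y ^ 2 * z + 2 * x * y * u + y ^ 2 * u * t) * t_sq
    have h₄ : (p + q * t : O) ^ 3 = (r - s * t) ^ 2 * (r + 2 * s * t) := by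
      rw [h₃, ← h₁, ← h₂]
      ring
    rw [← add_mul_t_inj]
    push_cast
    linear_combination h₄ - (3 * p * q ^ 2 + q ^ 3 * t) * t_sq -
      (3 * r * s ^ 2 - 2 * s ^ 3 * t) * t_sq
  have hpr : p ∣ r * (r ^ 2 - 6 * s ^ 2) := ⟨p ^ 2 + 6 * q ^ 2, by linear_combination -hpq.1⟩
  have hp2 : ¬ 2 ∣ p := fun hd ↦ by
    rcases Int.prime_two.dvd_or_dvd (hd.trans hpr) with h | h
    · exact hr h
    · exact hr (Int.prime_two.dvd_of_dvd_pow ((dvd_sub_left ⟨3 * s ^ 2, by ring⟩).mp h))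
  have hp3 : ¬ 3 ∣ p := fun hd ↦ by
    rcases Int.prime_three.dvd_or_dvd (hd.trans hpr) with h | h
    · exact hr3 h
    · exact hr3 (Int.prime_three.dvd_of_dvd_pow ((dvd_sub_left ⟨2 * s ^ 2, by ring⟩).mp h))
  have hps : IsCoprime p s := by
    refine IsCoprime.of_isCoprime_of_dvd_left (hrs.mul_left ?_) hpr
    rw [show r ^ 2 - 6 * s ^ 2 = r ^ 2 + (-6 * s) * s by ring, IsCoprime.add_mul_right_left_iff]
    exact hrs.pow_left
  have hpq4 : q * (3 * p ^ 2 + 2 * q ^ 2) = 4 * s ^ 3 := by linarith [hpq.2]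
  have hpq' : IsCoprime p (4 * s ^ 3) := (isCoprime_four hp2).symm.mul_right hps.pow_right
  rw [← hpq4] at hpq'
  exact eq_zero_of_mul_eq_four_mul_cube hp2 hp3 hpq'.of_mul_right_left hpq4

end O

lemma isCoprime_of_sub_mul {u v : ℤ} (h : IsCoprime (u - v) (u * v)) : IsCoprime u v := by
  obtain ⟨p, q, hpq⟩ := h
  exact ⟨p + q * v, -p, by linear_combination hpq⟩

/-- A primitive Pythagorean triple is parametrised by coprime integers of opposite parity. -/
lemma exists_parametrization {a b c : ℤ} (h : c ^ 2 = a ^ 2 + b ^ 2) (hab : IsCoprime a b)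
    (ha : ¬ 2 ∣ a) :
    ∃ m n, a = m ^ 2 - n ^ 2 ∧ b = 2 * m * n ∧ IsCoprime m n ∧ ¬ 2 ∣ m + n := by
  have hc : c ≠ 0 := by
    rintro rfl
    obtain rfl : a = 0 := pow_eq_zero_iff two_ne_zero |>.mp
      (by nlinarith [sq_nonneg a, sq_nonneg b])
    exact ha (dvd_zero 2)
  have hP : PythagoreanTriple a b |c| := by
    rw [PythagoreanTriple, abs_mul_abs_self]
    linarith
  obtain ⟨m, n, ha, hb, -, hmn, hpar, -⟩ := hP.coprime_classification'
    (Int.isCoprime_iff_gcd_eq_one.mp hab) (by omega) (abs_pos.mpr hc)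
  exact ⟨m, n, ha, hb, Int.isCoprime_iff_gcd_eq_one.mpr hmn, by omega⟩

lemma nine_dvd_or_nine_dvd {m n : ℤ} (hmn : IsCoprime m n) (h : 9 ∣ m * n) : 9 ∣ m ∨ 9 ∣ n := by
  by_cases hn : 3 ∣ n
  · exact .inr (Prime.pow_dvd_of_dvd_mul_left Int.prime_three 2
      (not_three_dvd_of_isCoprime hmn hn) h)
  · exact .inl (Prime.pow_dvd_of_dvd_mul_right Int.prime_three 2 hn h)

lemma three_dvd_of_odd {x y z : ℤ} (hxy : IsCoprime x (2 * y)) (h3 : 3 ∣ x)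
    (h : z ^ 2 = (x * (x ^ 2 + 24 * y ^ 2)) ^ 2 + (y * (3 * x ^ 2 + 8 * y ^ 2)) ^ 2) : 3 ∣ y := by
  by_contra hy3
  have hx2 : ¬ 2 ∣ x := fun hd ↦ Int.prime_two.not_isUnit (hxy.isUnit_of_dvd' hd ⟨y, rfl⟩)
  have hxy' : IsCoprime x y := hxy.of_mul_right_right
  have hN : IsCoprime (6 * (y * (3 * x ^ 2 + 8 * y ^ 2))) (x ^ 2 - 8 * y ^ 2) := by
    have hN2 : ¬ 2 ∣ x ^ 2 - 8 * y ^ 2 := fun hd ↦ hx2 <|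
      Int.prime_two.dvd_of_dvd_pow ((dvd_sub_left ⟨4 * y ^ 2, by ring⟩).mp hd)
    have hN3 : ¬ 3 ∣ x ^ 2 - 8 * y ^ 2 := fun hd ↦ hy3 <| by
      have h' := (dvd_sub_right (dvd_pow h3 two_ne_zero)).mp hd
      exact Int.prime_three.dvd_of_dvd_pow
        ((Int.prime_three.dvd_or_dvd h').resolve_left (by norm_num))
    have hNy : IsCoprime y (x ^ 2 - 8 * y ^ 2) := by
      rw [show x ^ 2 - 8 * y ^ 2 = x ^ 2 + (-8 * y) * y by ring, IsCoprime.add_mul_right_right_iff]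
      exact hxy'.symm.pow_right
    refine (isCoprime_six hN2 hN3).mul_left (hNy.mul_left ?_)
    rw [show 3 * x ^ 2 + 8 * y ^ 2 = 32 * y ^ 2 + 3 * (x ^ 2 - 8 * y ^ 2) by ring,
      IsCoprime.add_mul_right_left_iff]
    exact (isCoprime_of_six (k := 5) (by norm_num) hN2 hN3).mul_left hNy.pow_left
  have hprod : (z + 3 * (y * (3 * x ^ 2 + 8 * y ^ 2))) * (z - 3 * (y * (3 * x ^ 2 + 8 * y ^ 2))) =
      (x ^ 2 - 8 * y ^ 2) ^ 3 := by
    linear_combination h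
  obtain ⟨a, b, ha, hb, -⟩ := exists_cubes_of_mul_eq_cube (isCoprime_of_sub_mul (by
    rw [hprod, show ∀ u v : ℤ, u + 3 * v - (u - 3 * v) = 6 * v by intros; ring]
    exact hN.pow_right)) hprod
  have key : ∀ a b y : ZMod 9, a ^ 3 - b ^ 3 = 3 * y ^ 3 → 3 * y = 0 := by decide
  refine hy3 (three_dvd_of_three_mul_eq_zero (key a b y ?_))
  have h9 : 9 ∣ a ^ 3 - b ^ 3 - 3 * y ^ 3 :=
    ⟨2 * x ^ 2 * y + 5 * y ^ 3, by linear_combination hb - ha⟩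
  rw [← sub_eq_zero]
  exact_mod_cast (ZMod.intCast_zmod_eq_zero_iff_dvd _ 9).mpr h9

lemma three_dvd_of_two_mul_cube_sub_cube {a b : ℤ} (h : 9 ∣ 2 * a ^ 3 - b ^ 3) : 3 ∣ a := by
  have key : ∀ a b : ZMod 9, 2 * a ^ 3 - b ^ 3 = 0 → 3 * a = 0 := by decide
  refine three_dvd_of_three_mul_eq_zero (key a b ?_)
  exact_mod_cast (ZMod.intCast_zmod_eq_zero_iff_dvd _ 9).mpr h

lemma three_dvd_of_even {x y z : ℤ} (hxy : IsCoprime (2 * x) y) (h3 : 3 ∣ y)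
    (h : z ^ 2 = (4 * x * (2 * x ^ 2 + 3 * y ^ 2)) ^ 2 + (y * (6 * x ^ 2 + y ^ 2)) ^ 2) :
    3 ∣ x := by
  by_contra hx3
  have hy2 : ¬ 2 ∣ y := fun hd ↦ Int.prime_two.not_isUnit (hxy.isUnit_of_dvd' ⟨x, rfl⟩ hd)
  have hxy' : IsCoprime x y := hxy.of_mul_left_right
  have hY2 : ¬ 2 ∣ y * (6 * x ^ 2 + y ^ 2) := fun hd ↦
    (Int.prime_two.dvd_or_dvd hd).elim hy2 fun hd ↦ hy2 <|
      Int.prime_two.dvd_of_dvd_pow ((dvd_add_right ⟨3 * x ^ 2, by ring⟩).mp hd)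
  have hN2 : ¬ 2 ∣ 2 * x ^ 2 - y ^ 2 := fun hd ↦ hy2 <|
    Int.prime_two.dvd_of_dvd_pow ((dvd_sub_right ⟨x ^ 2, rfl⟩).mp hd)
  have hN3 : ¬ 3 ∣ 2 * x ^ 2 - y ^ 2 := fun hd ↦ hx3 <| by
    have h' := (dvd_sub_left (dvd_pow h3 two_ne_zero)).mp hd
    exact Int.prime_three.dvd_of_dvd_pow
      ((Int.prime_three.dvd_or_dvd h').resolve_left (by norm_num))
  have hN : IsCoprime (y * (6 * x ^ 2 + y ^ 2)) (2 * x ^ 2 - y ^ 2) := by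
    have hNy : IsCoprime y (2 * x ^ 2 - y ^ 2) := by
      rw [show 2 * x ^ 2 - y ^ 2 = 2 * x ^ 2 + (-y) * y by ring, IsCoprime.add_mul_right_right_iff]
      exact (Int.prime_two.coprime_iff_not_dvd.mpr hy2).symm.mul_right hxy'.symm.pow_right
    refine hNy.mul_left ?_
    rw [show 6 * x ^ 2 + y ^ 2 = 4 * y ^ 2 + 3 * (2 * x ^ 2 - y ^ 2) by ring,
      IsCoprime.add_mul_right_left_iff]
    exact (isCoprime_four hN2).mul_left hNy.pow_left
  have hY9 : 9 ∣ 3 * (y * (6 * x ^ 2 + y ^ 2)) := by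
    obtain ⟨y, rfl⟩ := h3
    exact ⟨y * (6 * x ^ 2 + (3 * y) ^ 2), by ring⟩
  have hYN : IsCoprime (3 * (y * (6 * x ^ 2 + y ^ 2))) (2 * (2 * x ^ 2 - y ^ 2) ^ 3) :=
    IsCoprime.mul_right ((Int.prime_two.coprime_iff_not_dvd.mpr (by omega)).symm)
      ((Int.prime_three.coprime_iff_not_dvd.mpr hN3).mul_left hN).pow_right
  obtain ⟨v, rfl⟩ : ∃ v, z = 2 * v + 3 * (y * (6 * x ^ 2 + y ^ 2)) := by
    have hz2 : ¬ 2 ∣ z := fun ⟨c, hc⟩ ↦ hY2 <| Int.prime_two.dvd_of_dvd_pow (n := 2)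
      ⟨2 * c ^ 2 - 8 * (x * (2 * x ^ 2 + 3 * y ^ 2)) ^ 2, by rw [hc] at h; linear_combination -h⟩
    exact ⟨(z - 3 * (y * (6 * x ^ 2 + y ^ 2))) / 2, by omega⟩
  have hprod : (v + 3 * (y * (6 * x ^ 2 + y ^ 2))) * v = 2 * (2 * x ^ 2 - y ^ 2) ^ 3 :=
    mul_left_cancel₀ (show (4 : ℤ) ≠ 0 by norm_num) (by linear_combination h)
  have hcop : IsCoprime (v + 3 * (y * (6 * x ^ 2 + y ^ 2))) v :=
    isCoprime_of_sub_mul (by rwa [hprod, add_sub_cancel_left])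
  generalize 3 * (y * (6 * x ^ 2 + y ^ 2)) = Y at *
  generalize 2 * x ^ 2 - y ^ 2 = N at *
  rcases Int.prime_two.dvd_or_dvd (⟨_, hprod⟩ : 2 ∣ (v + Y) * v) with h2 | ⟨v, rfl⟩
  · obtain ⟨u, hu⟩ := h2
    rw [hu] at hprod hcop
    obtain ⟨a, b, rfl, rfl, rfl⟩ := exists_cubes_of_mul_eq_cube (c := N) hcop.of_mul_left_right
      (by linarith)
    exact hN3 ((three_dvd_of_two_mul_cube_sub_cube
      (by rwa [← hu, add_sub_cancel_left])).mul_right b)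
  · obtain ⟨a, b, rfl, hb, rfl⟩ := exists_cubes_of_mul_eq_cube (c := N)
      hcop.symm.of_mul_left_right (by linarith)
    exact hN3 ((three_dvd_of_two_mul_cube_sub_cube
      (by rw [← hb]; simpa using hY9)).mul_right b)

lemma eq_zero_of_odd {x y z : ℤ} (hxy : IsCoprime x (2 * y)) (h3 : 3 ∣ y)
    (h : z ^ 2 = (x * (x ^ 2 + 24 * y ^ 2)) ^ 2 + (y * (3 * x ^ 2 + 8 * y ^ 2)) ^ 2) : y = 0 := by
  have hx2 : ¬ 2 ∣ x := fun hd ↦ Int.prime_two.not_isUnit (hxy.isUnit_of_dvd' hd ⟨y, rfl⟩)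
  have hx3 : ¬ 3 ∣ x := fun hd ↦ Int.prime_three.not_isUnit (hxy.isUnit_of_dvd' hd (h3.mul_left 2))
  have hxy' : IsCoprime x y := hxy.of_mul_right_right
  have hX2 : ¬ 2 ∣ x ^ 2 + 24 * y ^ 2 := fun hd ↦ hx2 <|
    Int.prime_two.dvd_of_dvd_pow ((dvd_add_left ⟨12 * y ^ 2, by ring⟩).mp hd)
  have hYX : IsCoprime (x ^ 2 + 24 * y ^ 2) y := by
    rw [show 24 * y ^ 2 = (24 * y) * y by ring, IsCoprime.add_mul_right_left_iff]
    exact hxy'.pow_left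
  have hcop : IsCoprime (x * (x ^ 2 + 24 * y ^ 2)) (y * (3 * x ^ 2 + 8 * y ^ 2)) := by
    refine (hxy'.mul_right ?_).mul_left (hYX.mul_right ?_)
    · rw [show 3 * x ^ 2 + 8 * y ^ 2 = 8 * y ^ 2 + (3 * x) * x by ring,
        IsCoprime.add_mul_right_right_iff]
      exact (isCoprime_of_six (k := 3) (by norm_num) hx2 hx3).symm.mul_right hxy'.pow_right
    · rw [show 3 * x ^ 2 + 8 * y ^ 2 = -64 * y ^ 2 + 3 * (x ^ 2 + 24 * y ^ 2) by ring,
        IsCoprime.add_mul_right_right_iff]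
      exact IsCoprime.mul_right (((Int.prime_two.coprime_iff_not_dvd.mpr hX2).pow_left
        (m := 6)).symm.neg_right) hYX.pow_right
  obtain ⟨m, n, hm, hn, hmn, hpar⟩ := exists_parametrization h hcop fun hd ↦
    (Int.prime_two.dvd_or_dvd hd).elim hx2 hX2
  have h9 : 9 ∣ m * n := by
    obtain ⟨y, rfl⟩ := h3
    refine IsCoprime.dvd_of_dvd_mul_left (y := 2) ⟨1, -4, by norm_num⟩
      ⟨y * (x ^ 2 + 24 * y ^ 2), by linear_combination -hn⟩
  have hξ : (x + 2 * y * O.t : O) ^ 3 = m ^ 2 - n ^ 2 + 4 * m * n * O.t := by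
    have hm := congrArg (Int.cast : ℤ → O) hm
    have hn := congrArg (Int.cast : ℤ → O) hn
    push_cast at hm hn
    linear_combination hm + 2 * O.t * hn + (12 * x * y ^ 2 + 8 * y ^ 3 * O.t) * O.t_sq
  have hmn0 : m = 0 ∨ n = 0 := by
    obtain h9 | h9 := nine_dvd_or_nine_dvd hmn h9
    · refine .inl (neg_eq_zero.mp (O.eq_zero_of_cube_eq_sq_sub_sq hmn.symm.neg_right (by omega)
        (dvd_neg.mpr h9) (ξ := -(x + 2 * y * O.t)) ?_))
      push_cast
      linear_combination -hξ
    · exact .inr (O.eq_zero_of_cube_eq_sq_sub_sq hmn hpar h9 hξ)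
  have h0 : y * (3 * x ^ 2 + 8 * y ^ 2) = 0 := by
    rw [hn]
    obtain rfl | rfl := hmn0 <;> ring
  refine (mul_eq_zero.mp h0).resolve_right fun h0 ↦ hx2 ?_
  obtain rfl : x = 0 := pow_eq_zero_iff two_ne_zero |>.mp (by nlinarith [sq_nonneg x, sq_nonneg y])
  exact dvd_zero 2

lemma eq_zero_of_even {x y z : ℤ} (hxy : IsCoprime (2 * x) y) (h3 : 3 ∣ x)
    (h : z ^ 2 = (4 * x * (2 * x ^ 2 + 3 * y ^ 2)) ^ 2 + (y * (6 * x ^ 2 + y ^ 2)) ^ 2) :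
    x = 0 := by
  have hy2 : ¬ 2 ∣ y := fun hd ↦ Int.prime_two.not_isUnit (hxy.isUnit_of_dvd' ⟨x, rfl⟩ hd)
  have hxy' : IsCoprime x y := hxy.of_mul_left_right
  have hX2 : ¬ 2 ∣ 2 * x ^ 2 + 3 * y ^ 2 := fun hd ↦ hy2 <| Int.prime_two.dvd_of_dvd_pow
    ((Int.prime_two.dvd_or_dvd ((dvd_add_right ⟨x ^ 2, rfl⟩).mp hd)).resolve_left (by norm_num))
  have hY2 : ¬ 2 ∣ 6 * x ^ 2 + y ^ 2 := fun hd ↦ hy2 <| Int.prime_two.dvd_of_dvd_pow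
    ((dvd_add_right ⟨3 * x ^ 2, by ring⟩).mp hd)
  have hXY : IsCoprime (2 * x ^ 2 + 3 * y ^ 2) y := by
    rw [show 3 * y ^ 2 = (3 * y) * y by ring, IsCoprime.add_mul_right_left_iff]
    exact (Int.prime_two.coprime_iff_not_dvd.mpr hy2).mul_left hxy'.pow_left
  have hcop : IsCoprime (y * (6 * x ^ 2 + y ^ 2)) (4 * x * (2 * x ^ 2 + 3 * y ^ 2)) := by
    have hYo : ¬ 2 ∣ y * (6 * x ^ 2 + y ^ 2) := fun hd ↦
      (Int.prime_two.dvd_or_dvd hd).elim hy2 hY2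
    refine ((isCoprime_four hYo).symm.mul_right (hxy'.symm.mul_left ?_)).mul_right
      (hXY.symm.mul_left ?_)
    · rw [show 6 * x ^ 2 + y ^ 2 = y ^ 2 + (6 * x) * x by ring, IsCoprime.add_mul_right_left_iff]
      exact hxy'.symm.pow_left
    · rw [show 6 * x ^ 2 + y ^ 2 = -8 * y ^ 2 + 3 * (2 * x ^ 2 + 3 * y ^ 2) by ring,
        IsCoprime.add_mul_right_left_iff]
      exact IsCoprime.mul_left (((Int.prime_two.coprime_iff_not_dvd.mpr hX2).pow_left
        (m := 3)).neg_left) hXY.symm.pow_left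
  obtain ⟨m, n, hm, hn, hmn, hpar⟩ := exists_parametrization (h.trans (add_comm _ _)) hcop
    fun hd ↦ (Int.prime_two.dvd_or_dvd hd).elim hy2 hY2
  have hmn9 : 9 ∣ m * n := by
    obtain ⟨x, rfl⟩ := h3
    refine IsCoprime.dvd_of_dvd_mul_left (y := 2) ⟨1, -4, by norm_num⟩
      ⟨4 * x * (6 * x ^ 2 + y ^ 2), by linear_combination -hn⟩
  have hξ : 2 * (y + x * O.t : O) ^ 3 = 2 * (m ^ 2 - n ^ 2) + m * n * O.t := by
    have hm := congrArg (Int.cast : ℤ → O) hm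
    have hn := congrArg (Int.cast : ℤ → O)
      (show 2 * (x * (2 * x ^ 2 + 3 * y ^ 2)) = m * n by linarith)
    push_cast at hm hn
    linear_combination 2 * hm + O.t * hn + 2 * (3 * y * x ^ 2 + x ^ 3 * O.t) * O.t_sq
  have h2 : (2 : O) ≠ 0 := two_ne_zero
  have hmn0 : m = 0 ∨ n = 0 := by
    by_cases hn2 : 2 ∣ n
    · obtain ⟨n, rfl⟩ := hn2
      have hmn := hmn.of_mul_right_right
      have h0 := O.eq_zero_of_cube_eq_sq_sub_four_mul_sq hmn (by omega)
        (nine_dvd_or_nine_dvd hmn (by rw [mul_left_comm] at hmn9; omega)) (ξ := y + x * O.t)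
        (mul_left_cancel₀ h2 (by rw [hξ]; push_cast; ring))
      exact .inr (by rw [h0, mul_zero])
    · obtain ⟨m, rfl⟩ : 2 ∣ m := by
        by_contra hm2
        omega
      have hmn := hmn.of_mul_left_right
      have h0 := O.eq_zero_of_cube_eq_sq_sub_four_mul_sq hmn.symm.neg_right hn2
        ((nine_dvd_or_nine_dvd hmn (by rw [mul_assoc] at hmn9; omega)).symm.imp_right
          (dvd_neg (α := ℤ)).mpr) (ξ := -(y + x * O.t))
        (mul_left_cancel₀ h2 (by push_cast at hξ ⊢; linear_combination -hξ))
      exact .inl (by rw [neg_eq_zero.mp h0, mul_zero])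
  have h0 : x * (2 * x ^ 2 + 3 * y ^ 2) = 0 := by
    have : 4 * x * (2 * x ^ 2 + 3 * y ^ 2) = 0 := by
      rw [hn]
      obtain rfl | rfl := hmn0 <;> ring
    linarith
  refine (mul_eq_zero.mp h0).resolve_right fun h0 ↦ hX2 ?_
  rw [h0]
  exact dvd_zero 2

/-- If `x, y, z` are integers with `gcd(x, y) = 1` and
`4x⁶ + 57x⁴y² + 156x²y⁴ + 4y⁶ = z²`, then `x = 0` or `y = 0`. Equivalently, every
rational point on `C₄ : Y² = X⁶ + (57/4)X⁴ + 39X² + 1` has `X`-coordinate `0` or lies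
at infinity. -/
theorem rational_points_C4 (x y z : ℤ) (hgcd : Int.gcd x y = 1)
    (heq : 4 * x ^ 6 + 57 * x ^ 4 * y ^ 2 + 156 * x ^ 2 * y ^ 4 + 4 * y ^ 6 = z ^ 2) :
    x = 0 ∨ y = 0 := by
  have hxy : IsCoprime x y := Int.isCoprime_iff_gcd_eq_one.mpr hgcd
  have h3 : 3 ∣ x ∨ 3 ∣ y := by
    have key : ∀ x y z : ZMod 3, 4*x^6+57*x^4*y^2+156*x^2*y^4+4*y^6 = z^2 → x = 0 ∨ y = 0 := by
      decide
    have h := key x y z (by exact_mod_cast congrArg (Int.cast : ℤ → ZMod 3) heq)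
    rw [ZMod.intCast_zmod_eq_zero_iff_dvd, ZMod.intCast_zmod_eq_zero_iff_dvd] at h
    exact_mod_cast h
  have h2 : 2 ∣ x ∨ 2 ∣ y := by
    have key : ∀ x y z : ZMod 8, 4*x^6+57*x^4*y^2+156*x^2*y^4+4*y^6 = z^2 →
        4 * x = 0 ∨ 4 * y = 0 := by decide
    have h : ((4 * x : ℤ) : ZMod 8) = 0 ∨ ((4 * y : ℤ) : ZMod 8) = 0 := by
      exact_mod_cast key x y z (by exact_mod_cast congrArg (Int.cast : ℤ → ZMod 8) heq)
    rw [ZMod.intCast_zmod_eq_zero_iff_dvd, ZMod.intCast_zmod_eq_zero_iff_dvd] at h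
    push_cast at h
    omega
  rcases h2 with ⟨x, rfl⟩ | ⟨y, rfl⟩
  · obtain ⟨z, rfl⟩ : 2 ∣ z := Int.prime_two.dvd_of_dvd_pow (n := 2)
      ⟨128 * x ^ 6 + 456 * x ^ 4 * y ^ 2 + 312 * x ^ 2 * y ^ 4 + 2 * y ^ 6, by rw [← heq]; ring⟩
    have h : z ^ 2 = (4 * x * (2 * x ^ 2 + 3 * y ^ 2)) ^ 2 + (y * (6 * x ^ 2 + y ^ 2)) ^ 2 := by
      linarith
    have hx3 : 3 ∣ x := h3.elim (fun hd ↦ by omega) fun hd ↦ three_dvd_of_even hxy hd h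
    exact .inl (by rw [eq_zero_of_even hxy hx3 h, mul_zero])
  · obtain ⟨z, rfl⟩ : 2 ∣ z := Int.prime_two.dvd_of_dvd_pow (n := 2)
      ⟨2 * x ^ 6 + 114 * x ^ 4 * y ^ 2 + 1248 * x ^ 2 * y ^ 4 + 128 * y ^ 6, by rw [← heq]; ring⟩
    have h : z ^ 2 = (x * (x ^ 2 + 24 * y ^ 2)) ^ 2 + (y * (3 * x ^ 2 + 8 * y ^ 2)) ^ 2 := by
      linarith
    have hy3 : 3 ∣ y := h3.elim (fun hd ↦ three_dvd_of_odd hxy hd h) fun hd ↦ by omega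
    exact .inr (by rw [eq_zero_of_odd hxy hy3 h, mul_zero])
end

section
/- Let x, y be coprime integers and z an integer satisfying 3x⁶ + 18x⁵y + 9x⁴y² - 148x³y³ - 27x²y⁴ + 162xy⁵ - 81y⁶ = 2z³. Then (x, y, z) is one of (1, -1, -4), (-1, 1, -4), (3, 1, 12), (-3, -1, 12). -/
section

open Polynomial NumberField

/-- The pure cubic field `ℚ(∛3)`. -/
abbrev CbrtThree : Type := AdjoinRoot (X ^ 3 - C 3 : ℚ[X])

namespace CbrtThree

instance : Fact (Irreducible (X ^ 3 - C 3 : ℚ[X])) := ⟨by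
  refine X_pow_sub_C_irreducible_of_prime Nat.prime_three fun b hb => ?_
  have hb' : b = ((b.num : ℤ) : ℚ) := by
    have : IsIntegral ℤ b := by
      refine ⟨X ^ 3 - C 3, monic_X_pow_sub_C 3 (by norm_num), by simp [hb]⟩
    obtain ⟨n, rfl⟩ := IsIntegrallyClosed.isIntegral_iff.1 this
    simp
  rw [hb'] at hb
  have h : b.num ^ 3 = 3 := by exact_mod_cast hb
  have h1 : b.num < 2 := by by_contra! h2; nlinarith [pow_le_pow_left₀ (by norm_num) h2 3]
  have h0 : 0 < b.num := by
    by_contra! h2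
    nlinarith [sq_nonneg b.num]
  have : b.num = 1 := by omega
  rw [this] at h
  norm_num at h⟩

/-- The cube root of `3`. -/
noncomputable def s : CbrtThree := AdjoinRoot.root _

lemma s_pow_three : s ^ 3 = 3 := by
  have h := AdjoinRoot.eval₂_root (X ^ 3 - C 3 : ℚ[X])
  rw [eval₂_sub, eval₂_X_pow, eval₂_C, sub_eq_zero] at h
  rw [s, h]
  simp

lemma monic_poly : (X ^ 3 - C 3 : ℚ[X]).Monic := monic_X_pow_sub_C 3 (by norm_num)

/-- The power basis `1, s, s²`. -/
noncomputable def pb : PowerBasis ℚ CbrtThree := AdjoinRoot.powerBasis monic_poly.ne_zero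

noncomputable instance : NumberField CbrtThree where
  to_finiteDimensional := pb.finite

lemma dim_pb : pb.dim = 3 := by simp [pb]

/-- The basis `1, s, s²`, indexed by `Fin 3`. -/
noncomputable def bas : Module.Basis (Fin 3) ℚ CbrtThree := pb.basis.reindex (finCongr dim_pb)

lemma bas_apply (i : Fin 3) : bas i = s ^ (i : ℕ) := by
  rw [bas, Module.Basis.reindex_apply, pb.basis_eq_pow]
  rfl

lemma finrank_eq : Module.finrank ℚ CbrtThree = 3 := by
  simpa using Module.finrank_eq_card_basis bas

/-- The element `a + b s + c s²`. -/
noncomputable def mk (a b c : ℚ) : CbrtThree :=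
  algebraMap ℚ _ a + algebraMap ℚ _ b * s + algebraMap ℚ _ c * s ^ 2

lemma mk_eq (a b c : ℚ) : mk a b c = bas.equivFun.symm ![a, b, c] := by
  rw [Module.Basis.equivFun_symm_apply, Fin.sum_univ_three]
  simp [bas_apply, Algebra.smul_def, mk]

lemma repr_mk (a b c : ℚ) (i : Fin 3) : bas.repr (mk a b c) i = ![a, b, c] i := by
  rw [← Module.Basis.equivFun_apply, mk_eq, LinearEquiv.apply_symm_apply]

lemma mk_mul (a b c a' b' c' : ℚ) : mk a b c * mk a' b' c' =
    mk (a * a' + 3 * (b * c' + c * b')) (a * b' + b * a' + 3 * c * c')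
      (a * c' + b * b' + c * a') := by
  simp only [mk, map_add, map_mul, map_ofNat]
  linear_combination (algebraMap ℚ _ b * algebraMap ℚ _ c' + algebraMap ℚ _ c * algebraMap ℚ _ b'
    + algebraMap ℚ _ c * algebraMap ℚ _ c' * s) * s_pow_three

lemma mk_inj {a b c a' b' c' : ℚ} (h : mk a b c = mk a' b' c') : a = a' ∧ b = b' ∧ c = c' := by
  have := congrArg (fun z => (bas.repr z 0, bas.repr z 1, bas.repr z 2)) h
  simpa [repr_mk] using this

lemma bas_zero : bas 0 = mk 1 0 0 := by simp [bas_apply, mk]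

lemma bas_one : bas 1 = mk 0 1 0 := by simp [bas_apply, mk]

lemma bas_two : bas 2 = mk 0 0 1 := by simp [bas_apply, mk]

lemma leftMulMatrix_mk (a b c : ℚ) : Algebra.leftMulMatrix bas (mk a b c) =
    !![a, 3 * c, 3 * b; b, a, 3 * c; c, b, a] := by
  ext i j
  rw [Algebra.leftMulMatrix_eq_repr_mul]
  fin_cases i <;> fin_cases j <;> simp [bas_zero, bas_one, bas_two, mk_mul, repr_mk]

lemma norm_mk (a b c : ℚ) :
    Algebra.norm ℚ (mk a b c) = a ^ 3 + 3 * b ^ 3 + 9 * c ^ 3 - 9 * a * b * c := by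
  rw [Algebra.norm_eq_matrix_det bas, leftMulMatrix_mk, Matrix.det_fin_three]
  simp
  ring

lemma trace_mk (a b c : ℚ) : Algebra.trace ℚ _ (mk a b c) = 3 * a := by
  rw [Algebra.trace_eq_matrix_trace bas, leftMulMatrix_mk, Matrix.trace_fin_three]
  simp
  ring

lemma discr_bas : Algebra.discr ℚ bas = -243 := by
  rw [Algebra.discr_def, Matrix.det_fin_three]
  simp only [Algebra.traceMatrix_apply, Algebra.traceForm_apply, bas_zero, bas_one, bas_two, mk_mul,
    trace_mk]
  norm_num

lemma isIntegral_s : IsIntegral ℤ s :=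
  ⟨X ^ 3 - C 3, monic_X_pow_sub_C 3 (by norm_num), by simp [s_pow_three]⟩

lemma gen_pb : pb.gen = s := rfl

lemma minpoly_s : minpoly ℤ s = X ^ 3 - C 3 := by
  have h₁ := minpoly.isIntegrallyClosed_eq_field_fractions' ℚ isIntegral_s
  have h₂ : minpoly ℚ s = X ^ 3 - C 3 := by
    have := AdjoinRoot.minpoly_powerBasis_gen_of_monic monic_poly
    exact this
  apply map_injective (algebraMap ℤ ℚ) (algebraMap ℤ ℚ).injective_int
  rw [← h₁, h₂]
  simp [map_ofNat]

lemma mem_adjoin_of_isIntegral {z : CbrtThree} (hz : IsIntegral ℤ z) :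
    z ∈ Algebra.adjoin ℤ {s} := by
  have hp : Prime (3 : ℤ) := Int.prime_three
  have H := Algebra.discr_mul_isIntegral_mem_adjoin ℚ (R := ℤ) (B := pb) isIntegral_s hz
  have hd : Algebra.discr ℚ pb.basis = -243 := by
    rw [← discr_bas, bas, Module.Basis.coe_reindex, Algebra.discr_reindex]
  rw [hd, gen_pb] at H
  have H' : (3 : ℤ) ^ 5 • z ∈ Algebra.adjoin ℤ {s} := by
    convert neg_mem H using 1
    rw [Algebra.smul_def, Algebra.smul_def]; norm_num
  refine mem_adjoin_of_smul_prime_pow_smul_of_minpoly_isEisensteinAt (B := pb) hp isIntegral_s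
    hz H' ?_
  rw [gen_pb, minpoly_s]
  refine ⟨?_, ?_, ?_⟩
  · rw [(monic_X_pow_sub_C (3 : ℤ) (by norm_num)).leadingCoeff]
    rw [Ideal.submodule_span_eq, Ideal.mem_span_singleton]
    norm_num
  · intro n hn
    rw [natDegree_X_pow_sub_C] at hn
    rw [Ideal.submodule_span_eq, Ideal.mem_span_singleton]
    interval_cases n <;> simp [coeff_X_pow, coeff_ofNat_succ]
  · rw [Ideal.submodule_span_eq, Ideal.span_singleton_pow, Ideal.mem_span_singleton]
    simp

lemma exists_int_mk {z : CbrtThree} (hz : IsIntegral ℤ z) :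
    ∃ a b c : ℤ, z = mk a b c := by
  have hz' := mem_adjoin_of_isIntegral hz
  clear hz
  induction hz' using Algebra.adjoin_induction with
  | mem x hx => exact ⟨0, 1, 0, by simpa [mk] using hx⟩
  | algebraMap r => exact ⟨r, 0, 0, by simp [mk]⟩
  | add x y hx hy h1 h2 =>
    obtain ⟨a, b, c, rfl⟩ := h1
    obtain ⟨a', b', c', rfl⟩ := h2
    refine ⟨a + a', b + b', c + c', ?_⟩
    simp only [mk, Int.cast_add, map_add]
    ring
  | mul x y hx hy h1 h2 =>
    obtain ⟨a, b, c, rfl⟩ := h1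
    obtain ⟨a', b', c', rfl⟩ := h2
    rw [mk_mul]
    exact ⟨a * a' + 3 * (b * c' + c * b'), a * b' + b * a' + 3 * c * c', a * c' + b * b' + c * a',
      by push_cast; rfl⟩

lemma isIntegral_mk (a b c : ℤ) : IsIntegral ℤ (mk a b c) := by
  have h (n : ℤ) : IsIntegral ℤ (algebraMap ℚ CbrtThree n) := by
    simpa using (isIntegral_algebraMap (R := ℤ) (A := CbrtThree) (x := n))
  exact ((h a).add ((h b).mul isIntegral_s)).add ((h c).mul (isIntegral_s.pow 2))

/-- The integer `a + b s + c s²`. -/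
noncomputable def int (a b c : ℤ) : 𝓞 CbrtThree := ⟨mk a b c, isIntegral_mk a b c⟩

lemma coe_int (a b c : ℤ) : (int a b c : CbrtThree) = mk a b c := rfl

lemma exists_int (z : 𝓞 CbrtThree) : ∃ a b c : ℤ, z = int a b c := by
  obtain ⟨a, b, c, h⟩ := exists_int_mk z.isIntegral_coe
  exact ⟨a, b, c, RingOfIntegers.ext h⟩

lemma int_inj {a b c a' b' c' : ℤ} (h : int a b c = int a' b' c') : a = a' ∧ b = b' ∧ c = c' := by
  have := mk_inj (congrArg (fun z : 𝓞 CbrtThree => (z : CbrtThree)) h)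
  exact_mod_cast this

lemma int_mul (a b c a' b' c' : ℤ) : int a b c * int a' b' c' =
    int (a * a' + 3 * (b * c' + c * b')) (a * b' + b * a' + 3 * c * c')
      (a * c' + b * b' + c * a') := by
  apply RingOfIntegers.ext
  change mk a b c * mk a' b' c' = mk _ _ _
  rw [mk_mul]
  push_cast
  rfl

lemma int_add (a b c a' b' c' : ℤ) : int a b c + int a' b' c' =
    int (a + a') (b + b') (c + c') := by
  apply RingOfIntegers.ext
  change mk a b c + mk a' b' c' = mk _ _ _
  simp only [mk, Int.cast_add, map_add]
  ring

lemma int_neg (a b c : ℤ) : -int a b c = int (-a) (-b) (-c) := by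
  apply RingOfIntegers.ext
  change -mk a b c = mk _ _ _
  simp only [mk, Int.cast_neg, map_neg]
  ring

lemma int_sub (a b c a' b' c' : ℤ) : int a b c - int a' b' c' =
    int (a - a') (b - b') (c - c') := by
  rw [sub_eq_add_neg (int a b c), int_neg, int_add]
  simp only [sub_eq_add_neg]

lemma intCast_eq (n : ℤ) : (n : 𝓞 CbrtThree) = int n 0 0 := by
  apply RingOfIntegers.ext
  rw [coe_int]
  simp [mk]

lemma norm_int (a b c : ℤ) :
    Algebra.norm ℤ (int a b c) = a ^ 3 + 3 * b ^ 3 + 9 * c ^ 3 - 9 * a * b * c := by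
  have h := Algebra.coe_norm_int (int a b c)
  rw [coe_int, norm_mk] at h
  exact_mod_cast h

lemma trace_int (a b c : ℤ) : Algebra.trace ℤ _ (int a b c) = 3 * a := by
  have h := Algebra.coe_trace_int (int a b c)
  rw [coe_int, trace_mk] at h
  exact_mod_cast h

/-- Coordinates of an integer with respect to `1, s, s²`. -/
noncomputable def coordEquiv : (Fin 3 → ℤ) ≃ₗ[ℤ] 𝓞 CbrtThree :=
  LinearEquiv.ofBijective
    { toFun := fun v => int (v 0) (v 1) (v 2)
      map_add' := fun v w => by simp [int_add]
      map_smul' := fun n v => by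
        simp only [Pi.smul_apply, smul_eq_mul, RingHom.id_apply]
        rw [zsmul_eq_mul, intCast_eq, int_mul]
        simp }
    ⟨fun v w h => by
        obtain ⟨h0, h1, h2⟩ := int_inj h
        ext i
        fin_cases i <;> assumption,
      fun z => by
        obtain ⟨a, b, c, rfl⟩ := exists_int z
        exact ⟨![a, b, c], rfl⟩⟩

/-- The integral basis `1, s, s²`. -/
noncomputable def intBasis : Module.Basis (Fin 3) ℤ (𝓞 CbrtThree) :=
  .ofEquivFun coordEquiv.symm

lemma intBasis_apply (i : Fin 3) : intBasis i =
    int ((Pi.single i 1 : Fin 3 → ℤ) 0) ((Pi.single i 1 : Fin 3 → ℤ) 1)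
      ((Pi.single i 1 : Fin 3 → ℤ) 2) := by
  rw [intBasis, Module.Basis.coe_ofEquivFun]
  rfl

lemma discr_eq : discr CbrtThree = -243 := by
  rw [← discr_eq_discr CbrtThree intBasis, Algebra.discr_def, Matrix.det_fin_three]
  have h0 : intBasis 0 = int 1 0 0 := by simp [intBasis_apply]
  have h1 : intBasis 1 = int 0 1 0 := by simp [intBasis_apply]
  have h2 : intBasis 2 = int 0 0 1 := by simp [intBasis_apply]
  simp only [Algebra.traceMatrix_apply, Algebra.traceForm_apply, h0, h1, h2, int_mul, trace_int]
  norm_num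

lemma nrComplexPlaces_eq : InfinitePlace.nrComplexPlaces CbrtThree = 1 := by
  have h := sign_discr CbrtThree
  have h2 := InfinitePlace.card_add_two_mul_card_eq_rank CbrtThree
  rw [finrank_eq] at h2
  rw [discr_eq] at h
  have : InfinitePlace.nrComplexPlaces CbrtThree ≠ 0 := by
    intro h0
    rw [h0] at h
    revert h
    decide
  omega

lemma rank_eq : Units.rank CbrtThree = 1 := by
  have h2 := InfinitePlace.card_add_two_mul_card_eq_rank CbrtThree
  rw [finrank_eq, nrComplexPlaces_eq] at h2
  rw [Units.rank, InfinitePlace.card_eq_nrRealPlaces_add_nrComplexPlaces, nrComplexPlaces_eq]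
  omega

lemma int_one : int 1 0 0 = 1 := by rw [← intCast_eq, Int.cast_one]

lemma minkowski_bound_lt :
    (4 / Real.pi) ^ InfinitePlace.nrComplexPlaces CbrtThree *
      ((Module.finrank ℚ CbrtThree).factorial / (Module.finrank ℚ CbrtThree : ℝ) ^
        Module.finrank ℚ CbrtThree * √|discr CbrtThree|) < 5 := by
  rw [nrComplexPlaces_eq, finrank_eq, discr_eq]
  have h1 : √|((-243 : ℤ) : ℝ)| < 15.6 := by
    rw [Real.sqrt_lt' (by norm_num)]
    norm_num [abs_of_neg]
  have h2 : 4 / Real.pi < 4 / 3.14 := by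
    gcongr
    exact Real.pi_gt_d2
  have h3 := mul_lt_mul'' h2 h1 (by positivity) (Real.sqrt_nonneg _)
  norm_num [Nat.factorial] at h3 ⊢
  linarith

lemma eq_span_of_prime_natAbs_norm {I : Ideal (𝓞 CbrtThree)} (hI : I.IsPrime) {x : 𝓞 CbrtThree}
    (hx : x ∈ I) (hn : (Algebra.norm ℤ x).natAbs.Prime) : I = Ideal.span {x} := by
  have hp : (Ideal.span {x}).IsPrime := by
    apply Ideal.isPrime_of_irreducible_absNorm
    rwa [Ideal.absNorm_span_singleton]
  have h0 : Ideal.span {x} ≠ ⊥ := by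
    rw [Ne, Ideal.span_singleton_eq_bot]
    rintro rfl
    simp at hn
    exact Nat.not_prime_zero hn
  exact ((hp.isMaximal h0).eq_of_le hI.ne_top ((Ideal.span_singleton_le_iff_mem I).2 hx)).symm

lemma isPrincipal_of_two_mem {I : Ideal (𝓞 CbrtThree)} (hI : I.IsPrime)
    (h2 : (2 : 𝓞 CbrtThree) ∈ I) : I.IsPrincipal := by
  have hfac : int (-1) 1 0 * int 1 1 1 = 2 := by
    rw [int_mul]; norm_num; exact_mod_cast (intCast_eq 2).symm
  rw [← hfac] at h2
  rcases hI.mem_or_mem h2 with h | h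
  · exact ⟨_, eq_span_of_prime_natAbs_norm hI h (by rw [norm_int]; norm_num)⟩
  · refine ⟨int 1 1 1, le_antisymm (fun z hz => ?_) ((Ideal.span_singleton_le_iff_mem I).2 h)⟩
    rw [Ideal.submodule_span_eq, Ideal.mem_span_singleton]
    have h1 : int 1 0 0 ∉ I := by rw [int_one]; exact (Ideal.ne_top_iff_one I).1 hI.ne_top
    obtain ⟨a, b, c, rfl⟩ := exists_int z
    have key (a b : ℤ) (hab : int a b 0 ∈ I) : 2 ∣ a ∧ 2 ∣ b := by
      have h2 : ∀ u v : ℤ, int (2 * u) (2 * v) 0 ∈ I := fun u v => by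
        have := I.mul_mem_left (int u v 0 * int (-1) 1 0) h
        rw [mul_assoc, int_mul (-1), int_mul] at this
        convert this using 2 <;> ring
      obtain ⟨u, hu | hu⟩ := Int.even_or_odd' a <;> obtain ⟨v, hv | hv⟩ := Int.even_or_odd' b
      · exact ⟨⟨u, hu⟩, ⟨v, hv⟩⟩
      · exfalso
        have h3 : int 0 1 0 ∈ I := by
          have := I.sub_mem hab (h2 u v)
          rwa [int_sub, hu, hv, show 2 * u - (2 * u) = 0 by ring,
            show 2 * v + 1 - (2 * v) = 1 by ring] at this
        have h4 := I.mul_mem_left (int 0 0 1) h3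
        rw [int_mul] at h4
        have := I.sub_mem h4 (h2 1 0)
        rw [int_sub] at this
        exact h1 (by simpa using this)
      · exfalso
        have := I.sub_mem hab (h2 u v)
        rw [int_sub, hu, hv, show 2 * u + 1 - (2 * u) = 1 by ring,
          show 2 * v - (2 * v) = 0 by ring] at this
        exact h1 this
      · exfalso
        have h3 : int 1 1 0 ∈ I := by
          have := I.sub_mem hab (h2 u v)
          rwa [int_sub, hu, hv, show 2 * u + 1 - (2 * u) = 1 by ring,
            show 2 * v + 1 - (2 * v) = 1 by ring] at this
        have h4 := I.mul_mem_left (int 0 1 0) h3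
        rw [int_mul] at h4
        have := I.sub_mem h h4
        rw [int_sub] at this
        exact h1 (by simpa using this)
    have h3 := I.sub_mem hz (I.mul_mem_left (int c 0 0) h)
    rw [int_mul, int_sub] at h3
    obtain ⟨⟨u, hu⟩, ⟨v, hv⟩⟩ := key (a - c) (b - c) (by convert h3 using 2 <;> ring)
    refine ⟨int c 0 0 + int u v 0 * int (-1) 1 0, ?_⟩
    rw [int_mul, int_add, int_mul]
    obtain rfl : a = c + 2 * u := by linarith
    obtain rfl : b = c + 2 * v := by linarith
    congr 1 <;> ring

lemma isPrincipal_of_three_mem {I : Ideal (𝓞 CbrtThree)} (hI : I.IsPrime)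
    (h3 : (3 : 𝓞 CbrtThree) ∈ I) : I.IsPrincipal := by
  have hfac : int 0 1 0 * (int 0 1 0 * int 0 1 0) = 3 := by
    rw [int_mul, int_mul]; norm_num; exact_mod_cast (intCast_eq 3).symm
  rw [← hfac] at h3
  have h : int 0 1 0 ∈ I := by
    rcases hI.mem_or_mem h3 with h | h
    · exact h
    · exact (or_self_iff).1 (hI.mem_or_mem h)
  exact ⟨_, eq_span_of_prime_natAbs_norm hI h (by rw [norm_int]; norm_num)⟩

instance : IsPrincipalIdealRing (𝓞 CbrtThree) := by
  apply RingOfIntegers.isPrincipalIdealRing_of_isPrincipal_of_norm_le_of_isPrime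
  intro I hI hle
  have hlt : Ideal.absNorm (I : Ideal (𝓞 CbrtThree)) < 5 := by
    exact_mod_cast hle.trans_lt minkowski_bound_lt
  have hmem := Ideal.absNorm_mem (I : Ideal (𝓞 CbrtThree))
  have hne : Ideal.absNorm (I : Ideal (𝓞 CbrtThree)) ≠ 0 := by
    rw [Ne, Ideal.absNorm_eq_zero_iff]
    exact nonZeroDivisors.coe_ne_zero I
  generalize Ideal.absNorm (I : Ideal (𝓞 CbrtThree)) = n at *
  interval_cases n
  · exact absurd rfl hne
  · exact absurd ((Ideal.eq_top_iff_one _).2 (by simpa using hmem)) hI.ne_top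
  · exact isPrincipal_of_two_mem hI (by simpa using hmem)
  · exact isPrincipal_of_three_mem hI (by simpa using hmem)
  · refine isPrincipal_of_two_mem hI (hI.mem_of_pow_mem 2 ?_)
    convert hmem using 1
    norm_num

lemma int_sq (p q r : ℤ) : int p q r ^ 2 =
    int (p ^ 2 + 6 * q * r) (2 * p * q + 3 * r ^ 2) (q ^ 2 + 2 * p * r) := by
  rw [pow_two, int_mul]
  congr 1 <;> ring

/-- The unit `s² - 2`. -/
noncomputable def eta : (𝓞 CbrtThree)ˣ where
  val := int (-2) 0 1
  inv := int 4 3 2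
  val_inv := by rw [int_mul, ← int_one]; norm_num
  inv_val := by rw [int_mul, ← int_one]; norm_num

lemma coe_eta : (eta : 𝓞 CbrtThree) = int (-2) 0 1 := rfl

lemma eta_ne_sq_or_neg_sq (v : (𝓞 CbrtThree)ˣ) : ¬(eta = v ^ 2 ∨ eta = -v ^ 2) := by
  obtain ⟨p, q, r, h⟩ := exists_int v
  have key : ∀ n : ZMod 5, n ^ 2 ≠ 2 ∧ n ^ 2 ≠ -2 := by decide
  rintro (hv | hv)
  · have hv := congrArg (Units.val) hv
    rw [Units.val_pow_eq_pow_val, h, int_sq, coe_eta] at hv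
    obtain ⟨h0, h1, h2⟩ := int_inj hv
    apply (key ((p + 2 * q + 4 * r : ℤ) : ZMod 5)).1
    rw [← Int.cast_pow, show (2 : ZMod 5) = ((2 : ℤ) : ZMod 5) by norm_num,
      ZMod.intCast_eq_intCast_iff_dvd_sub]
    exact ⟨-2 * r ^ 2 - 2 * q * r, by linear_combination h0 + 2 * h1 + 4 * h2⟩
  · have hv := congrArg (Units.val) hv
    rw [Units.val_neg, Units.val_pow_eq_pow_val, h, int_sq, coe_eta, int_neg] at hv
    obtain ⟨h0, h1, h2⟩ := int_inj hv
    apply (key ((p + 2 * q + 4 * r : ℤ) : ZMod 5)).2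
    rw [← Int.cast_pow, show (-2 : ZMod 5) = ((-2 : ℤ) : ZMod 5) by norm_num,
      ZMod.intCast_eq_intCast_iff_dvd_sub]
    exact ⟨-2 * r ^ 2 - 2 * q * r, by linear_combination -h0 - 2 * h1 - 4 * h2⟩

lemma exists_fundamental_unit : ∃ ε : (𝓞 CbrtThree)ˣ, ∀ u : (𝓞 CbrtThree)ˣ,
    ∃ n : ℤ, u = ε ^ n ∨ u = -ε ^ n := by
  have hsub : Subsingleton (Fin (Units.rank CbrtThree)) := by rw [rank_eq]; infer_instance
  let i : Fin (Units.rank CbrtThree) := ⟨0, by rw [rank_eq]; norm_num⟩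
  refine ⟨Units.fundSystem CbrtThree i, fun u => ?_⟩
  obtain ⟨⟨ζ, e⟩, h, -⟩ := Units.exist_unique_eq_mul_prod CbrtThree u
  rw [Fintype.prod_subsingleton _ i] at h
  refine ⟨e i, ?_⟩
  have hodd : Odd (Module.finrank ℚ CbrtThree) := by rw [finrank_eq]; decide
  rcases Units.torsion_eq_one_or_neg_one_of_odd_finrank hodd ζ with hζ | hζ
  · left; rw [h, hζ]; simp
  · right; rw [h, hζ]; simp

lemma unit_mod_squares (u : (𝓞 CbrtThree)ˣ) : ∃ v : (𝓞 CbrtThree)ˣ,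
    u = v ^ 2 ∨ u = -v ^ 2 ∨ u = eta * v ^ 2 ∨ u = -(eta * v ^ 2) := by
  obtain ⟨ε, hε⟩ := exists_fundamental_unit
  obtain ⟨m, hm⟩ := hε eta
  obtain ⟨n, hn⟩ := hε u
  have hsq (k : ℤ) : ε ^ (2 * k) = (ε ^ k) ^ 2 := by
    rw [mul_comm, zpow_mul]; rfl
  obtain ⟨k, rfl | rfl⟩ := Int.even_or_odd' m
  · rw [hsq] at hm
    exact absurd hm (eta_ne_sq_or_neg_sq _)
  obtain ⟨l, rfl | rfl⟩ := Int.even_or_odd' n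
  · rw [hsq] at hn
    exact ⟨ε ^ l, by tauto⟩
  · refine ⟨ε ^ (l - k), ?_⟩
    have : ε ^ (2 * l + 1) = ε ^ (2 * k + 1) * (ε ^ (l - k)) ^ 2 := by
      rw [← hsq, ← zpow_add]; congr 1; ring
    rw [this] at hn
    rcases hm with hm | hm <;> rcases hn with hn | hn <;> simp [hm, hn]

lemma isCoprime_factors {t N m : ℤ} (h : t ^ 2 + 243 * m ^ 6 = N ^ 3) (hNm : IsCoprime N m)
    (h3 : ¬(3 : ℤ) ∣ N) :
    IsCoprime (int N 0 (-3 * m ^ 2)) (int (N ^ 2) (27 * m ^ 4) (3 * m ^ 2 * N)) := by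
  rw [IsCoprime, ← Ideal.mem_span_pair]
  set J : Ideal (𝓞 CbrtThree) :=
    Ideal.span {int N 0 (-3 * m ^ 2), int (N ^ 2) (27 * m ^ 4) (3 * m ^ 2 * N)}
  have hα : int N 0 (-3 * m ^ 2) ∈ J := Ideal.subset_span (by simp)
  have hβ : int (N ^ 2) (27 * m ^ 4) (3 * m ^ 2 * N) ∈ J := Ideal.subset_span (by simp)
  have h1 : ((3 * N ^ 2 : ℤ) : 𝓞 CbrtThree) ∈ J := by
    convert J.add_mem hβ (J.mul_mem_left (int (2 * N) 0 (3 * m ^ 2)) hα) using 1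
    rw [intCast_eq, int_mul, int_add]
    congr 1 <;> ring
  have h2 : ((243 * m ^ 4 : ℤ) : 𝓞 CbrtThree) ∈ J := by
    convert J.mul_mem_left (int 0 0 1) (J.add_mem hβ
      (J.mul_mem_left (int (-N) 0 (-6 * m ^ 2)) hα)) using 1
    rw [intCast_eq, int_mul, int_add, int_mul]
    congr 1 <;> ring
  have h4 : ((t ^ 2 : ℤ) : 𝓞 CbrtThree) ∈ J := by
    convert J.mul_mem_left (int (N ^ 2) (27 * m ^ 4) (3 * m ^ 2 * N)) hα using 1
    rw [intCast_eq, int_mul]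
    congr 1
    · linear_combination h
    · ring
    · ring
  have hc : IsCoprime (N ^ 2) (m ^ 4) := hNm.pow
  have ht : IsCoprime (t ^ 2) (3 ^ 5) := by
    refine IsCoprime.pow (IsCoprime.symm ((Int.prime_three.coprime_iff_not_dvd).2 fun hd => h3 ?_))
    apply Int.prime_three.dvd_of_dvd_pow (n := 3)
    rw [← h]
    exact dvd_add (dvd_pow hd (by norm_num)) ⟨81 * m ^ 6, by ring⟩
  obtain ⟨a, b, hab⟩ := hc
  obtain ⟨c, d, hcd⟩ := ht
  have h5 : (1 : 𝓞 CbrtThree) = (c : 𝓞 CbrtThree) * ((t ^ 2 : ℤ) : 𝓞 CbrtThree) +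
      (d * 81 * a : ℤ) * ((3 * N ^ 2 : ℤ) : 𝓞 CbrtThree) +
      (d * b : ℤ) * ((243 * m ^ 4 : ℤ) : 𝓞 CbrtThree) := by
    have : (1 : ℤ) = c * t ^ 2 + d * 81 * a * (3 * N ^ 2) + d * b * (243 * m ^ 4) := by
      linear_combination -hcd - d * 243 * hab
    exact_mod_cast congrArg (fun n : ℤ => (n : 𝓞 CbrtThree)) this
  rw [h5]
  exact J.add_mem (J.add_mem (J.mul_mem_left _ h4) (J.mul_mem_left _ h1)) (J.mul_mem_left _ h2)

/-- The 2-descent on `t² = N³ - 243 m⁶` in the integers of `ℚ(∛3)`. -/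
theorem two_descent {t N m : ℤ} (h : t ^ 2 + 243 * m ^ 6 = N ^ 3) (hNm : IsCoprime N m)
    (h3 : ¬(3 : ℤ) ∣ N) (ht : t ≠ 0) : ∃ p q r : ℤ,
    (N = p ^ 2 + 6 * q * r ∧ 2 * p * q + 3 * r ^ 2 = 0 ∧ q ^ 2 + 2 * p * r = -3 * m ^ 2) ∨
    (N = 3 * (2 * p * q + 3 * r ^ 2) - 2 * (p ^ 2 + 6 * q * r) ∧
      2 * (2 * p * q + 3 * r ^ 2) = 3 * (q ^ 2 + 2 * p * r) ∧
      p ^ 2 + 6 * q * r - 2 * (q ^ 2 + 2 * p * r) = -3 * m ^ 2) := by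
  have hprod : int N 0 (-3 * m ^ 2) * int (N ^ 2) (27 * m ^ 4) (3 * m ^ 2 * N) = int t 0 0 ^ 2 := by
    rw [int_sq, int_mul]
    congr 1
    · linear_combination -h
    · ring
    · ring
  obtain ⟨d, u, hd⟩ := exists_associated_pow_of_mul_eq_pow' (isCoprime_factors h hNm h3) hprod
  have hnorm : Algebra.norm ℤ (int N 0 (-3 * m ^ 2)) = t ^ 2 := by
    rw [norm_int]; linear_combination -h
  have hneg (γ : 𝓞 CbrtThree) : Algebra.norm ℤ (-γ) = -Algebra.norm ℤ γ := by
    obtain ⟨a, b, c, rfl⟩ := exists_int γ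
    rw [int_neg, norm_int, norm_int]; ring
  have heta : Algebra.norm ℤ (eta : 𝓞 CbrtThree) = 1 := by rw [coe_eta, norm_int]; norm_num
  have htpos : 0 < t ^ 2 := by positivity
  obtain ⟨v, hv⟩ := unit_mod_squares u
  obtain ⟨p, q, r, hγ⟩ := exists_int (d * v)
  refine ⟨p, q, r, ?_⟩
  rcases hv with rfl | rfl | rfl | rfl
  · left
    rw [Units.val_pow_eq_pow_val, ← mul_pow, hγ, int_sq] at hd
    obtain ⟨h0, h1, h2⟩ := int_inj hd
    exact ⟨h0.symm, h1, h2⟩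
  · exfalso
    rw [Units.val_neg, Units.val_pow_eq_pow_val, mul_neg, ← mul_pow] at hd
    rw [← hd, hneg, map_pow] at hnorm
    nlinarith [sq_nonneg (Algebra.norm ℤ (d * v))]
  · right
    rw [Units.val_mul, Units.val_pow_eq_pow_val, mul_left_comm, ← mul_pow, hγ, int_sq, coe_eta,
      int_mul] at hd
    obtain ⟨h0, h1, h2⟩ := int_inj hd
    exact ⟨by linear_combination -h0, by linear_combination -h1, by linear_combination h2⟩
  · exfalso
    rw [Units.val_neg, Units.val_mul, Units.val_pow_eq_pow_val, mul_neg, mul_left_comm,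
      ← mul_pow] at hd
    rw [← hd, hneg, map_mul, heta, map_pow] at hnorm
    nlinarith [sq_nonneg (Algebra.norm ℤ (d * v))]

end CbrtThree

end

lemma exists_signed_squares {a b c : ℤ} (hab : IsCoprime a b) (h : a * b = c ^ 2) (hc : c ≠ 0) :
    ∃ e u v : ℤ, e ^ 2 = 1 ∧ a = e * u ^ 2 ∧ b = e * v ^ 2 := by
  have hc2 : 0 < c ^ 2 := by positivity
  obtain ⟨u, hu⟩ := Int.sq_of_isCoprime hab h
  obtain ⟨v, hv⟩ := Int.sq_of_isCoprime hab.symm (by rw [mul_comm, h])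
  rcases hu with hu | hu <;> rcases hv with hv | hv
  · exact ⟨1, u, v, by norm_num, by rw [hu, one_mul], by rw [hv, one_mul]⟩
  · rw [hu, hv] at h
    nlinarith [sq_nonneg (u * v)]
  · rw [hu, hv] at h
    nlinarith [sq_nonneg (u * v)]
  · exact ⟨-1, u, v, by norm_num, by rw [hu]; ring, by rw [hv]; ring⟩

lemma mod_eight_of_prime_factors {n : ℕ} (hn : Odd n)
    (h : ∀ p : ℕ, p.Prime → p ∣ n → ¬(p % 8 = 5 ∨ p % 8 = 7)) : n % 8 = 1 ∨ n % 8 = 3 := by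
  induction n using induction_on_primes with
  | zero => simp at hn
  | one => simp
  | prime_mul p n hp ih =>
    obtain ⟨hp2, hn2⟩ := Nat.odd_mul.1 hn
    have h1 := ih hn2 fun q hq hqn => h q hq (hqn.mul_left p)
    have h2 := h p hp (dvd_mul_right p n)
    have h3 : p % 8 = 1 ∨ p % 8 = 3 := by
      have := Nat.odd_iff.1 hp2
      omega
    rw [Nat.mul_mod]
    rcases h1 with h1 | h1 <;> rcases h3 with h3 | h3 <;> simp [h1, h3]

lemma three_not_dvd {t N m : ℤ} (h : t ^ 2 + 243 * m ^ 6 = N ^ 3) (hNm : IsCoprime N m) :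
    ¬(3 : ℤ) ∣ N := by
  have h3 := Int.prime_three
  rintro ⟨n, rfl⟩
  obtain ⟨a, rfl⟩ : (3 : ℤ) ∣ t := h3.dvd_of_dvd_pow (n := 2) ⟨9 * n ^ 3 - 81 * m ^ 6, by linarith⟩
  obtain ⟨b, rfl⟩ : (3 : ℤ) ∣ a := h3.dvd_of_dvd_pow (n := 2) ⟨n ^ 3 - 9 * m ^ 6, by linarith⟩
  obtain ⟨k, rfl⟩ : (3 : ℤ) ∣ n := h3.dvd_of_dvd_pow (n := 3) ⟨b ^ 2 + 3 * m ^ 6, by linarith⟩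
  obtain ⟨c, rfl⟩ : (3 : ℤ) ∣ b := h3.dvd_of_dvd_pow (n := 2) ⟨3 * k ^ 3 - m ^ 6, by linarith⟩
  have hm : (3 : ℤ) ∣ m := h3.dvd_of_dvd_pow (n := 6) ⟨k ^ 3 - c ^ 2, by linarith⟩
  exact h3.not_isUnit (hNm.isUnit_of_dvd' (dvd_mul_right _ _) hm)

lemma odd_of_sq_add {t N m : ℤ} (h : t ^ 2 + 243 * m ^ 6 = N ^ 3) (hNm : IsCoprime N m) :
    Odd N := by
  by_contra hN
  obtain ⟨n, rfl⟩ := (Int.not_odd_iff_even.1 hN).two_dvd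
  have key : ∀ t m : ZMod 8, t ^ 2 + 243 * m ^ 6 = 0 → 4 * m = 0 := by decide
  have h8 : ((t ^ 2 + 243 * m ^ 6 : ℤ) : ZMod 8) = 0 := by
    rw [h, ZMod.intCast_zmod_eq_zero_iff_dvd]
    exact ⟨n ^ 3, by push_cast; ring⟩
  have hm := key t m (by exact_mod_cast h8)
  have hm' : ((4 * m : ℤ) : ZMod 8) = 0 := by exact_mod_cast hm
  rw [ZMod.intCast_zmod_eq_zero_iff_dvd] at hm'
  push_cast at hm'
  exact Int.prime_two.not_isUnit (hNm.isUnit_of_dvd' (dvd_mul_right _ _) (by omega))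

lemma mod_eight_of_nontrivial_class {N m p q r : ℤ} (hN : Odd N)
    (h0 : N = 3 * (2 * p * q + 3 * r ^ 2) - 2 * (p ^ 2 + 6 * q * r))
    (h1 : 2 * (2 * p * q + 3 * r ^ 2) = 3 * (q ^ 2 + 2 * p * r))
    (h2 : p ^ 2 + 6 * q * r - 2 * (q ^ 2 + 2 * p * r) = -3 * m ^ 2) : N % 8 = 7 := by
  obtain ⟨k, rfl⟩ : (2 : ℤ) ∣ q := Int.prime_two.dvd_of_dvd_pow (n := 2)
    ⟨2 * p * q + 3 * r ^ 2 - (q ^ 2 + 2 * p * r) - p * r, by linarith⟩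
  have hr : Odd r := by
    by_contra hr
    obtain ⟨l, rfl⟩ := (Int.not_odd_iff_even.1 hr).two_dvd
    obtain ⟨w, rfl⟩ := hN
    have : 2 * w + 1 = 2 * (6 * p * k + 18 * l ^ 2 - (p ^ 2 + 6 * (2 * k) * (2 * l))) := by
      linear_combination h0
    omega
  have hp : Odd p := by
    by_contra hp
    obtain ⟨l, rfl⟩ := (Int.not_odd_iff_even.1 hp).two_dvd
    obtain ⟨w, rfl⟩ := hr
    have : 3 * (2 * (2 * (w ^ 2 + w)) + 1) = 2 * (3 * k ^ 2 - 4 * k * l + 3 * l * (2 * w + 1)) := by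
      linarith
    omega
  have hm : Odd m := by
    by_contra hm
    obtain ⟨l, rfl⟩ := (Int.not_odd_iff_even.1 hm).two_dvd
    obtain ⟨w, rfl⟩ := hp
    have : 2 * (2 * (w ^ 2 + w) + 6 * k * r - 4 * k ^ 2 - 2 * (2 * w + 1) * r + 6 * l ^ 2) + 1 =
        0 := by
      linarith
    omega
  obtain ⟨c, hc⟩ := Int.eight_dvd_sq_sub_one_of_odd hm
  obtain ⟨a, ha⟩ := Int.eight_dvd_sq_sub_one_of_odd hp
  obtain ⟨b, hb⟩ := Int.eight_dvd_sq_sub_one_of_odd hr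
  obtain ⟨w, hw⟩ := hp.mul hr
  obtain ⟨v, rfl⟩ := hr
  have hk : (2 : ℤ) ∣ k := by
    have : 8 * (a + 3 * k * v - k ^ 2 - w + 3 * c) + 12 * k = 0 := by linarith
    omega
  obtain ⟨j, rfl⟩ := hk
  have h4 : 8 * (p * j + 3 * b - 3 * j ^ 2) = 6 * w := by linarith
  have h5 : N = 8 * (j ^ 2 + 6 * c) + 2 * w + 7 := by linarith
  omega

/-- The trivial class of the 2-descent on `t² + 243 m⁶ = N³` produces a smaller solution. -/
lemma exists_smaller_solution {N m p q r : ℤ} (hNm : IsCoprime N m) (h3 : ¬(3 : ℤ) ∣ N) (hN : Odd N)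
    (hm : m ≠ 0) (h0 : N = p ^ 2 + 6 * q * r) (h1 : 2 * p * q + 3 * r ^ 2 = 0)
    (h2 : q ^ 2 + 2 * p * r = -3 * m ^ 2) :
    ∃ t' N' m' : ℤ, t' ^ 2 + 243 * m' ^ 6 = N' ^ 3 ∧ IsCoprime N' m' ∧ m' ≠ 0 ∧
      m'.natAbs < m.natAbs ∧ N' ∣ N := by
  have pr3 := Int.prime_three
  obtain ⟨k, rfl⟩ : (2 : ℤ) ∣ r :=
    Int.prime_two.dvd_of_dvd_pow (n := 2) ⟨-p * q - r ^ 2, by linarith⟩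
  have hp3 : ¬(3 : ℤ) ∣ p := fun hd =>
    h3 (h0 ▸ dvd_add (dvd_pow hd two_ne_zero) ⟨4 * q * k, by ring⟩)
  have hp2 : ¬(2 : ℤ) ∣ p := fun ⟨u, hu⟩ => by
    rw [hu] at h0
    have : N = 2 * (2 * u ^ 2 + 6 * q * k) := by linear_combination h0
    rw [Int.odd_iff] at hN
    omega
  have h1' : p * q = 2 * (-3 * k ^ 2) := by linarith
  obtain ⟨l, rfl⟩ := (Int.prime_two.dvd_or_dvd ⟨_, h1'⟩).resolve_left hp2
  have h1' : p * l = 3 * (-k ^ 2) := by linarith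
  obtain ⟨l, rfl⟩ := (pr3.dvd_or_dvd ⟨_, h1'⟩).resolve_left hp3
  obtain ⟨n, rfl⟩ : (2 : ℤ) ∣ m := Int.prime_two.dvd_of_dvd_pow (n := 2)
    ⟨-18 * l ^ 2 - 2 * p * k - m ^ 2, by linarith⟩
  have h1 : p * -l = k ^ 2 := by linarith
  have h2 : 9 * l ^ 2 + p * k = -3 * n ^ 2 := by linarith
  have hcop : IsCoprime p (-l) := by
    refine isCoprime_of_prime_dvd (fun h => hp2 (h.1 ▸ dvd_zero 2)) fun g hg hgp hgl => ?_
    rw [dvd_neg] at hgl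
    have hgN : g ∣ N := by
      rw [h0, pow_two]
      exact dvd_add (hgp.mul_left p) (hgl.trans ⟨72 * k, by ring⟩)
    have hgn : g ∣ 3 * n ^ 2 := by
      rw [show 3 * n ^ 2 = -(9 * l * l + k * p) by linarith, dvd_neg]
      exact dvd_add (hgl.mul_left _) (hgp.mul_left _)
    rcases hg.dvd_or_dvd hgn with h | h
    · exact hp3 (((hg.dvd_prime_iff_associated pr3).1 h).symm.dvd.trans hgp)
    · exact hg.not_isUnit (hNm.isUnit_of_dvd' hgN ((hg.dvd_of_dvd_pow h).mul_left 2))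
  have hk : k ≠ 0 := by
    rintro rfl
    have hp0 : p ≠ 0 := by rintro rfl; simp at hp2
    have : l = 0 := by simpa [hp0] using h1
    subst this
    apply hm
    have : n ^ 2 = 0 := by linarith
    simpa using this
  obtain ⟨e, A, B, he, rfl, hl⟩ := exists_signed_squares hcop h1 hk
  obtain ⟨B, hkB, hl⟩ : ∃ B, k = A * B ∧ l = -e * B ^ 2 := by
    have : k ^ 2 = (A * B) ^ 2 := by rw [← h1, hl]; linear_combination A ^ 2 * B ^ 2 * he
    rcases sq_eq_sq_iff_eq_or_eq_neg.1 this with h | h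
    · exact ⟨B, h, by linear_combination -hl⟩
    · exact ⟨-B, by rw [h]; ring, by linear_combination -hl⟩
  subst hkB hl
  have h2 : B * (9 * B ^ 3 + e * A ^ 3) = 3 * (-n ^ 2) := by
    linear_combination h2 - 9 * B ^ 4 * he
  have hA3 : ¬(3 : ℤ) ∣ A := fun hd => hp3 ((dvd_pow hd two_ne_zero).mul_left e)
  have hB3 : (3 : ℤ) ∣ B := by
    rcases pr3.dvd_or_dvd ⟨_, h2⟩ with h | h
    · exact h
    · exfalso
      apply hA3
      apply pr3.dvd_of_dvd_pow (n := 3)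
      have : e * (9 * B ^ 3 + e * A ^ 3) = A ^ 3 + 3 * (3 * e * B ^ 3) := by
        linear_combination A ^ 3 * he
      rw [← Int.dvd_add_left (dvd_mul_right 3 (3 * e * B ^ 3)), ← this]
      exact h.mul_left e
  obtain ⟨B, rfl⟩ := hB3
  have hAB : IsCoprime A B := by
    have h := hcop
    rw [show -(-e * (3 * B) ^ 2) = B * (e * 9 * B) by ring, pow_two, mul_left_comm] at h
    exact h.of_mul_left_left.of_mul_right_left
  have hn : n ≠ 0 := by rintro rfl; simp at hm
  have h2 : -B * (e * A ^ 3 + (243 * B ^ 2) * B) = n ^ 2 := by linarith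
  have heu : IsCoprime e B := ⟨e, 0, by linear_combination he⟩
  have hcop2 : IsCoprime (-B) (e * A ^ 3 + (243 * B ^ 2) * B) := by
    rw [IsCoprime.neg_left_iff, IsCoprime.add_mul_right_right_iff]
    exact (heu.mul_left hAB.pow_left).symm
  obtain ⟨d, b, w, hd, hb, hw⟩ := exists_signed_squares hcop2 h2 hn
  obtain rfl : B = -(d * b ^ 2) := by linear_combination -hb
  refine ⟨w, d * e * A, b, ?_, ?_, ?_, ?_, ?_⟩
  · have h3 : (d * e * A) ^ 3 = d * e * A ^ 3 := by
      linear_combination A ^ 3 * (d * e ^ 3 * hd + d * e * he)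
    linear_combination -h3 - d * hw - (243 * b ^ 6 * (d ^ 2 + 1) + w ^ 2) * hd
  · have : IsCoprime A b := by
      rw [IsCoprime.neg_right_iff, pow_two, mul_left_comm] at hAB
      exact hAB.of_mul_right_left
    have hu : IsUnit (d * e) := IsUnit.of_mul_eq_one (d * e) (by linear_combination e ^ 2 * hd + he)
    exact (isCoprime_mul_unit_left_left hu _ _).2 this
  · rintro rfl
    simp at hk
  · rw [Int.natAbs_lt_iff_sq_lt]
    have hn2 : n ^ 2 = b ^ 2 * w ^ 2 := by
      rw [← h2, hw]
      linear_combination b ^ 2 * w ^ 2 * hd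
    have hw0 : w ≠ 0 := by
      rintro rfl
      simp [hn] at hn2
    have hb2 : 0 ≤ b ^ 2 := sq_nonneg b
    have hw2 : 0 < w ^ 2 := by positivity
    have hnpos : 0 < n ^ 2 := by positivity
    nlinarith
  · refine ⟨d * e * (e ^ 2 * A ^ 3 + 1944 * e * d ^ 3 * b ^ 6), ?_⟩
    rw [h0]
    have : (d * e) ^ 2 = 1 := by linear_combination e ^ 2 * hd + he
    linear_combination -A * (e ^ 2 * A ^ 3 + 1944 * e * d ^ 3 * b ^ 6) * this

/-- If `t² + 243 m⁶ = N³` with `N`, `m` coprime and `m ≠ 0`, then `N` has a prime factor modulo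
which `-2` is not a square. -/
theorem exists_prime_mod_eight_dvd {t N m : ℤ} (h : t ^ 2 + 243 * m ^ 6 = N ^ 3)
    (hNm : IsCoprime N m) (hm : m ≠ 0) :
    ∃ p : ℕ, p.Prime ∧ (p % 8 = 5 ∨ p % 8 = 7) ∧ (p : ℤ) ∣ N := by
  induction hn : m.natAbs using Nat.strong_induction_on generalizing t N m with
  | _ n ih =>
    subst hn
    have h3 := three_not_dvd h hNm
    have hN := odd_of_sq_add h hNm
    have ht : t ≠ 0 := by
      rintro rfl
      exact h3 (Int.prime_three.dvd_of_dvd_pow (n := 3) ⟨81 * m ^ 6, by linarith⟩)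
    obtain ⟨p, q, r, ⟨h0, h1, h2⟩ | ⟨h0, h1, h2⟩⟩ := CbrtThree.two_descent h hNm h3 ht
    · obtain ⟨t', N', m', h', hc, hm', hlt, hd⟩ := exists_smaller_solution hNm h3 hN hm h0 h1 h2
      obtain ⟨l, hl, hl8, hlN⟩ := ih _ hlt h' hc hm' rfl
      exact ⟨l, hl, hl8, hlN.trans hd⟩
    · have h7 := mod_eight_of_nontrivial_class hN h0 h1 h2
      have hpos : 0 < N := by
        have : 0 < N ^ 3 := by rw [← h]; positivity
        exact (Odd.pow_pos_iff (by decide)).1 this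
      lift N to ℕ using hpos.le
      by_contra! hcon
      have := mod_eight_of_prime_factors (n := N) (by exact_mod_cast hN) fun p hp hpn hp8 =>
        hcon p hp hp8 (by exact_mod_cast hpn)
      omega

lemma exists_integral_model {X Y : ℚ} (h : Y ^ 2 = X ^ 3 - 243) : ∃ t N m : ℤ,
    t ^ 2 + 243 * m ^ 6 = N ^ 3 ∧ IsCoprime N m ∧ m ≠ 0 ∧ X * m ^ 2 = N := by
  have hd : (X.den : ℚ) ≠ 0 := by exact_mod_cast X.den_ne_zero
  have hX : X * X.den = X.num := Rat.mul_den_eq_num X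
  have hsq : ((X.den * (X.num ^ 3 - 243 * X.den ^ 3) : ℤ) : ℚ) = (Y * X.den ^ 2) ^ 2 := by
    push_cast
    rw [mul_pow, h, ← hX]
    ring
  have : IsSquare ((X.den * (X.num ^ 3 - 243 * X.den ^ 3) : ℤ) : ℚ) := ⟨_, hsq.trans (pow_two _)⟩
  obtain ⟨T, hT⟩ := Rat.isSquare_intCast_iff.1 this
  rw [← pow_two] at hT
  have hcop : IsCoprime (X.num : ℤ) X.den := by
    rw [Int.isCoprime_iff_gcd_eq_one]
    exact X.reduced
  have hcop2 : IsCoprime (X.den : ℤ) (X.num ^ 3 - 243 * X.den ^ 3) := by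
    rw [show X.num ^ 3 - 243 * (X.den : ℤ) ^ 3 = X.num ^ 3 + (-243 * X.den ^ 2) * X.den by ring,
      IsCoprime.add_mul_right_right_iff]
    exact hcop.symm.pow_right
  have hden : 0 < (X.den : ℤ) := by exact_mod_cast X.den_pos
  obtain ⟨m, hm⟩ := Int.sq_of_isCoprime hcop2 hT
  replace hm : (X.den : ℤ) = m ^ 2 := hm.resolve_right fun h => by nlinarith [sq_nonneg m]
  obtain ⟨t, ht⟩ := Int.sq_of_isCoprime hcop2.symm (by rw [mul_comm, hT])
  replace ht : X.num ^ 3 - 243 * (X.den : ℤ) ^ 3 = t ^ 2 := by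
    rcases ht with ht | ht
    · exact ht
    · rw [ht] at hT ⊢
      nlinarith [sq_nonneg T, sq_nonneg t]
  refine ⟨t, X.num, m, ?_, ?_, ?_, ?_⟩
  · rw [← ht, hm]; ring
  · rw [hm] at hcop
    exact (IsCoprime.pow_right_iff two_pos).1 hcop
  · rintro rfl
    simp at hm
  · rw [← hX]
    congr 1
    exact_mod_cast hm.symm

lemma eq_of_tangent {a b c w : ℤ} (hl : 3 * a - 2 * c - b = 0)
    (h : 3 * a ^ 3 = 2 * c ^ 3 + b ^ 3) (hw : a ^ 2 - a * b + b ^ 2 = w ^ 2) : a = b ∧ a = c := by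
  obtain rfl : b = 3 * a - 2 * c := by linarith
  have h2 : (a - c) ^ 2 * (4 * a - c) = 0 := by linarith
  rcases mul_eq_zero.1 h2 with h2 | h2
  · have : a - c = 0 := by simpa using h2
    constructor <;> linarith
  · obtain rfl : c = 4 * a := by linarith
    suffices a = 0 by subst this; simp
    by_contra ha
    have hw' : w ^ 2 = a ^ 2 * 31 := by linarith
    obtain ⟨k, rfl⟩ := (Int.pow_dvd_pow_iff two_ne_zero).1 ⟨_, hw'⟩
    have hk : k ^ 2 = 31 := by
      rw [mul_pow] at hw'
      exact mul_left_cancel₀ (pow_ne_zero 2 ha) hw'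
    have h1 : k < 6 := by nlinarith
    have h2 : -6 < k := by nlinarith
    interval_cases k <;> omega

/-- The cubic `3a³ = 2c³ + b³` has no primitive integral points other than `±(1, 1, 1)` at which
`a² - ab + b²` is a square. -/
theorem eq_of_cubic_of_sq {a b c w : ℤ}
    (hprim : ∀ p : ℕ, p.Prime → ¬((p : ℤ) ∣ a ∧ (p : ℤ) ∣ b ∧ (p : ℤ) ∣ c))
    (h : 3 * a ^ 3 = 2 * c ^ 3 + b ^ 3) (hw : a ^ 2 - a * b + b ^ 2 = w ^ 2) : a = b ∧ a = c := by
  by_cases hl : 3 * a - 2 * c - b = 0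
  · exact eq_of_tangent hl h hw
  exfalso
  have hlQ : ((3 * a - 2 * c - b : ℤ) : ℚ) ≠ 0 := by exact_mod_cast hl
  have hq : 3 * (3 * a - 2 * c - b) * (24 * (a + b + c) ^ 3 - (3 * a - 2 * c - b) ^ 3) =
      (9 * a ^ 2 + 15 * b ^ 2 - 24 * c ^ 2) ^ 2 := by
    linear_combination (-36 * a + 300 * b + 384 * c) * h
  have hU : (3 * a - 2 * c - b) * (b ^ 2 + b * c + c ^ 2) =
      -((a + b + c) * (3 * (a - b) * (a - c))) := by
    linear_combination h
  set l := 3 * a - 2 * c - b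
  set Q := 9 * a ^ 2 + 15 * b ^ 2 - 24 * c ^ 2
  have hS : a + b + c ≠ 0 := by
    intro h0
    rw [h0] at hq
    have : 0 < l ^ 4 := by positivity
    nlinarith [sq_nonneg Q]
  obtain ⟨t, N, m, htN, hNm, hm, hX⟩ := exists_integral_model
    (X := 18 * ((a + b + c : ℤ) : ℚ) / (l : ℚ)) (Y := 9 * (Q : ℚ) / (l : ℚ) ^ 2) (by
      have : 3 * (l : ℚ) * (24 * ((a + b + c : ℤ) : ℚ) ^ 3 - (l : ℚ) ^ 3) = (Q : ℚ) ^ 2 := by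
        exact_mod_cast hq
      field_simp
      linear_combination -81 * this)
  have hNl : N * l = 18 * (a + b + c) * m ^ 2 := by
    rw [div_mul_eq_mul_div, div_eq_iff hlQ] at hX
    exact_mod_cast hX.symm
  obtain ⟨p, hp, hp8, hpN⟩ := exists_prime_mod_eight_dvd htN hNm hm
  have hpZ : Prime (p : ℤ) := Nat.prime_iff_prime_int.1 hp
  have hp18 : ¬(p : ℤ) ∣ 18 := by
    intro hd
    have hd' : p ∣ 18 := by exact_mod_cast hd
    have := Nat.le_of_dvd (by norm_num) hd'
    interval_cases p <;> omega
  have hpm : ¬(p : ℤ) ∣ m := fun hd => hpZ.not_isUnit (hNm.isUnit_of_dvd' hpN hd)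
  have hpS : (p : ℤ) ∣ a + b + c := by
    have hd : (p : ℤ) ∣ 18 * (a + b + c) * m ^ 2 := hNl ▸ hpN.mul_right l
    rcases hpZ.dvd_or_dvd hd with hd | hd
    · exact (hpZ.dvd_or_dvd hd).resolve_left hp18
    · exact absurd (hpZ.dvd_of_dvd_pow hd) hpm
  have hpU : (p : ℤ) ∣ b ^ 2 + b * c + c ^ 2 := by
    have heq : 18 * m ^ 2 * (b ^ 2 + b * c + c ^ 2) = N * -(3 * (a - b) * (a - c)) := by
      apply mul_left_cancel₀ hS
      linear_combination N * hU - (b ^ 2 + b * c + c ^ 2) * hNl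
    have hd : (p : ℤ) ∣ 18 * m ^ 2 * (b ^ 2 + b * c + c ^ 2) := heq ▸ hpN.mul_right _
    rcases hpZ.dvd_or_dvd hd with hd | hd
    · rcases hpZ.dvd_or_dvd hd with hd | hd
      · exact absurd hd hp18
      · exact absurd (hpZ.dvd_of_dvd_pow hd) hpm
    · exact hd
  have hpc : ¬(p : ℤ) ∣ c := by
    intro hc
    have hb : (p : ℤ) ∣ b := by
      apply hpZ.dvd_of_dvd_pow (n := 2)
      rw [show b ^ 2 = b ^ 2 + b * c + c ^ 2 - c * (b + c) by ring]
      exact dvd_sub hpU (hc.mul_right _)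
    have ha : (p : ℤ) ∣ a := by
      rw [show a = a + b + c - b - c by ring]
      exact dvd_sub (dvd_sub hpS hb) hc
    exact hprim p hp ⟨ha, hb, hc⟩
  have := Fact.mk hp
  have hsq : IsSquare (-2 : ZMod p) := by
    have hc0 : (c : ZMod p) ≠ 0 := by rwa [Ne, ZMod.intCast_zmod_eq_zero_iff_dvd]
    have hS0 : (a + b + c : ZMod p) = 0 := by
      exact_mod_cast (ZMod.intCast_zmod_eq_zero_iff_dvd _ p).2 hpS
    have hU0 : (b ^ 2 + b * c + c ^ 2 : ZMod p) = 0 := by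
      exact_mod_cast (ZMod.intCast_zmod_eq_zero_iff_dvd _ p).2 hpU
    have hw0 : (a ^ 2 - a * b + b ^ 2 : ZMod p) = w ^ 2 := by exact_mod_cast congrArg _ hw
    refine ⟨w / c, ?_⟩
    field_simp
    linear_combination hw0 - 3 * hU0 - (a - 2 * b - c : ZMod p) * hS0
  have hp2 : p ≠ 2 := by rintro rfl; omega
  have := (ZMod.exists_sq_eq_neg_two_iff hp2).1 hsq
  omega

lemma exists_primitive_triple {A B C : ℤ} (h : ¬(A = 0 ∧ B = 0)) : ∃ g a b c : ℤ, g ≠ 0 ∧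
    A = g * a ∧ B = g * b ∧ C = g * c ∧
    ∀ p : ℕ, p.Prime → ¬((p : ℤ) ∣ a ∧ (p : ℤ) ∣ b ∧ (p : ℤ) ∣ c) := by
  have hg : gcd A (gcd B C) ≠ 0 := by
    rw [Ne, gcd_eq_zero_iff, gcd_eq_zero_iff]
    tauto
  obtain ⟨a, ha⟩ := gcd_dvd_left A (gcd B C)
  obtain ⟨b, hb⟩ := (gcd_dvd_right A (gcd B C)).trans (gcd_dvd_left B C)
  obtain ⟨c, hc⟩ := (gcd_dvd_right A (gcd B C)).trans (gcd_dvd_right B C)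
  refine ⟨_, a, b, c, hg, ha, hb, hc, fun p hp ⟨h1, h2, h3⟩ => ?_⟩
  have hd : gcd A (gcd B C) * p ∣ gcd A (gcd B C) * 1 := by
    rw [mul_one]
    refine dvd_gcd ?_ (dvd_gcd ?_ ?_)
    · conv_rhs => rw [ha]
      exact mul_dvd_mul_left _ h1
    · conv_rhs => rw [hb]
      exact mul_dvd_mul_left _ h2
    · conv_rhs => rw [hc]
      exact mul_dvd_mul_left _ h3
  exact (Nat.prime_iff_prime_int.1 hp).not_isUnit
    (isUnit_of_dvd_one ((mul_dvd_mul_iff_left hg).1 hd))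

/-- The only solutions of
`3x⁶ + 18x⁵y + 9x⁴y² - 148x³y³ - 27x²y⁴ + 162xy⁵ - 81y⁶ = 2z³` in integers with
`gcd(x, y) = 1` are `(x, y, z) = (1, -1, -4), (-1, 1, -4), (3, 1, 12), (-3, -1, 12)`. -/
theorem sextic_eq_two_z_cubed (x y z : ℤ) (hgcd : Int.gcd x y = 1)
    (heq : 3 * x ^ 6 + 18 * x ^ 5 * y + 9 * x ^ 4 * y ^ 2 - 148 * x ^ 3 * y ^ 3
      - 27 * x ^ 2 * y ^ 4 + 162 * x * y ^ 5 - 81 * y ^ 6 = 2 * z ^ 3) :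
    (x = 1 ∧ y = -1 ∧ z = -4) ∨ (x = -1 ∧ y = 1 ∧ z = -4) ∨
    (x = 3 ∧ y = 1 ∧ z = 12) ∨ (x = -3 ∧ y = -1 ∧ z = 12) := by
  have hcub : 3 * (x ^ 2 + 2 * x * y - 3 * y ^ 2) ^ 3 = 2 * z ^ 3 + (4 * x * y) ^ 3 := by
    linear_combination heq
  have hsq : (x ^ 2 + 2 * x * y - 3 * y ^ 2) ^ 2 - (x ^ 2 + 2 * x * y - 3 * y ^ 2) * (4 * x * y) +
      (4 * x * y) ^ 2 = (x ^ 2 + 3 * y ^ 2) ^ 2 := by ring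
  have hne : ¬(x ^ 2 + 2 * x * y - 3 * y ^ 2 = 0 ∧ 4 * x * y = 0) := by
    rintro ⟨h1, h2⟩
    rw [h1, h2] at hsq
    have h0 : x ^ 2 + 3 * y ^ 2 = 0 := by
      rw [← sq_eq_zero_iff, ← hsq]; norm_num
    have hx : x = 0 := by nlinarith [sq_nonneg x, sq_nonneg y]
    have hy : y = 0 := by nlinarith [sq_nonneg x, sq_nonneg y]
    simp [hx, hy] at hgcd
  obtain ⟨g, a, b, c, hg, ha, hb, rfl, hprim⟩ := exists_primitive_triple (C := z) hne
  rw [ha, hb] at hcub hsq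
  have hsq' : (x ^ 2 + 3 * y ^ 2) ^ 2 = g ^ 2 * (a ^ 2 - a * b + b ^ 2) := by
    linear_combination -hsq
  obtain ⟨w, hw⟩ := (Int.pow_dvd_pow_iff two_ne_zero).1 ⟨_, hsq'⟩
  have hsq2 : a ^ 2 - a * b + b ^ 2 = w ^ 2 :=
    mul_left_cancel₀ (pow_ne_zero 2 hg) (by rw [← hsq', hw]; ring)
  have hcub2 : 3 * a ^ 3 = 2 * c ^ 3 + b ^ 3 :=
    mul_left_cancel₀ (pow_ne_zero 3 hg) (by linear_combination hcub)
  obtain ⟨rfl, rfl⟩ := eq_of_cubic_of_sq hprim hcub2 hsq2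
  rw [← hb] at ha ⊢
  have hxy : (x - 3 * y) * (x + y) = 0 := by linear_combination ha
  have hunit (k : ℤ) (hk : x = y * k) : y = 1 ∨ y = -1 := by
    apply Int.isUnit_iff.1
    exact (Int.isCoprime_iff_gcd_eq_one.2 hgcd).isUnit_of_dvd' ⟨k, hk⟩ dvd_rfl
  rcases mul_eq_zero.1 hxy with h | h
  · obtain rfl : x = 3 * y := by linarith
    rcases hunit 3 (mul_comm _ _) with rfl | rfl <;> norm_num
  · obtain rfl : x = -y := by linarith
    rcases hunit (-1) (by ring) with rfl | rfl <;> norm_num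
end
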